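/- arXiv:1603.03139 — 4 statements merged into one kernel-verified Lean document; each statement's English description precedes it below -/
import Mathlib

section
/- Let g ∈ H^1_loc(ℝ^d) with g, ∇g ∈ L²_{loc,unif}(ℝ^d), and let u(x,t) = (g * Φ_t)(x) where Φ_t is the standard heat kernel at time t. Then for any 0 < R < ∞, ‖g‖_{S²_R} ≤ C { ‖u(·, R²)‖_∞ + R ‖∇g‖_{S²_R} }, where C depends only on d. -/
open MeasureTheory Metric Filter Real
noncomputable section

/-- Euclidean space `ℝ^d`. -/
abbrev Ed (d : ℕ) := EuclideanSpace ℝ (Fin d)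

/-- The closed cube centered at `x` with side length `R`. -/
def cube {d : ℕ} (x : Ed d) (R : ℝ) : Set (Ed d) := {y | ∀ i, |y i - x i| ≤ R / 2}

/-- The uniform local `L²` norm `‖f‖_{S²_R}` over balls of radius `R`. -/
def S2 {d : ℕ} (R : ℝ) (f : Ed d → ℝ) : ℝ :=
  ⨆ x : Ed d, (⨍ y in ball x R, (f y) ^ 2) ^ (1/2 : ℝ)

/-- The uniform local `L²` norm at scale `R` for vector-valued functions. -/
def S2v {d : ℕ} {F : Type*} [NormedAddCommGroup F] (R : ℝ) (f : Ed d → F) : ℝ :=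
  ⨆ x : Ed d, (⨍ y in ball x R, ‖f y‖ ^ 2) ^ (1/2 : ℝ)

/-- The standard heat kernel `Φ_t(y) = (4πt)^{-d/2} exp(-|y|²/(4t))`. -/
def heatK (d : ℕ) (t : ℝ) (y : Ed d) : ℝ :=
  (4 * π * t) ^ (-(d : ℝ) / 2) * Real.exp (-‖y‖ ^ 2 / (4 * t))

/-- The heat extension `u(x,t) = (g * Φ_t)(x)`. -/
def heatConv {d : ℕ} (g : Ed d → ℝ) (x : Ed d) (t : ℝ) : ℝ :=
  ∫ y, g y * heatK d t (x - y)

lemma lintegral_sq_le_aux {α : Type*} [MeasurableSpace α] (μ : Measure α) [IsProbabilityMeasure μ]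
    (f : α → ENNReal) (hf : AEMeasurable f μ) : (∫⁻ a, f a ∂μ) ^ 2 ≤ ∫⁻ a, (f a) ^ 2 ∂μ := by
  have h := ENNReal.lintegral_mul_le_Lp_mul_Lq μ Real.HolderConjugate.two_two hf
    (aemeasurable_const (b := (1 : ENNReal)))
  simp only [Pi.mul_apply, mul_one, ENNReal.one_rpow, lintegral_const, measure_univ] at h
  calc (∫⁻ a, f a ∂μ) ^ 2 ≤ ((∫⁻ a, f a ^ (2:ℝ) ∂μ) ^ (1 / 2 : ℝ)) ^ 2 := by gcongr
    _ = ∫⁻ a, (f a) ^ 2 ∂μ := by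
      rw [← ENNReal.rpow_natCast, ← ENNReal.rpow_mul]
      norm_num

lemma gauss_lint {d : ℕ} (b : ℝ) (hb : 0 < b) :
    ∫⁻ z : Ed d, ENNReal.ofReal (Real.exp (-b * ‖z‖ ^ 2)) = ENNReal.ofReal ((π / b) ^ ((d : ℝ) / 2)) := by
  have h := GaussianFourier.integral_rexp_neg_mul_sq_norm (V := Ed d) hb
  rw [finrank_euclideanSpace_fin] at h
  rw [← h, ofReal_integral_eq_lintegral_ofReal]
  · by_contra hc
    rw [integral_undef hc] at h
    have : 0 < (π / b) ^ ((d : ℝ) / 2) := by positivity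
    linarith
  · exact ae_of_all _ fun _ => by positivity

lemma unif_bound {d : ℕ} (t : ℝ) (ht : 0 < t) (M : ENNReal) (hM : M ≠ ⊤) :
    ∃ K : ENNReal, K ≠ ⊤ ∧ ∀ h : Ed d → ENNReal, Measurable h →
      (∀ x, ∫⁻ y in ball x 1, h y ≤ M) →
      ∀ x : Ed d, ∫⁻ y, h y * ENNReal.ofReal (Real.exp (-‖x - y‖ ^ 2 / (4 * t))) ≤ K := by
  obtain ⟨V, hV⟩ : ∃ V : ENNReal, V = volume (ball (0 : Ed d) 1) := ⟨_, rfl⟩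
  have hV0 : V ≠ 0 := hV ▸ (measure_ball_pos _ _ one_pos).ne'
  have hVt : V ≠ ⊤ := hV ▸ measure_ball_lt_top.ne
  have hVx : ∀ x : Ed d, volume (ball x 1) = V := fun x => by
    rw [hV, Measure.addHaar_ball_center]
  obtain ⟨c, hc⟩ : ∃ c : ENNReal, c = ENNReal.ofReal (Real.exp (1 / (4 * t))) := ⟨_, rfl⟩
  have hct : c ≠ ⊤ := hc ▸ ENNReal.ofReal_ne_top
  obtain ⟨e2, he⟩ : ∃ e2 : Ed d → ENNReal, e2 = fun z => ENNReal.ofReal (Real.exp (-(1 / (8 * t)) * ‖z‖ ^ 2)) := ⟨_, rfl⟩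
  have he2 : Measurable e2 := by rw [he]; fun_prop
  refine ⟨V⁻¹ * c * (ENNReal.ofReal ((π / (1 / (8 * t))) ^ ((d : ℝ) / 2))) * M, ?_, ?_⟩
  · refine ENNReal.mul_ne_top (ENNReal.mul_ne_top (ENNReal.mul_ne_top ?_ hct) ENNReal.ofReal_ne_top) hM
    simpa using hV0
  intro h hh hM x
  have key : ∀ y : Ed d, ENNReal.ofReal (Real.exp (-‖x - y‖ ^ 2 / (4 * t))) ≤
      V⁻¹ * ∫⁻ z, (ball y 1).indicator (fun z => c * e2 (x - z)) z := by
    intro y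
    rw [lintegral_indicator measurableSet_ball]
    calc ENNReal.ofReal (Real.exp (-‖x - y‖ ^ 2 / (4 * t)))
        = V⁻¹ * ∫⁻ z in ball y 1, ENNReal.ofReal (Real.exp (-‖x - y‖ ^ 2 / (4 * t))) := by
          rw [setLIntegral_const, hVx, mul_comm (ENNReal.ofReal _), ← mul_assoc,
            ENNReal.inv_mul_cancel hV0 hVt, one_mul]
      _ ≤ _ := by
          refine mul_le_mul' le_rfl ?_
          have hcm : Measurable fun z => c * e2 (x - z) := by fun_prop
          refine setLIntegral_mono hcm fun z hz => ?_
          rw [mem_ball, dist_eq_norm] at hz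
          simp only [hc, he]
          rw [← ENNReal.ofReal_mul (by positivity), ← Real.exp_add]
          apply ENNReal.ofReal_le_ofReal
          apply Real.exp_le_exp.2
          have h1 : ‖x - z‖ ≤ ‖x - y‖ + 1 := by
            calc ‖x - z‖ = ‖(x - y) - (z - y)‖ := by congr 1; abel
              _ ≤ ‖x - y‖ + ‖z - y‖ := norm_sub_le _ _
              _ ≤ _ := by linarith
          have h2 : ‖x - z‖ ^ 2 ≤ 2 * ‖x - y‖ ^ 2 + 2 := by
            have := norm_nonneg (x - z)
            nlinarith [sq_nonneg (‖x - y‖ - 1)]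
          have : 1 / (4 * t) + -(1 / (8 * t)) * ‖x - z‖ ^ 2 - (-‖x - y‖ ^ 2 / (4 * t))
            = (2 * ‖x - y‖ ^ 2 + 2 - ‖x - z‖ ^ 2) / (8 * t) := by field_simp; ring
          have h3 : 0 ≤ (2 * ‖x - y‖ ^ 2 + 2 - ‖x - z‖ ^ 2) / (8 * t) := by
            apply div_nonneg <;> linarith
          linarith
  have hce : Measurable fun z => c * e2 (x - z) := by fun_prop
  have hind : Measurable fun p : Ed d × Ed d => (ball p.1 1).indicator (fun z => c * e2 (x - z)) p.2 := by
    have : (fun p : Ed d × Ed d => (ball p.1 1).indicator (fun z => c * e2 (x - z)) p.2)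
      = {p : Ed d × Ed d | dist p.2 p.1 < 1}.indicator (fun p => c * e2 (x - p.2)) := by
      ext p; simp [Set.indicator, mem_ball]
    rw [this]
    refine Measurable.indicator (by fun_prop) ?_
    exact measurableSet_lt (by fun_prop) (by fun_prop)
  calc ∫⁻ y, h y * ENNReal.ofReal (Real.exp (-‖x - y‖ ^ 2 / (4 * t)))
      ≤ ∫⁻ y, V⁻¹ * ∫⁻ z, h y * (ball y 1).indicator (fun z => c * e2 (x - z)) z := by
        refine lintegral_mono fun y => ?_
        have hmy : Measurable ((ball y 1).indicator (fun z => c * e2 (x - z))) :=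
          (hce).indicator measurableSet_ball
        calc _ ≤ h y * (V⁻¹ * ∫⁻ z, (ball y 1).indicator (fun z => c * e2 (x - z)) z) :=
              mul_le_mul' le_rfl (key y)
          _ = _ := by rw [lintegral_const_mul (h y) hmy, mul_left_comm]
    _ = V⁻¹ * ∫⁻ z, ∫⁻ y, h y * (ball y 1).indicator (fun z => c * e2 (x - z)) z := by
        rw [lintegral_const_mul' _ _ (by simpa using hV0), lintegral_lintegral_swap]
        exact ((hh.comp measurable_fst).mul hind).aemeasurable
    _ ≤ V⁻¹ * ∫⁻ z, (c * e2 (x - z)) * M := by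
        gcongr with z
        calc ∫⁻ y, h y * (ball y 1).indicator (fun z => c * e2 (x - z)) z
            = ∫⁻ y, (c * e2 (x - z)) * (ball z 1).indicator h y := by
              congr 1; ext y
              by_cases hy : y ∈ ball z 1
              · rw [Set.indicator_of_mem hy, Set.indicator_of_mem (mem_ball_comm.1 hy), mul_comm]
              · rw [Set.indicator_of_notMem hy, Set.indicator_of_notMem (fun h => hy (mem_ball_comm.1 h))]
                simp
          _ = (c * e2 (x - z)) * ∫⁻ y in ball z 1, h y := by
              rw [lintegral_const_mul _ (hh.indicator measurableSet_ball),
                lintegral_indicator measurableSet_ball]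
          _ ≤ _ := by gcongr; exact hM z
    _ = _ := by
        rw [lintegral_mul_const _ (by fun_prop), lintegral_const_mul _ (by fun_prop),
          lintegral_sub_left_eq_self e2 x]
        rw [he, gauss_lint _ (by positivity)]
        ring

lemma ftc_aux {d : ℕ} (g : Ed d → ℝ) (g' : Ed d → Ed d →L[ℝ] ℝ)
    (hg : ∀ x, HasFDerivAt g (g' x) x) (x z : Ed d) :
    ‖g x - g (x - z)‖ₑ ^ 2 ≤ ‖z‖ₑ ^ 2 * ∫⁻ s in Set.Ioc (0:ℝ) 1, ‖g' (x - s • z)‖ₑ ^ 2 := by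
  have hm : Measurable g' := by
    have : g' = fderiv ℝ g := by ext1 y; exact (hg y).fderiv.symm
    rw [this]; exact measurable_fderiv ℝ g
  have : IsProbabilityMeasure (volume.restrict (Set.Ioc (0:ℝ) 1)) := ⟨by simp⟩
  have hder : ∀ s : ℝ, HasDerivAt (fun s : ℝ => g (x - s • z)) (g' (x - s • z) (-z)) s := by
    intro s
    have h1 : HasDerivAt (fun s : ℝ => x - s • z) (-z) s := by
      simpa using ((hasDerivAt_id s).smul_const z).const_sub x
    exact (hg (x - s • z)).comp_hasDerivAt s h1
  have hm1 : Measurable fun s : ℝ => g' (x - s • z) := hm.comp (by fun_prop)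
  have hm2 : Measurable fun s : ℝ => g' (x - s • z) (-z) := by fun_prop
  by_cases hfin : ∫⁻ s in Set.Ioc (0:ℝ) 1, ‖g' (x - s • z) (-z)‖ₑ ^ 2 = ⊤
  · refine le_top.trans ?_
    rw [← hfin, ← lintegral_const_mul _ (by fun_prop)]
    refine lintegral_mono fun s => ?_
    rw [← mul_pow, mul_comm]
    gcongr
    simpa using (g' (x - s • z)).le_opENorm (-z)
  have hJ := lintegral_sq_le_aux (volume.restrict (Set.Ioc (0:ℝ) 1))
    (fun s => ‖g' (x - s • z) (-z)‖ₑ) (by fun_prop)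
  have hint : IntervalIntegrable (fun s => g' (x - s • z) (-z)) volume 0 1 := by
    rw [intervalIntegrable_iff_integrableOn_Ioc_of_le zero_le_one]
    refine ⟨hm2.aestronglyMeasurable, ?_⟩
    rw [hasFiniteIntegral_iff_enorm, lt_top_iff_ne_top]
    intro h
    rw [h] at hJ
    apply hfin
    simpa using hJ
  have hF := intervalIntegral.integral_eq_sub_of_hasDerivAt (fun s _ => hder s) hint
  simp only [one_smul, zero_smul, sub_zero] at hF
  rw [← enorm_neg, neg_sub, ← hF, intervalIntegral.integral_of_le zero_le_one]
  calc _ ≤ (∫⁻ s in Set.Ioc (0:ℝ) 1, ‖g' (x - s • z) (-z)‖ₑ) ^ 2 := by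
        gcongr; exact enorm_integral_le_lintegral_enorm _
    _ ≤ _ := hJ
    _ ≤ ∫⁻ s in Set.Ioc (0:ℝ) 1, ‖z‖ₑ ^ 2 * ‖g' (x - s • z)‖ₑ ^ 2 := by
        refine lintegral_mono fun s => ?_
        dsimp only
        rw [← mul_pow, mul_comm]
        gcongr
        simpa using (g' (x - s • z)).le_opENorm (-z)
    _ = _ := by rw [lintegral_const_mul _ (by fun_prop)]

lemma heat_lint {d : ℕ} (t : ℝ) (ht : 0 < t) :
    ∫⁻ z : Ed d, ENNReal.ofReal (heatK d t z) = 1 := by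
  have h1 : ∀ z : Ed d, ENNReal.ofReal (heatK d t z) = ENNReal.ofReal ((4 * π * t) ^ (-(d : ℝ) / 2)) *
      ENNReal.ofReal (Real.exp (-(1 / (4 * t)) * ‖z‖ ^ 2)) := by
    intro z
    rw [← ENNReal.ofReal_mul (by positivity), heatK]
    congr 3; field_simp
  simp_rw [h1]
  rw [lintegral_const_mul _ (by fun_prop), gauss_lint _ (by positivity),
    ← ENNReal.ofReal_mul (by positivity)]
  have : π / (1 / (4 * t)) = 4 * π * t := by field_simp
  rw [this, ← Real.rpow_add (by positivity)]
  simp [neg_div]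

lemma heat_moment {d : ℕ} (t : ℝ) (ht : 0 < t) :
    ∫⁻ z : Ed d, ENNReal.ofReal (heatK d t z) * ‖z‖ₑ ^ 2 ≤ ENNReal.ofReal (8 * t * 2 ^ ((d : ℝ) / 2)) := by
  have h1 : ∀ z : Ed d, ENNReal.ofReal (heatK d t z) * ‖z‖ₑ ^ 2 ≤
      ENNReal.ofReal (8 * t * (4 * π * t) ^ (-(d : ℝ) / 2)) *
      ENNReal.ofReal (Real.exp (-(1 / (8 * t)) * ‖z‖ ^ 2)) := by
    intro z
    rw [← ofReal_norm, ← ENNReal.ofReal_pow (norm_nonneg _),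
      ← ENNReal.ofReal_mul (by rw [heatK]; positivity), ← ENNReal.ofReal_mul (by positivity), heatK]
    apply ENNReal.ofReal_le_ofReal
    have e1 : Real.exp (-‖z‖ ^ 2 / (4 * t)) = Real.exp (-(1 / (8 * t)) * ‖z‖ ^ 2) * Real.exp (-(1 / (8 * t)) * ‖z‖ ^ 2) := by
      rw [← Real.exp_add]; congr 1; field_simp; ring
    have e2 : Real.exp (-(1 / (8 * t)) * ‖z‖ ^ 2) * ‖z‖ ^ 2 ≤ 8 * t := by
      have : ‖z‖ ^ 2 / (8 * t) ≤ Real.exp ((1 / (8 * t)) * ‖z‖ ^ 2) := by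
        have := Real.add_one_le_exp ((1 / (8 * t)) * ‖z‖ ^ 2)
        calc ‖z‖ ^ 2 / (8 * t) = (1 / (8 * t)) * ‖z‖ ^ 2 := by field_simp
          _ ≤ _ := by linarith
      rw [neg_mul, Real.exp_neg, inv_mul_le_iff₀ (by positivity)]
      rwa [div_le_iff₀ (by positivity)] at this
    rw [e1]
    calc _ = (4 * π * t) ^ (-(d : ℝ) / 2) * Real.exp (-(1 / (8 * t)) * ‖z‖ ^ 2) * (Real.exp (-(1 / (8 * t)) * ‖z‖ ^ 2) * ‖z‖ ^ 2) := by ring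
      _ ≤ (4 * π * t) ^ (-(d : ℝ) / 2) * Real.exp (-(1 / (8 * t)) * ‖z‖ ^ 2) * (8 * t) := by gcongr
      _ = _ := by ring
  refine (lintegral_mono h1).trans (le_of_eq ?_)
  rw [lintegral_const_mul _ (by fun_prop), gauss_lint _ (by positivity),
    ← ENNReal.ofReal_mul (by positivity)]
  have : π / (1 / (8 * t)) = 2 * (4 * π * t) := by field_simp; ring
  rw [this, Real.mul_rpow (x := 2) (y := 4 * π * t) (by positivity) (by positivity)]
  have h4 : 0 < 4 * π * t := by positivity
  clear h1 this
  generalize 4 * π * t = q at *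
  congr 1
  have : q ^ (-(d : ℝ) / 2) * q ^ ((d : ℝ) / 2) = 1 := by
    rw [← Real.rpow_add (by positivity)]
    simp [neg_div]
  linear_combination (8 * t * 2 ^ ((d : ℝ) / 2)) * this

lemma heatK_meas {d : ℕ} (t : ℝ) : Measurable (heatK d t) := by
  unfold heatK; fun_prop

lemma heatK_nonneg {d : ℕ} (t : ℝ) (ht : 0 < t) (z : Ed d) : 0 ≤ heatK d t z := by
  unfold heatK; positivity

lemma heat_integral {d : ℕ} (t : ℝ) (ht : 0 < t) :
    Integrable (heatK d t) ∧ ∫ z : Ed d, heatK d t z = 1 := by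
  have hn : 0 ≤ᵐ[volume] (heatK d t) := ae_of_all _ (heatK_nonneg t ht)
  constructor
  · refine ⟨(heatK_meas t).aestronglyMeasurable, ?_⟩
    rw [hasFiniteIntegral_iff_ofReal hn, heat_lint t ht]
    simp
  · rw [integral_eq_lintegral_of_nonneg_ae hn (heatK_meas t).aestronglyMeasurable, heat_lint t ht]
    simp

lemma diff_aux {d : ℕ} (g : Ed d → ℝ) (g' : Ed d → Ed d →L[ℝ] ℝ)
    (hg : ∀ x, HasFDerivAt g (g' x) x) (t : ℝ) (ht : 0 < t) (x : Ed d)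
    (hi : Integrable fun y => g y * heatK d t (x - y)) :
    ‖g x - heatConv g x t‖ₑ ^ 2 ≤ ∫⁻ z, ENNReal.ofReal (heatK d t z) *
      (‖z‖ₑ ^ 2 * ∫⁻ s in Set.Ioc (0:ℝ) 1, ‖g' (x - s • z)‖ₑ ^ 2) := by
  have hc : Continuous g := continuous_iff_continuousAt.2 fun x => (hg x).continuousAt
  have hgm : Measurable g := hc.measurable
  obtain ⟨hK, hK1⟩ := heat_integral (d := d) t ht
  have e1 : heatConv g x t = ∫ z, g (x - z) * heatK d t z := by
    rw [heatConv, ← integral_sub_left_eq_self _ _ x]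
    simp
  have hi' : Integrable fun z => g (x - z) * heatK d t z := by
    have := hi.comp_sub_left x
    simpa using this
  have e2 : g x - heatConv g x t = ∫ z, heatK d t z * (g x - g (x - z)) := by
    have : g x = ∫ z, g x * heatK d t z := by rw [integral_const_mul, hK1, mul_one]
    rw [e1]
    nth_rewrite 1 [this]
    rw [← integral_sub (hK.const_mul _) hi']
    congr 1; ext z; ring
  set ν : Measure (Ed d) := volume.withDensity fun z => ENNReal.ofReal (heatK d t z) with hν
  have hKm : Measurable fun z : Ed d => ENNReal.ofReal (heatK d t z) := (heatK_meas t).ennreal_ofReal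
  have : IsProbabilityMeasure ν := ⟨by
    rw [hν, withDensity_apply _ MeasurableSet.univ, Measure.restrict_univ, heat_lint t ht]⟩
  have hFm : Measurable fun z => ‖g x - g (x - z)‖ₑ := by fun_prop
  have hJ := lintegral_sq_le_aux ν (fun z => ‖g x - g (x - z)‖ₑ) hFm.aemeasurable
  rw [hν, lintegral_withDensity_eq_lintegral_mul _ hKm hFm,
    lintegral_withDensity_eq_lintegral_mul _ hKm (hFm.pow_const 2)] at hJ
  simp only [Pi.mul_apply] at hJ
  calc ‖g x - heatConv g x t‖ₑ ^ 2 ≤ (∫⁻ z, ENNReal.ofReal (heatK d t z) * ‖g x - g (x - z)‖ₑ) ^ 2 := by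
        rw [e2]
        gcongr
        refine (enorm_integral_le_lintegral_enorm _).trans (le_of_eq ?_)
        congr 1; ext z
        rw [enorm_mul, Real.enorm_of_nonneg (heatK_nonneg t ht z)]
    _ ≤ _ := hJ
    _ ≤ _ := by
        refine lintegral_mono fun z => ?_
        gcongr
        exact ftc_aux g g' hg x z

lemma int_aux {d : ℕ} (G : Ed d → ENNReal) (hG : Measurable G) (t R : ℝ) (N : ENNReal)
    (ht : 0 < t)
    (hN : ∀ x, ∫⁻ y in ball x R, G y ≤ N) (x₀ : Ed d) :
    ∫⁻ x in ball x₀ R, ∫⁻ z, ENNReal.ofReal (heatK d t z) *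
      (‖z‖ₑ ^ 2 * ∫⁻ s in Set.Ioc (0:ℝ) 1, G (x - s • z)) ≤
      ENNReal.ofReal (8 * t * 2 ^ ((d : ℝ) / 2)) * N := by
  have hKm : Measurable fun z : Ed d => ENNReal.ofReal (heatK d t z) := (heatK_meas t).ennreal_ofReal
  have hin : Measurable fun p : Ed d × Ed d => ∫⁻ s in Set.Ioc (0:ℝ) 1, G (p.1 - s • p.2) := by
    have : Measurable fun q : (Ed d × Ed d) × ℝ => G (q.1.1 - q.2 • q.1.2) := by fun_prop
    exact this.lintegral_prod_right'
  rw [lintegral_lintegral_swap]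
  · calc _ ≤ ∫⁻ z, (ENNReal.ofReal (heatK d t z) * ‖z‖ₑ ^ 2) * N := by
          refine lintegral_mono fun z => ?_
          have hinz : Measurable fun x : Ed d => ∫⁻ s in Set.Ioc (0:ℝ) 1, G (x - s • z) :=
            hin.comp (measurable_prodMk_right (y := z))
          dsimp only
          rw [lintegral_const_mul _ (hinz.const_mul _), lintegral_const_mul _ hinz, ← mul_assoc]
          gcongr
          rw [lintegral_lintegral_swap]
          · calc _ ≤ ∫⁻ s in Set.Ioc (0:ℝ) 1, N := by
                  refine lintegral_mono fun s => ?_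
                  refine le_trans (le_of_eq ?_) (hN (x₀ - s • z))
                  dsimp only
                  rw [← lintegral_indicator measurableSet_ball, ← lintegral_indicator measurableSet_ball,
                    ← lintegral_sub_right_eq_self ((ball (x₀ - s • z) R).indicator G) (s • z)]
                  congr 1; ext x
                  simp only [Set.indicator, mem_ball, dist_sub_right]
              _ = N := by simp
          · have : Measurable fun q : Ed d × ℝ => G (q.1 - q.2 • z) := by fun_prop
            exact this.aemeasurable
      _ ≤ _ := by
          rw [lintegral_mul_const _ (by fun_prop)]
          gcongr
          exact heat_moment t ht
  · exact Measurable.aemeasurable (by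
      exact (hKm.comp measurable_snd).mul ((by fun_prop : Measurable fun p : Ed d × Ed d => ‖p.2‖ₑ ^ 2).mul hin))

lemma lint_of_int {d : ℕ} {F : Type*} [NormedAddCommGroup F] (f : Ed d → F) (s : Set (Ed d))
    (hf : IntegrableOn (fun y => ‖f y‖ ^ 2) s) :
    ∫⁻ y in s, ‖f y‖ₑ ^ 2 = ENNReal.ofReal (∫ y in s, ‖f y‖ ^ 2) := by
  rw [ofReal_integral_eq_lintegral_ofReal hf (ae_of_all _ fun _ => by positivity)]
  congr 1; ext y
  rw [ENNReal.ofReal_pow (norm_nonneg _), ofReal_norm]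

/-- `‖g‖_{S²_R} ≤ C { ‖u(·,R²)‖_∞ + R ‖∇g‖_{S²_R} }` where
`u(x,t) = (g * Φ_t)(x)`. -/
theorem stmt_4 (d : ℕ) :
    ∃ C > 0, ∀ (g : Ed d → ℝ) (g' : Ed d → Ed d →L[ℝ] ℝ),
      (∀ x, HasFDerivAt g (g' x) x) →
      (∀ x : Ed d, IntegrableOn (fun y => (g y) ^ 2) (ball x 1)) →
      BddAbove (Set.range fun x : Ed d => ∫ y in ball x 1, (g y) ^ 2) →
      (∀ x : Ed d, IntegrableOn (fun y => ‖g' y‖ ^ 2) (ball x 1)) →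
      BddAbove (Set.range fun x : Ed d => ∫ y in ball x 1, ‖g' y‖ ^ 2) →
      ∀ R : ℝ, 0 < R →
      S2 R g ≤ C * ((⨆ x : Ed d, |heatConv g x (R ^ 2)|) + R * S2v R g') := by
  
  set B : ℝ := 8 * 2 ^ ((d : ℝ) / 2) with hB
  have hB0 : 0 < B := by positivity
  refine ⟨2 + 2 * B, by positivity, ?_⟩
  intro g g' hg hgi hgb hg'i hg'b R hR
  have hc : Continuous g := continuous_iff_continuousAt.2 fun x => (hg x).continuousAt
  have hgm : Measurable g := hc.measurable
  have hm : Measurable g' := by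
    have : g' = fderiv ℝ g := by ext1 y; exact (hg y).fderiv.symm
    rw [this]; exact measurable_fderiv ℝ g
  have hR2 : 0 < R ^ 2 := by positivity
  obtain ⟨A, hA⟩ := hgb
  obtain ⟨A', hA'⟩ := hg'b
  have hA1 : ∀ x, ∫⁻ y in ball x 1, ‖g y‖ₑ ^ 2 ≤ ENNReal.ofReal A := fun x => by
    rw [lint_of_int g _ (by simpa using hgi x)]
    apply ENNReal.ofReal_le_ofReal
    simpa using hA ⟨x, rfl⟩
  have hA1' : ∀ x, ∫⁻ y in ball x 1, ‖g' y‖ₑ ^ 2 ≤ ENNReal.ofReal A' := fun x => by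
    rw [lint_of_int g' _ (hg'i x)]
    exact ENNReal.ofReal_le_ofReal (hA' ⟨x, rfl⟩)
  set V1 : ENNReal := volume (ball (0 : Ed d) 1) with hV1
  have hV1t : V1 ≠ ⊤ := measure_ball_lt_top.ne
  -- integrability of the convolution and uniform bound
  obtain ⟨K, hK, hKb⟩ := unif_bound (d := d) (R ^ 2) hR2 (V1 + ENNReal.ofReal A)
    (ENNReal.add_ne_top.2 ⟨hV1t, ENNReal.ofReal_ne_top⟩)
  set q : ENNReal := ENNReal.ofReal ((4 * π * R ^ 2) ^ (-(d : ℝ) / 2)) with hq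
  have hconv : ∀ x, ∫⁻ y, ‖g y * heatK d (R ^ 2) (x - y)‖ₑ ≤ q * K := by
    intro x
    have h1 := hKb (fun y => 1 + ‖g y‖ₑ ^ 2) (by fun_prop) (fun x => by
      rw [lintegral_add_left measurable_const]
      gcongr
      · simp [hV1, Measure.addHaar_ball_center]
      · exact hA1 x) x
    refine le_trans ?_ (mul_le_mul' (le_refl q) h1)
    rw [← lintegral_const_mul _ (by fun_prop)]
    refine lintegral_mono fun y => ?_
    rw [enorm_mul, Real.enorm_of_nonneg (heatK_nonneg _ hR2 _), heatK,
      ENNReal.ofReal_mul (by positivity), ← hq]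
    have h2 : ‖g y‖ₑ ≤ 1 + ‖g y‖ₑ ^ 2 := by
      rcases le_total ‖g y‖ₑ 1 with h | h
      · exact h.trans le_self_add
      · exact (le_self_pow h two_ne_zero).trans le_add_self
    calc _ ≤ (1 + ‖g y‖ₑ ^ 2) * (q * ENNReal.ofReal (Real.exp (-‖x - y‖ ^ 2 / (4 * R ^ 2)))) := by
          gcongr
      _ = _ := by ring
  have hqK : q * K ≠ ⊤ := ENNReal.mul_ne_top ENNReal.ofReal_ne_top hK
  have hci : ∀ x, Integrable fun y => g y * heatK d (R ^ 2) (x - y) := fun x =>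
    ⟨(hgm.mul ((heatK_meas _).comp (by fun_prop))).aestronglyMeasurable,
      (hconv x).trans_lt hqK.lt_top⟩
  have hUb : BddAbove (Set.range fun x => |heatConv g x (R ^ 2)|) := by
    refine ⟨(q * K).toReal, ?_⟩
    rintro _ ⟨x, rfl⟩
    have := (enorm_integral_le_lintegral_enorm _).trans (hconv x)
    have := ENNReal.toReal_mono hqK this
    simpa [heatConv] using this
  set U : ℝ := ⨆ x : Ed d, |heatConv g x (R ^ 2)| with hU
  have hU1 : ∀ x, |heatConv g x (R ^ 2)| ≤ U := fun x => le_ciSup hUb x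
  have hU0 : 0 ≤ U := (abs_nonneg _).trans (hU1 0)
  -- gradient at scale R
  set W : ENNReal := volume (ball (0 : Ed d) R) with hW
  have hWt : W ≠ ⊤ := measure_ball_lt_top.ne
  have hW0 : W ≠ 0 := (measure_ball_pos _ _ hR).ne'
  have hWr : 0 < W.toReal := ENNReal.toReal_pos hW0 hWt
  have hWx : ∀ x : Ed d, volume (ball x R) = W := fun x => by
    rw [hW, Measure.addHaar_ball_center]
  have hWxr : ∀ x : Ed d, volume.real (ball x R) = W.toReal := fun x => by
    rw [measureReal_def, hWx]
  obtain ⟨K', hK', hKb'⟩ := unif_bound (d := d) (R ^ 2) hR2 (ENNReal.ofReal A') ENNReal.ofReal_ne_top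
  set r : ENNReal := ENNReal.ofReal (Real.exp (1 / 4)) with hr
  have hrt : r * K' ≠ ⊤ := ENNReal.mul_ne_top ENNReal.ofReal_ne_top hK'
  have hgR : ∀ x, ∫⁻ y in ball x R, ‖g' y‖ₑ ^ 2 ≤ r * K' := by
    intro x
    have h1 := hKb' (fun y => ‖g' y‖ₑ ^ 2) (by fun_prop) hA1' x
    refine le_trans ?_ (mul_le_mul' (le_refl r) h1)
    rw [← lintegral_const_mul _ (by fun_prop)]
    refine le_trans ?_ (setLIntegral_le_lintegral (ball x R) _)
    refine setLIntegral_mono (by fun_prop) fun y hy => ?_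
    rw [mem_ball, dist_comm, dist_eq_norm] at hy
    have : 1 ≤ r * ENNReal.ofReal (Real.exp (-‖x - y‖ ^ 2 / (4 * R ^ 2))) := by
      rw [hr, ← ENNReal.ofReal_mul (by positivity), ← Real.exp_add, ENNReal.one_le_ofReal]
      apply Real.one_le_exp
      have h2 : ‖x - y‖ ^ 2 ≤ R ^ 2 := by gcongr
      have h3 : ‖x - y‖ ^ 2 / (4 * R ^ 2) ≤ 1 / 4 := by
        rw [div_le_div_iff₀ (by positivity) (by positivity)]; linarith
      rw [neg_div]; linarith
    calc ‖g' y‖ₑ ^ 2 = ‖g' y‖ₑ ^ 2 * 1 := by simp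
      _ ≤ ‖g' y‖ₑ ^ 2 * (r * ENNReal.ofReal (Real.exp (-‖x - y‖ ^ 2 / (4 * R ^ 2)))) := by gcongr
      _ = _ := by ring
  have hgRi : ∀ x, IntegrableOn (fun y => ‖g' y‖ ^ 2) (ball x R) := fun x => by
    refine ⟨(by fun_prop : Measurable fun y => ‖g' y‖ ^ 2).aestronglyMeasurable, ?_⟩
    rw [hasFiniteIntegral_iff_enorm]
    simpa using (hgR x).trans_lt hrt.lt_top
  set S : ℝ := S2v R g' with hS
  have hSb : BddAbove (Set.range fun x : Ed d => (⨍ y in ball x R, ‖g' y‖ ^ 2) ^ (1/2 : ℝ)) := by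
    refine ⟨(W.toReal⁻¹ * (r * K').toReal) ^ (1/2 : ℝ), ?_⟩
    rintro _ ⟨x, rfl⟩
    have h0 : 0 ≤ ∫ y in ball x R, ‖g' y‖ ^ 2 := integral_nonneg fun _ => by positivity
    dsimp only
    rw [setAverage_eq, hWxr, smul_eq_mul]
    gcongr
    rw [← ENNReal.ofReal_le_iff_le_toReal hrt, ← lint_of_int g' _ (hgRi x)]
    exact hgR x
  have hS1 : ∀ x, (⨍ y in ball x R, ‖g' y‖ ^ 2) ^ (1/2 : ℝ) ≤ S := fun x => le_ciSup hSb x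
  have hS0 : 0 ≤ S := le_trans (Real.rpow_nonneg (by
    rw [setAverage_eq, hWxr, smul_eq_mul]
    exact mul_nonneg (by positivity) (integral_nonneg fun _ => by positivity)) _) (hS1 0)
  have hN : ∀ x, ∫⁻ y in ball x R, ‖g' y‖ₑ ^ 2 ≤ ENNReal.ofReal (W.toReal * S ^ 2) := by
    intro x
    have h1 := hS1 x
    have h0 : 0 ≤ ∫ y in ball x R, ‖g' y‖ ^ 2 := integral_nonneg fun _ => by positivity
    rw [setAverage_eq, hWxr, smul_eq_mul, ← Real.sqrt_eq_rpow, Real.sqrt_le_left hS0,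
      inv_mul_le_iff₀ hWr] at h1
    rw [lint_of_int g' _ (hgRi x)]
    exact ENNReal.ofReal_le_ofReal h1
  -- main estimate
  have hmain : ∀ x₀, ∫⁻ x in ball x₀ R, ‖g x‖ₑ ^ 2 ≤
      ENNReal.ofReal (W.toReal * (2 * U ^ 2 + 2 * (B * R ^ 2 * S ^ 2))) := by
    intro x₀
    have hpt : ∀ x, ‖g x‖ₑ ^ 2 ≤ ENNReal.ofReal (2 * U ^ 2) +
        2 * ∫⁻ z, ENNReal.ofReal (heatK d (R ^ 2) z) *
      (‖z‖ₑ ^ 2 * ∫⁻ s in Set.Ioc (0:ℝ) 1, ‖g' (x - s • z)‖ₑ ^ 2) := by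
      intro x
      have h1 := diff_aux g g' hg (R ^ 2) hR2 x (hci x)
      refine le_trans ?_ (add_le_add le_rfl (mul_le_mul' (le_refl 2) h1))
      rw [← ofReal_norm, ← ofReal_norm, ← ENNReal.ofReal_pow (norm_nonneg _),
        ← ENNReal.ofReal_pow (norm_nonneg _), ← ENNReal.ofReal_ofNat 2,
        ← ENNReal.ofReal_mul (by positivity), ← ENNReal.ofReal_add (by positivity) (by positivity)]
      apply ENNReal.ofReal_le_ofReal
      simp only [Real.norm_eq_abs, sq_abs]
      have h2 : heatConv g x (R ^ 2) ^ 2 ≤ U ^ 2 := by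
        rw [← sq_abs]
        have := hU1 x
        gcongr
      nlinarith [sq_nonneg (g x - 2 * heatConv g x (R ^ 2))]
    calc _ ≤ ∫⁻ x in ball x₀ R, (ENNReal.ofReal (2 * U ^ 2) +
        2 * ∫⁻ z, ENNReal.ofReal (heatK d (R ^ 2) z) *
      (‖z‖ₑ ^ 2 * ∫⁻ s in Set.Ioc (0:ℝ) 1, ‖g' (x - s • z)‖ₑ ^ 2)) := lintegral_mono hpt
      _ ≤ ENNReal.ofReal (2 * U ^ 2) * W + 2 * (ENNReal.ofReal (8 * R ^ 2 * 2 ^ ((d : ℝ) / 2)) *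
          ENNReal.ofReal (W.toReal * S ^ 2)) := by
        rw [lintegral_add_left measurable_const, setLIntegral_const, hWx,
          lintegral_const_mul' _ _ (by simp)]
        gcongr
        exact int_aux (fun y => ‖g' y‖ₑ ^ 2) (by fun_prop) (R ^ 2) R _ hR2 hN x₀
      _ = _ := by
        nth_rewrite 1 [← ENNReal.ofReal_toReal hWt]
        rw [← ENNReal.ofReal_ofNat 2, ← ENNReal.ofReal_mul (by positivity),
          ← ENNReal.ofReal_mul (by positivity), ← ENNReal.ofReal_mul (by positivity),
          ← ENNReal.ofReal_add (by positivity) (by positivity)]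
        congr 1
        rw [hB]; ring
  rw [S2]
  refine ciSup_le fun x₀ => ?_
  rw [← Real.sqrt_eq_rpow, Real.sqrt_le_left (by positivity), setAverage_eq, hWxr, smul_eq_mul,
    inv_mul_le_iff₀ hWr]
  have h1 := ENNReal.toReal_mono ENNReal.ofReal_ne_top (hmain x₀)
  rw [ENNReal.toReal_ofReal (by positivity)] at h1
  have h2 : ∫ y in ball x₀ R, g y ^ 2 = (∫⁻ x in ball x₀ R, ‖g x‖ₑ ^ 2).toReal := by
    rw [integral_eq_lintegral_of_nonneg_ae (ae_of_all _ fun _ => by positivity)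
      (by fun_prop : Measurable fun y => g y ^ 2).aestronglyMeasurable]
    congr 2; ext y
    rw [← ofReal_norm, ← ENNReal.ofReal_pow (norm_nonneg _)]
    simp
  rw [h2]
  refine h1.trans ?_
  gcongr
  have hRS : 0 ≤ R * S := by positivity
  have h5 : 2 * U ^ 2 + 2 * (B * R ^ 2 * S ^ 2) ≤ (2 + 2 * B) * (U + R * S) ^ 2 := by
    have : 0 ≤ U * (R * S) := by positivity
    have e : (2 + 2 * B) * (U + R * S) ^ 2 - (2 * U ^ 2 + 2 * (B * R ^ 2 * S ^ 2))
      = 2 * B * U ^ 2 + 2 * (R * S) ^ 2 + (2 + 2 * B) * 2 * (U * (R * S)) := by ring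
    have : 0 ≤ 2 * B * U ^ 2 + 2 * (R * S) ^ 2 + (2 + 2 * B) * 2 * (U * (R * S)) := by positivity
    linarith
  refine h5.trans ?_
  rw [mul_pow]
  gcongr
  nlinarith
end
end

section
/- Let g ∈ H^1_loc(ℝ^d) with g, ∇g ∈ L²_{loc,unif}(ℝ^d), let u(x,t) = (g * Φ_t)(x), and let r ≥ 1. Then for every x ∈ ℝ^d, | u(x,1) − ⨍_{B(x,r)} g | ≤ C r^{d/2+2} ‖∇g‖_{S²_r} + C e^{−c r²} ‖g‖_{S²_r}, where C > 0 and c > 0 depend only on d. -/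
open MeasureTheory Metric Filter Real
noncomputable section

open scoped ENNReal

lemma cs_lintegral {α : Type*} [MeasurableSpace α] (μ : Measure α) {f h : α → ℝ≥0∞}
    (hf : AEMeasurable f μ) (hh : AEMeasurable h μ) :
    (∫⁻ a, f a * h a ∂μ) ^ 2 ≤ (∫⁻ a, f a ^ 2 ∂μ) * ∫⁻ a, h a ^ 2 ∂μ := by
  have hpq : (2 : ℝ).HolderConjugate 2 := Real.HolderConjugate.two_two
  have := ENNReal.lintegral_mul_le_Lp_mul_Lq μ hpq hf hh
  simp only [Pi.mul_apply] at this
  calc _ ≤ _ := pow_le_pow_left₀ (by positivity) this 2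
    _ = _ := by
      rw [mul_pow]
      simp only [← ENNReal.rpow_natCast, ← ENNReal.rpow_mul]
      norm_num

lemma cs_set {α : Type*} [MeasurableSpace α] (μ : Measure α) {f : α → ℝ≥0∞}
    (hf : AEMeasurable f μ) :
    (∫⁻ a, f a ∂μ) ^ 2 ≤ (∫⁻ a, f a ^ 2 ∂μ) * μ Set.univ := by
  simpa using cs_lintegral μ hf (aemeasurable_const (b := (1:ℝ≥0∞)))

lemma dilate {d : ℕ} (F : Ed d → ℝ≥0∞) (hF : Measurable F) (x : Ed d) (r a : ℝ)
    (ha : 1/2 ≤ a) (ha1 : a ≤ 1) (v : Ed d) (hv : v ∈ ball x r) :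
    ∫⁻ y in ball x r, F (a • y + (1 - a) • v) ≤ 2 ^ d * ∫⁻ y in ball x r, F y := by
  have hm : MeasurableSet (ball x r) := measurableSet_ball
  set G := (ball x r).indicator F with hG
  have hGm : Measurable G := hF.indicator hm
  rw [← lintegral_indicator hm, ← lintegral_indicator hm]
  have ha0 : a ≠ 0 := by linarith
  calc _ ≤ ∫⁻ y, G (a • y + (1 - a) • v) := by
        apply lintegral_mono
        intro y
        by_cases hy : y ∈ ball x r
        · have : a • y + (1 - a) • v ∈ ball x r :=
            (convex_ball x r) hy hv (by linarith) (by linarith) (by ring)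
          simp [hG, Set.indicator_of_mem, hy, this]
        · simp only [Set.indicator_of_notMem hy]; exact zero_le
    _ = ∫⁻ y, G (y + (1 - a) • v) ∂(Measure.map (a • ·) volume) := by
        rw [lintegral_map (by fun_prop) (by fun_prop)]
    _ = ENNReal.ofReal |(a ^ d)⁻¹| * ∫⁻ y, G y := by
        rw [Measure.map_addHaar_smul _ ha0, lintegral_smul_measure,
          lintegral_add_right_eq_self (fun y => G y)]
        simp
    _ ≤ 2 ^ d * ∫⁻ y, G y := by
        gcongr
        rw [abs_of_nonneg (by positivity), show (2:ℝ≥0∞)^d = ENNReal.ofReal (2^d) by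
          rw [ENNReal.ofReal_pow (by norm_num)]; norm_num]
        apply ENNReal.ofReal_le_ofReal
        rw [← inv_pow]
        have : a⁻¹ ≤ 2 := by
          rw [inv_le_comm₀ (by linarith) (by norm_num)]; linarith
        gcongr

lemma ftc {d : ℕ} {g : Ed d → ℝ} {g' : Ed d → Ed d →L[ℝ] ℝ}
    (hg : ∀ x, HasFDerivAt g (g' x) x) (hm : Measurable g') (y z : Ed d) :
    ‖g y - g z‖ₑ ^ 2 ≤ ‖y - z‖ₑ ^ 2 *
      ∫⁻ s in Set.Ioc (0:ℝ) 1, ‖g' (s • y + (1 - s) • z)‖ₑ ^ 2 := by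
  have hmm : Measurable fun s : ℝ => g' (s • y + (1 - s) • z) := by
    exact hm.comp (by fun_prop)
  have h1 : ‖g y - g z‖ₑ ≤ ‖y - z‖ₑ *
      ∫⁻ s in Set.Ioc (0:ℝ) 1, ‖g' (s • y + (1 - s) • z)‖ₑ := by
    by_cases hyz : y = z
    · simp [hyz]
    by_cases htop : ∫⁻ s in Set.Ioc (0:ℝ) 1, ‖g' (s • y + (1 - s) • z)‖ₑ = ∞
    · rw [htop, ENNReal.mul_top]
      · exact le_top
      · simpa [sub_eq_zero] using hyz
    have hint : IntegrableOn (fun s : ℝ => g' (s • y + (1 - s) • z)) (Set.Ioc 0 1) :=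
      ⟨hmm.aestronglyMeasurable, lt_top_iff_ne_top.2 htop⟩
    have hder : ∀ s : ℝ, HasDerivAt (fun s : ℝ => g (s • y + (1 - s) • z))
        (g' (s • y + (1 - s) • z) (y - z)) s := by
      intro s
      have h2 : HasDerivAt (fun s : ℝ => s • y + (1 - s) • z) (y - z) s := by
        have := ((hasDerivAt_id s).smul_const y).add
          (((hasDerivAt_id s).const_sub 1).smul_const z)
        have e : (1:ℝ) • y + (-1:ℝ) • z = y - z := by simp [sub_eq_add_neg]
        rw [e] at this
        exact this
      exact (hg _).comp_hasDerivAt s h2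
    have hint2 : IntervalIntegrable (fun s : ℝ => g' (s • y + (1 - s) • z) (y - z))
        volume 0 1 := by
      rw [intervalIntegrable_iff_integrableOn_Ioc_of_le zero_le_one]
      exact hint.apply_continuousLinearMap _
    have := intervalIntegral.integral_eq_sub_of_hasDerivAt (fun s _ => hder s) hint2
    simp only [one_smul, sub_self, zero_smul, add_zero, sub_zero, zero_add] at this
    rw [← this, intervalIntegral.integral_of_le zero_le_one]
    refine (enorm_integral_le_lintegral_enorm _).trans ?_
    rw [← lintegral_const_mul _ hmm.enorm]
    apply lintegral_mono
    intro s
    refine le_of_le_of_eq ?_ (mul_comm _ _)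
    exact ContinuousLinearMap.le_opENorm _ _
  have h2 := cs_set (volume.restrict (Set.Ioc (0:ℝ) 1)) hmm.enorm.aemeasurable
  simp only [Measure.restrict_apply_univ, Real.volume_Ioc, sub_zero, ENNReal.ofReal_one, mul_one] at h2
  calc _ ≤ _ := pow_le_pow_left₀ (by positivity) h1 2
    _ ≤ _ := by rw [mul_pow]; gcongr

lemma poincare {d : ℕ} {g : Ed d → ℝ} {g' : Ed d → Ed d →L[ℝ] ℝ}
    (hg : ∀ x, HasFDerivAt g (g' x) x) (hm : Measurable g') (x : Ed d) (r : ℝ) :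
    ∫⁻ y in ball x r, ∫⁻ z in ball x r, ‖g y - g z‖ₑ ^ 2 ≤
      ENNReal.ofReal (2 * r) ^ 2 * (2 ^ d * (∫⁻ y in ball x r, ‖g' y‖ₑ ^ 2) * volume (ball x r)) := by
  have hmB : MeasurableSet (ball x r) := measurableSet_ball
  set F : Ed d → ℝ≥0∞ := fun y => ‖g' y‖ₑ ^ 2 with hF
  have hFm : Measurable F := hm.enorm.pow_const 2
  have hFj : Measurable fun p : (Ed d × Ed d) × ℝ => F (p.2 • p.1.1 + (1 - p.2) • p.1.2) :=
    hFm.comp (by fun_prop)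
  set μ := (volume : Measure (Ed d)).restrict (ball x r) with hμ
  set ν := (volume : Measure ℝ).restrict (Set.Ioc 0 1) with hν
  calc _ ≤ ∫⁻ y, ∫⁻ z, ENNReal.ofReal (2 * r) ^ 2 *
          ∫⁻ s, F (s • y + (1 - s) • z) ∂ν ∂μ ∂μ := by
        apply setLIntegral_mono' hmB
        intro y hy
        apply setLIntegral_mono' hmB
        intro z hz
        refine (ftc hg hm y z).trans ?_
        gcongr
        rw [← ofReal_norm]
        apply ENNReal.ofReal_le_ofReal
        rw [← dist_eq_norm]
        have := dist_triangle_right y z x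
        rw [mem_ball] at hy hz
        linarith
    _ = ENNReal.ofReal (2 * r) ^ 2 * ∫⁻ s, ∫⁻ y, ∫⁻ z, F (s • y + (1 - s) • z) ∂μ ∂μ ∂ν := by
        have e1 : ∀ y, ∫⁻ z, ENNReal.ofReal (2 * r) ^ 2 *
          ∫⁻ s, F (s • y + (1 - s) • z) ∂ν ∂μ = ENNReal.ofReal (2 * r) ^ 2 *
          ∫⁻ s, ∫⁻ z, F (s • y + (1 - s) • z) ∂μ ∂ν := by
          intro y
          rw [lintegral_const_mul' _ _ (by finiteness), lintegral_lintegral_swap]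
          exact (hFm.comp (by fun_prop : Measurable fun p : Ed d × ℝ =>
            p.2 • y + (1 - p.2) • p.1)).aemeasurable
        simp_rw [e1]
        rw [lintegral_const_mul' _ _ (by finiteness), lintegral_lintegral_swap]
        apply Measurable.aemeasurable
        have : Measurable fun p : (Ed d × ℝ) × Ed d => F (p.1.2 • p.1.1 + (1 - p.1.2) • p.2) :=
          hFm.comp (by fun_prop)
        exact this.lintegral_prod_right'
    _ ≤ ENNReal.ofReal (2 * r) ^ 2 * ∫⁻ s, (2 ^ d * (∫⁻ y, F y ∂μ) * volume (ball x r)) ∂ν := by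
        refine mul_le_mul_right ?_ _
        apply setLIntegral_mono' measurableSet_Ioc
        intro s hs
        by_cases hs2 : 1/2 ≤ s
        · rw [lintegral_lintegral_swap]
          · calc _ ≤ ∫⁻ z, 2 ^ d * (∫⁻ y, F y ∂μ) ∂μ := by
                  apply setLIntegral_mono' hmB
                  intro z hz
                  exact dilate F hFm x r s hs2 hs.2 z hz
              _ = _ := by simp [hμ]
          · exact (hFm.comp (by fun_prop : Measurable fun p : Ed d × Ed d =>
              s • p.1 + (1 - s) • p.2)).aemeasurable
        · push Not at hs2
          calc _ ≤ ∫⁻ z, 2 ^ d * (∫⁻ y, F y ∂μ) ∂μ := by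
                  apply setLIntegral_mono' hmB
                  intro z hz
                  have := dilate F hFm x r (1 - s) (by linarith) (by linarith [hs.1]) z hz
                  simpa only [sub_sub_cancel, add_comm] using this
              _ = _ := by simp [hμ]
    _ = _ := by simp [hν]

lemma tail_bound {d : ℕ} (f : Ed d → ℝ≥0∞) (hf : Measurable f) (x : Ed d) (r : ℝ) (hr : 0 < r)
    (S : ℝ≥0∞) (hS : ∀ z, ∫⁻ y in ball z r, f y ≤ S * volume (ball (0 : Ed d) r)) :
    ∫⁻ y in (ball x r)ᶜ, f y * ENNReal.ofReal (Real.exp (-‖x - y‖ ^ 2 / 4)) ≤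
      ENNReal.ofReal (Real.exp (-(1/8) * r ^ 2)) *
        (∫⁻ z : Ed d, ENNReal.ofReal (Real.exp (-(1/32) * ‖z‖ ^ 2))) * S := by
  have hmB : MeasurableSet (ball x r)ᶜ := measurableSet_ball.compl
  set V := volume (ball (0 : Ed d) r) with hV
  have hV0 : V ≠ 0 := (measure_ball_pos _ _ hr).ne'
  have hVt : V ≠ ∞ := measure_ball_lt_top.ne
  have hVy : ∀ y : Ed d, volume (ball y r) = V := fun y =>
    Measure.addHaar_ball_center _ y r
  rw [← lintegral_indicator hmB]
  set w : Ed d → ℝ≥0∞ := (ball x r)ᶜ.indicator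
    (fun y => f y * ENNReal.ofReal (Real.exp (-‖x - y‖ ^ 2 / 4))) with hw
  have hwm : Measurable w := by
    apply Measurable.indicator _ hmB
    apply hf.mul
    fun_prop
  set k : Ed d → Ed d → ℝ≥0∞ := fun y z =>
    {p : Ed d × Ed d | dist p.1 p.2 < r}.indicator (fun p => w p.1) (y, z) with hk
  have hT : MeasurableSet {p : Ed d × Ed d | dist p.1 p.2 < r} :=
    (isOpen_lt (by fun_prop) (by fun_prop)).measurableSet
  have hkm : Measurable (Function.uncurry k) :=
    (hwm.comp measurable_fst).indicator hT
  have e1 : ∀ y, ∫⁻ z, k y z = w y * V := by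
    intro y
    have : ∀ z, k y z = (ball y r).indicator (fun _ => w y) z := by
      intro z
      simp only [hk, Set.indicator, Set.mem_ofPred_eq, mem_ball, dist_comm z y]
    simp_rw [this]
    rw [lintegral_indicator measurableSet_ball, setLIntegral_const, hVy]
  have e2 : ∀ z, ∫⁻ y, k y z = ∫⁻ y in ball z r, w y := by
    intro z
    have : ∀ y, k y z = (ball z r).indicator w y := by
      intro y
      simp only [hk, Set.indicator, Set.mem_ofPred_eq, mem_ball]
    simp_rw [this]
    rw [lintegral_indicator measurableSet_ball]
  have key : (∫⁻ y, w y) * V ≤ (ENNReal.ofReal (Real.exp (-(1/8) * r ^ 2)) *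
        (∫⁻ z : Ed d, ENNReal.ofReal (Real.exp (-(1/32) * ‖z‖ ^ 2))) * S) * V := by
    calc (∫⁻ y, w y) * V = ∫⁻ y, ∫⁻ z, k y z := by
          simp_rw [e1]; rw [lintegral_mul_const _ hwm]
      _ = ∫⁻ z, ∫⁻ y in ball z r, w y := by
          rw [lintegral_lintegral_swap hkm.aemeasurable]; simp_rw [e2]
      _ ≤ ∫⁻ z, ENNReal.ofReal (Real.exp (-(1/8) * r ^ 2)) *
            ENNReal.ofReal (Real.exp (-(1/32) * ‖z - x‖ ^ 2)) * (S * V) := by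
          apply lintegral_mono
          intro z
          refine le_trans ?_ (mul_le_mul_right (hS z) _)
          rw [← lintegral_const_mul _ hf]
          apply setLIntegral_mono' measurableSet_ball
          intro y hy
          by_cases hyx : y ∈ ball x r
          · simp [hw, hyx]
          · have hyx' : y ∈ (ball x r)ᶜ := hyx
            rw [hw, Set.indicator_of_mem hyx', mul_comm (f y)]
            refine mul_le_mul_left ?_ _
            rw [← ENNReal.ofReal_mul (by positivity), ← Real.exp_add]
            apply ENNReal.ofReal_le_ofReal
            apply Real.exp_le_exp.2
            rw [mem_ball, dist_eq_norm] at hy hyx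
            push Not at hyx
            rw [norm_sub_rev x y]
            have h3 : ‖z - x‖ ≤ ‖y - z‖ + ‖y - x‖ := by
              have := norm_sub_le (y - x) (y - z)
              simp only [sub_sub_sub_cancel_left] at this
              linarith
            have h4 : ‖z - x‖ ≤ 2 * ‖y - x‖ := by linarith
            have h5 : ‖z - x‖ ^ 2 ≤ (2 * ‖y - x‖) ^ 2 := by gcongr
            have h6 : r ^ 2 ≤ ‖y - x‖ ^ 2 := by gcongr
            nlinarith
      _ = _ := by
          rw [lintegral_mul_const _ (by fun_prop), lintegral_const_mul _ (by fun_prop),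
            lintegral_sub_right_eq_self
              (fun z => ENNReal.ofReal (Real.exp (-(1/32) * ‖z‖ ^ 2))) x]
          ring
  exact (ENNReal.mul_le_mul_iff_left hV0 hVt).1 key

lemma gauss_lt_top {d : ℕ} {b : ℝ} (hb : 0 < b) :
    ∫⁻ z : Ed d, ENNReal.ofReal (Real.exp (-b * ‖z‖ ^ 2)) ≠ ∞ := by
  have h := GaussianFourier.integral_rexp_neg_mul_sq_norm (V := Ed d) hb
  have hi : Integrable fun z : Ed d => Real.exp (-b * ‖z‖ ^ 2) := by
    by_contra hc
    rw [integral_undef hc] at h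
    have : 0 < (π / b) ^ (Module.finrank ℝ (Ed d) / 2 : ℝ) := by positivity
    linarith
  rw [← ofReal_integral_eq_lintegral_ofReal hi (ae_of_all _ fun _ => by positivity)]
  exact ENNReal.ofReal_ne_top

lemma avg_bound {d : ℕ} (h : Ed d → ℝ) (h0 : ∀ x, 0 ≤ h x)
    (hi : ∀ x : Ed d, IntegrableOn h (ball x 1))
    (hb : BddAbove (Set.range fun x : Ed d => ∫ y in ball x 1, h y)) (r : ℝ) (hr : 0 < r)
    (x : Ed d) : ∫⁻ y in ball x r, ENNReal.ofReal (h y) ≤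
      ENNReal.ofReal ((⨆ x : Ed d, (⨍ y in ball x r, h y) ^ (1/2 : ℝ)) ^ 2) *
        volume (ball x r) := by
  have hl : LocallyIntegrable h := fun x => ⟨ball x 1, ball_mem_nhds x one_pos, hi x⟩
  have hir : ∀ x, IntegrableOn h (ball x r) := fun x =>
    (hl.integrableOn_isCompact (isCompact_closedBall x r)).mono_set ball_subset_closedBall
  have hof : ∀ x s, IntegrableOn h (ball x s) → ENNReal.ofReal (∫ y in ball x s, h y) =
      ∫⁻ y in ball x s, ENNReal.ofReal (h y) := fun x s hs =>
    ofReal_integral_eq_lintegral_ofReal hs (ae_of_all _ h0)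
  obtain ⟨M, hM⟩ := hb
  have hM' : ∀ x, ∫ y in ball x 1, h y ≤ M := fun x => hM ⟨x, rfl⟩
  have hM0 : 0 ≤ M := (setIntegral_nonneg measurableSet_ball fun y _ => h0 y).trans (hM' 0)
  obtain ⟨t, -, ht⟩ := (isCompact_closedBall (0 : Ed d) r).elim_nhds_subcover
    (fun c => ball c 1) (fun c _ => ball_mem_nhds c one_pos)
  set V := volume.real (ball (0 : Ed d) r) with hV
  have hVy : ∀ y : Ed d, volume (ball y r) = volume (ball (0 : Ed d) r) := fun y =>
    Measure.addHaar_ball_center _ y r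
  have hV0 : 0 < V := ENNReal.toReal_pos (measure_ball_pos _ _ hr).ne' measure_ball_lt_top.ne
  have hbd : ∀ x, ∫ y in ball x r, h y ≤ t.card * M := by
    intro x
    have h1 : ∫⁻ y in ball x r, ENNReal.ofReal (h y) ≤ ENNReal.ofReal (t.card * M) := by
      set μ := (volume : Measure (Ed d)).withDensity fun y => ENNReal.ofReal (h y) with hμ
      rw [← withDensity_apply _ measurableSet_ball, ← hμ]
      calc μ (ball x r) ≤ μ (⋃ c ∈ t, ball (x + c) 1) := by
            apply measure_mono
            intro y hy
            have : y - x ∈ closedBall (0 : Ed d) r := by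
              rw [mem_closedBall_zero_iff, ← dist_eq_norm]; exact (mem_ball.1 hy).le
            have := ht this
            simp only [Set.mem_iUnion, mem_ball, dist_eq_norm] at this ⊢
            obtain ⟨c, hc, h⟩ := this
            exact ⟨c, hc, by rwa [← sub_sub]⟩
        _ ≤ ∑ c ∈ t, μ (ball (x + c) 1) := measure_biUnion_finset_le _ _
        _ ≤ ∑ c ∈ t, ENNReal.ofReal M := by
            apply Finset.sum_le_sum
            intro c _
            rw [hμ, withDensity_apply _ measurableSet_ball, ← hof _ _ (hi _)]
            exact ENNReal.ofReal_le_ofReal (hM' _)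
        _ = _ := by
            rw [Finset.sum_const, nsmul_eq_mul, ENNReal.ofReal_mul (by positivity),
              ENNReal.ofReal_natCast]
    rw [← hof _ _ (hir x)] at h1
    exact (ENNReal.ofReal_le_ofReal_iff (by positivity)).1 h1
  have hav : ∀ x, ⨍ y in ball x r, h y = V⁻¹ * ∫ y in ball x r, h y := by
    intro x
    rw [setAverage_eq, measureReal_def, hVy]; rfl
  have hi0 : ∀ x, 0 ≤ ∫ y in ball x r, h y := fun x =>
    setIntegral_nonneg measurableSet_ball fun y _ => h0 y
  have hbdd : BddAbove (Set.range fun x : Ed d => (⨍ y in ball x r, h y) ^ (1/2 : ℝ)) := by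
    refine ⟨(V⁻¹ * (t.card * M)) ^ (1/2 : ℝ), ?_⟩
    rintro _ ⟨x, rfl⟩
    simp only [hav]
    have := hi0 x
    have := hbd x
    gcongr
  have hle := le_ciSup hbdd x
  have hsq : ⨍ y in ball x r, h y ≤ (⨆ x : Ed d, (⨍ y in ball x r, h y) ^ (1/2 : ℝ)) ^ 2 := by
    have hn : 0 ≤ ⨍ y in ball x r, h y := by
      rw [hav]; have := hi0 x; positivity
    calc _ = ((⨍ y in ball x r, h y) ^ (1/2 : ℝ)) ^ 2 := by
          rw [← Real.rpow_natCast, ← Real.rpow_mul hn]; norm_num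
      _ ≤ _ := by
          have : 0 ≤ (⨍ y in ball x r, h y) ^ (1/2 : ℝ) := by positivity
          gcongr
  rw [← hof _ _ (hir x), hVy, show volume (ball (0 : Ed d) r) = ENNReal.ofReal V from
    (ENNReal.ofReal_toReal measure_ball_lt_top.ne).symm, ← ENNReal.ofReal_mul (by positivity)]
  apply ENNReal.ofReal_le_ofReal
  rw [hav, inv_mul_le_iff₀ hV0] at hsq
  linarith

lemma variance_bound {d : ℕ} {g : Ed d → ℝ} {g' : Ed d → Ed d →L[ℝ] ℝ}
    (hg : ∀ x, HasFDerivAt g (g' x) x) (hm : Measurable g') (x : Ed d) (r : ℝ) (hr : 0 < r) :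
    ∫⁻ y in ball x r, ‖g y - ⨍ z in ball x r, g z‖ₑ ^ 2 ≤
      ENNReal.ofReal (2 * r) ^ 2 * (2 ^ d * (∫⁻ y in ball x r, ‖g' y‖ₑ ^ 2)) := by
  have hgc : Continuous g := continuous_iff_continuousAt.2 fun x => (hg x).continuousAt
  have hgi : IntegrableOn g (ball x r) :=
    (hgc.continuousOn.integrableOn_compact (isCompact_closedBall x r)).mono_set
      ball_subset_closedBall
  have hV0 : volume (ball x r) ≠ 0 := (measure_ball_pos _ _ hr).ne'
  have hVt : volume (ball x r) ≠ ∞ := measure_ball_lt_top.ne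
  set V := volume (ball x r) with hV
  have h1 : ∀ y, ‖g y - ⨍ z in ball x r, g z‖ₑ ^ 2 * V ≤ ∫⁻ z in ball x r, ‖g y - g z‖ₑ ^ 2 := by
    intro y
    have e : ‖g y - ⨍ z in ball x r, g z‖ₑ * V = ‖∫ z in ball x r, (g y - g z)‖ₑ := by
      have hVr : V.toReal ≠ 0 := (ENNReal.toReal_pos hV0 hVt).ne'
      have : ∫ z in ball x r, (g y - g z) = V.toReal * (g y - ⨍ z in ball x r, g z) := by
        have hc : Integrable (fun _ : Ed d => g y) (volume.restrict (ball x r)) :=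
          integrableOn_const hVt
        rw [integral_sub hc hgi.integrable, setIntegral_const, setAverage_eq,
          measureReal_def, ← hV, smul_eq_mul, smul_eq_mul]
        field_simp
      rw [this, enorm_mul, mul_comm, Real.enorm_of_nonneg ENNReal.toReal_nonneg,
        ENNReal.ofReal_toReal hVt]
    have h2 := cs_set (volume.restrict (ball x r)) (f := fun z => ‖g y - g z‖ₑ)
      (by fun_prop)
    rw [Measure.restrict_apply_univ, ← hV] at h2
    have h3 : (‖g y - ⨍ z in ball x r, g z‖ₑ * V) ^ 2 ≤
        (∫⁻ z in ball x r, ‖g y - g z‖ₑ ^ 2) * V := by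
      refine le_trans ?_ h2
      rw [e]
      gcongr
      exact enorm_integral_le_lintegral_enorm _
    rw [mul_pow, sq V, ← mul_assoc] at h3
    exact (ENNReal.mul_le_mul_iff_left hV0 hVt).1 h3
  have h4 := poincare hg hm x r
  rw [← hV] at h4
  refine (ENNReal.mul_le_mul_iff_left hV0 hVt).1 ?_
  rw [← lintegral_mul_const' _ _ hVt]
  refine (lintegral_mono h1).trans (h4.trans_eq ?_)
  ring

/-- pointwise comparison of the heat extension at time 1 with
ball averages:
`|u(x,1) − ⨍_{B(x,r)} g| ≤ C r^{d/2+2} ‖∇g‖_{S²_r} + C e^{-cr²} ‖g‖_{S²_r}`. -/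
theorem stmt_5 (d : ℕ) :
    ∃ C > 0, ∃ c > 0, ∀ (g : Ed d → ℝ) (g' : Ed d → Ed d →L[ℝ] ℝ),
      (∀ x, HasFDerivAt g (g' x) x) →
      (∀ x : Ed d, IntegrableOn (fun y => (g y) ^ 2) (ball x 1)) →
      BddAbove (Set.range fun x : Ed d => ∫ y in ball x 1, (g y) ^ 2) →
      (∀ x : Ed d, IntegrableOn (fun y => ‖g' y‖ ^ 2) (ball x 1)) →
      BddAbove (Set.range fun x : Ed d => ∫ y in ball x 1, ‖g' y‖ ^ 2) →
      ∀ r : ℝ, 1 ≤ r → ∀ x : Ed d,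
      |heatConv g x 1 - ⨍ y in ball x r, g y| ≤
        C * r ^ ((d : ℝ) / 2 + 2) * S2v r g'
          + C * Real.exp (-c * r ^ 2) * S2 r g := by
  set V1 : ℝ := volume.real (ball (0 : Ed d) 1) with hV1
  set K : ℝ := (4 * π * 1) ^ (-(d : ℝ) / 2) with hK
  have hK0 : 0 < K := by positivity
  set J : ℝ := (∫⁻ z : Ed d, ENNReal.ofReal (Real.exp (-(1/32) * ‖z‖ ^ 2))).toReal with hJ
  have hJe : ∫⁻ z : Ed d, ENNReal.ofReal (Real.exp (-(1/32) * ‖z‖ ^ 2)) = ENNReal.ofReal J :=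
    (ENNReal.ofReal_toReal (gauss_lt_top (by norm_num))).symm
  set I : ℝ := (∫⁻ z : Ed d, ENNReal.ofReal (Real.exp (-(1/2) * ‖z‖ ^ 2))).toReal with hI
  have hIe : ∫⁻ z : Ed d, ENNReal.ofReal (Real.exp (-(1/2) * ‖z‖ ^ 2)) = ENNReal.ofReal I :=
    (ENNReal.ofReal_toReal (gauss_lt_top (by norm_num))).symm
  have hJ0 : 0 ≤ J := ENNReal.toReal_nonneg
  have hI0 : 0 ≤ I := ENNReal.toReal_nonneg
  have hV10 : 0 ≤ V1 := ENNReal.toReal_nonneg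
  set A : ℝ := √(4 * 2 ^ d * V1 * I) with hA
  have hA0 : 0 ≤ A := Real.sqrt_nonneg _
  have hA2 : A ^ 2 = 4 * 2 ^ d * V1 * I := Real.sq_sqrt (by positivity)
  refine ⟨1 + K * A + 2 * K * J, by positivity, 1/8, by norm_num, ?_⟩
  intro g g' hg hgi hgb hg'i hg'b r hr x
  have hr0 : 0 < r := by linarith
  have hgc : Continuous g := continuous_iff_continuousAt.2 fun x => (hg x).continuousAt
  have hm : Measurable g' := by
    have : g' = fderiv ℝ g := funext fun x => (hg x).fderiv.symm
    rw [this]; exact measurable_fderiv ℝ g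
  set S := S2 r g with hS
  set T := S2v r g' with hT
  have hS0 : 0 ≤ S := Real.iSup_nonneg fun x => Real.rpow_nonneg
    (by rw [setAverage_eq]; exact smul_nonneg (by positivity)
          (integral_nonneg fun y => sq_nonneg _)) _
  have hT0 : 0 ≤ T := Real.iSup_nonneg fun x => Real.rpow_nonneg
    (by rw [setAverage_eq]; exact smul_nonneg (by positivity)
          (integral_nonneg fun y => sq_nonneg _)) _
  set V := volume (ball (0 : Ed d) r) with hV
  have hVy : ∀ y : Ed d, volume (ball y r) = V := fun y =>
    Measure.addHaar_ball_center _ y r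
  have hV0 : V ≠ 0 := (measure_ball_pos _ _ hr0).ne'
  have hVt : V ≠ ∞ := measure_ball_lt_top.ne
  have hVe : V = ENNReal.ofReal (r ^ d * V1) := by
    rw [hV, Measure.addHaar_ball_of_pos _ _ hr0, ENNReal.ofReal_mul (by positivity), hV1,
      measureReal_def, ENNReal.ofReal_toReal measure_ball_lt_top.ne]
    simp
  have hSb : ∀ z, ∫⁻ y in ball z r, ‖g y‖ₑ ^ 2 ≤ ENNReal.ofReal S ^ 2 * V := by
    intro z
    have := avg_bound (fun y => g y ^ 2) (fun _ => sq_nonneg _) hgi hgb r hr0 z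
    change _ ≤ ENNReal.ofReal (S ^ 2) * _ at this
    rw [hVy, ENNReal.ofReal_pow hS0] at this
    refine le_of_eq_of_le ?_ this
    refine lintegral_congr fun y => ?_
    rw [← ofReal_norm, ← ENNReal.ofReal_pow (norm_nonneg _), Real.norm_eq_abs, sq_abs]
  have hTb : ∫⁻ y in ball x r, ‖g' y‖ₑ ^ 2 ≤ ENNReal.ofReal T ^ 2 * V := by
    have := avg_bound (fun y => ‖g' y‖ ^ 2) (fun _ => sq_nonneg _) hg'i hg'b r hr0 x
    change _ ≤ ENNReal.ofReal (T ^ 2) * _ at this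
    rw [hVy, ENNReal.ofReal_pow hT0] at this
    refine le_of_eq_of_le ?_ this
    refine lintegral_congr fun y => ?_
    rw [← ofReal_norm, ← ENNReal.ofReal_pow (norm_nonneg _)]
  have hS1 : ∀ z, ∫⁻ y in ball z r, ‖g y‖ₑ ≤ ENNReal.ofReal S * V := by
    intro z
    have h2 := cs_set (volume.restrict (ball z r)) (f := fun y => ‖g y‖ₑ) (by fun_prop)
    rw [Measure.restrict_apply_univ, hVy] at h2
    have h3 : (∫⁻ y in ball z r, ‖g y‖ₑ) ^ 2 ≤ (ENNReal.ofReal S * V) ^ 2 := by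
      refine h2.trans ((mul_le_mul_left (hSb z) V).trans_eq (by ring))
    exact (ENNReal.pow_le_pow_left_iff two_ne_zero).1 h3
  set m := ⨍ y in ball x r, g y with hmdef
  have hmS : ‖m‖ₑ ≤ ENNReal.ofReal S := by
    have e : ‖m‖ₑ * V = ‖∫ y in ball x r, g y‖ₑ := by
      have hVr : V.toReal ≠ 0 := (ENNReal.toReal_pos hV0 hVt).ne'
      have : ∫ y in ball x r, g y = V.toReal * m := by
        rw [hmdef, setAverage_eq, measureReal_def, hVy, smul_eq_mul]
        field_simp
      rw [this, enorm_mul, mul_comm, Real.enorm_of_nonneg ENNReal.toReal_nonneg,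
        ENNReal.ofReal_toReal hVt]
    refine (ENNReal.mul_le_mul_iff_left hV0 hVt).1 ?_
    rw [e]
    exact (enorm_integral_le_lintegral_enorm _).trans (hS1 x)
  have hdiff : ∀ z, ∫⁻ y in ball z r, ‖g y - m‖ₑ ≤ ENNReal.ofReal (2 * S) * V := by
    intro z
    calc _ ≤ ∫⁻ y in ball z r, (‖g y‖ₑ + ‖m‖ₑ) := lintegral_mono fun y => enorm_sub_le
      _ = (∫⁻ y in ball z r, ‖g y‖ₑ) + ‖m‖ₑ * V := by
          rw [lintegral_add_left (by fun_prop), setLIntegral_const, hVy]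
      _ ≤ ENNReal.ofReal S * V + ENNReal.ofReal S * V := by gcongr; exact hS1 z
      _ = _ := by
          rw [ENNReal.ofReal_mul (by norm_num)]; norm_num; ring
  have hE : ∀ y, heatK d 1 (x - y) = K * Real.exp (-‖x - y‖ ^ 2 / 4) := by
    intro y; simp only [heatK, hK, mul_one]
  set E : Ed d → ℝ≥0∞ := fun y => ENNReal.ofReal (Real.exp (-‖x - y‖ ^ 2 / 4)) with hEdef
  have hEm : Measurable E := by fun_prop
  have hout := tail_bound (fun y => ‖g y - m‖ₑ) (by fun_prop) x r hr0 _ hdiff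
  rw [hJe, ← ENNReal.ofReal_mul (by positivity), ← ENNReal.ofReal_mul (by positivity)] at hout
  have hin : ∫⁻ y in ball x r, ‖g y - m‖ₑ * E y ≤
      ENNReal.ofReal (A * r ^ ((d : ℝ) / 2 + 1) * T) := by
    refine (ENNReal.pow_le_pow_left_iff two_ne_zero).1 ?_
    have hEI : ∫⁻ y in ball x r, E y ^ 2 ≤ ENNReal.ofReal I := by
      refine (setLIntegral_le_lintegral _ _).trans_eq ?_
      rw [← hIe, ← lintegral_sub_left_eq_self _ x]
      refine lintegral_congr fun y => ?_
      rw [hEdef]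
      simp only
      rw [← ENNReal.ofReal_pow (by positivity), ← Real.exp_nat_mul]
      congr 2
      rw [sub_sub_cancel]
      push_cast; ring
    calc _ ≤ (∫⁻ y in ball x r, ‖g y - m‖ₑ ^ 2) * ∫⁻ y in ball x r, E y ^ 2 :=
          cs_lintegral _ (by fun_prop) hEm.aemeasurable
      _ ≤ (ENNReal.ofReal (2 * r) ^ 2 * (2 ^ d * (ENNReal.ofReal T ^ 2 * V))) *
            ENNReal.ofReal I := by
          refine mul_le_mul' ((variance_bound hg hm x r hr0).trans ?_) hEI
          gcongr
      _ = ENNReal.ofReal ((2 * r) ^ 2 * (2 ^ d * (T ^ 2 * (r ^ d * V1))) * I) := by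
          have e2 : (2 : ℝ≥0∞) ^ d = ENNReal.ofReal (2 ^ d) := by
            rw [ENNReal.ofReal_pow (by norm_num)]; norm_num
          rw [hVe, e2, ← ENNReal.ofReal_pow hT0, ← ENNReal.ofReal_pow (by positivity),
            ← ENNReal.ofReal_mul (by positivity), ← ENNReal.ofReal_mul (by positivity),
            ← ENNReal.ofReal_mul (by positivity), ← ENNReal.ofReal_mul (by positivity)]
      _ = _ := by
          rw [← ENNReal.ofReal_pow (by positivity)]
          congr 1
          have hrp : (r ^ ((d : ℝ) / 2 + 1)) ^ 2 = r ^ d * r ^ 2 := by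
            rw [← Real.rpow_natCast, ← Real.rpow_mul hr0.le, ← pow_add, ← Real.rpow_natCast r]
            congr 1
            push_cast; ring
          rw [mul_pow _ T, mul_pow A, hA2, hrp]
          ring
  have htot : ∫⁻ y, ‖(g y - m) * heatK d 1 (x - y)‖ₑ ≤
      ENNReal.ofReal (K * (A * r ^ ((d : ℝ) / 2 + 1) * T +
        Real.exp (-(1/8) * r ^ 2) * J * (2 * S))) := by
    have e : ∀ y, ‖(g y - m) * heatK d 1 (x - y)‖ₑ = ENNReal.ofReal K * (‖g y - m‖ₑ * E y) := by
      intro y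
      rw [hE, enorm_mul, enorm_mul, Real.enorm_of_nonneg hK0.le,
        Real.enorm_of_nonneg (Real.exp_nonneg _)]
      ring
    simp_rw [e]
    rw [lintegral_const_mul _ (by fun_prop), ENNReal.ofReal_mul hK0.le,
      ENNReal.ofReal_add (by positivity) (by positivity),
      ← lintegral_add_compl _ (measurableSet_ball (x := x) (ε := r))]
    gcongr
  have hΦ : Continuous fun y => heatK d 1 (x - y) := by
    simp_rw [hE]; fun_prop
  have hint1 : Integrable fun y => (g y - m) * heatK d 1 (x - y) :=
    ⟨((hgc.sub continuous_const).mul hΦ).aestronglyMeasurable,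
      htot.trans_lt ENNReal.ofReal_lt_top⟩
  have hgauss : ∫ y, heatK d 1 (x - y) = 1 := by
    rw [integral_sub_left_eq_self (fun y => heatK d 1 y)]
    have h := GaussianFourier.integral_rexp_neg_mul_sq_norm (V := Ed d) (b := 1/4) (by norm_num)
    have e : ∀ y, heatK d 1 y = K * Real.exp (-(1/4) * ‖y‖ ^ 2) := by
      intro y; simp only [heatK, hK]; congr 2; ring
    simp_rw [e]
    rw [integral_const_mul, h, hK, finrank_euclideanSpace_fin, show π / (1/4) = 4 * π * 1 by ring,
      ← Real.rpow_add (by positivity), show -(d:ℝ)/2 + d/2 = 0 by ring, Real.rpow_zero]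
  have hint2 : Integrable fun y => heatK d 1 (x - y) := by
    by_contra hc
    rw [integral_undef hc] at hgauss
    norm_num at hgauss
  have hid : heatConv g x 1 - m = ∫ y, (g y - m) * heatK d 1 (x - y) := by
    have : heatConv g x 1 = ∫ y, ((g y - m) * heatK d 1 (x - y) + m * heatK d 1 (x - y)) := by
      rw [heatConv]
      congr 1; ext y; ring
    rw [this, integral_add hint1 (hint2.const_mul m), integral_const_mul, hgauss]
    ring
  have hfin : |heatConv g x 1 - m| ≤ K * (A * r ^ ((d : ℝ) / 2 + 1) * T +
        Real.exp (-(1/8) * r ^ 2) * J * (2 * S)) := by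
    have h := (enorm_integral_le_lintegral_enorm
      (fun y => (g y - m) * heatK d 1 (x - y))).trans htot
    rw [← hid, ← ofReal_norm, Real.norm_eq_abs] at h
    exact (ENNReal.ofReal_le_ofReal_iff (by positivity)).1 h
  refine hfin.trans ?_
  have hpow : r ^ ((d : ℝ) / 2 + 1) ≤ r ^ ((d : ℝ) / 2 + 2) :=
    Real.rpow_le_rpow_of_exponent_le hr (by linarith)
  have hp0 : 0 ≤ r ^ ((d : ℝ) / 2 + 1) := by positivity
  calc _ = (K * A) * r ^ ((d : ℝ) / 2 + 1) * T + (2 * K * J) * Real.exp (-(1/8) * r ^ 2) * S := by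
        ring
    _ ≤ _ := by
        have h1 : K * A ≤ 1 + K * A + 2 * K * J := by
          have : 0 ≤ 2 * K * J := by positivity
          linarith
        have h2 : 2 * K * J ≤ 1 + K * A + 2 * K * J := by
          have : 0 ≤ K * A := by positivity
          linarith
        gcongr
end
end

section
/- Let F ∈ L²_{loc,unif}(ℝ^d) and let u ∈ H²_loc(ℝ^d) be the unique bounded-in-S²-norm weak solution of −Δu + T^{−2} u = F in ℝ^d, T > 0. Then for any 0 < R < ∞: T^{−1} ‖∇u‖_{S²_R} + T^{−2} ‖u‖_{S²_R} ≤ C ‖F‖_{S²_R}, where C depends only on d. -/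
open MeasureTheory Metric Filter Real
noncomputable section

/-- The Laplacian of `u`, as the trace of the second derivative. -/
def lap {d : ℕ} (u : Ed d → ℝ) (x : Ed d) : ℝ :=
  ∑ i : Fin d, iteratedFDeriv ℝ 2 u x ![EuclideanSpace.single i 1, EuclideanSpace.single i 1]

/-- basis vector -/
abbrev ee {d : ℕ} (i : Fin d) : Ed d := EuclideanSpace.single i (1:ℝ)

lemma second_deriv_nonpos {h h1 : ℝ → ℝ} {c : ℝ} (hm : IsLocalMax h 0)
    (h0 : ∀ᶠ s in nhds (0:ℝ), HasDerivAt h (h1 s) s) (h2 : HasDerivAt h1 c 0) : c ≤ 0 := by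
  by_contra! hc
  have e1 : deriv h =ᶠ[nhds 0] h1 := h0.mono fun s hs => hs.deriv
  have hd : deriv h 0 = 0 := hm.deriv_eq_zero
  have hdd : deriv (deriv h) 0 = c := by rw [e1.deriv_eq]; exact h2.deriv
  have hmin : IsLocalMin h 0 := isLocalMin_of_deriv_deriv_pos (by rw [hdd]; exact hc) hd
    h0.self_of_nhds.continuousAt
  have hconst : h =ᶠ[nhds 0] fun _ => h 0 := by
    filter_upwards [hm, hmin] with s a b using le_antisymm a b
  have e2 : deriv h =ᶠ[nhds 0] fun _ => 0 := by
    have := hconst.deriv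
    simpa using this
  rw [e2.deriv_eq] at hdd
  simp at hdd
  linarith

lemma normsq_line {d : ℕ} (x : Ed d) (i : Fin d) (s : ℝ) :
    ‖x + s • ee i‖ ^ 2 = ‖x‖ ^ 2 + 2 * s * x i + s ^ 2 := by
  rw [norm_add_sq_real, inner_smul_right, norm_smul]
  simp [ee, EuclideanSpace.inner_single_right]
  ring

lemma maxprin {d : ℕ} (D : Set (Ed d)) (hD : IsClosed D) (w : Ed d → ℝ) (hw : Continuous w)
    (K : ℝ) (hK : ∀ x ∈ D, w x ≤ K) (l : ℝ) (hl : 0 < l)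
    (H : ∀ x ∈ D, w x ≤ 0 ∨ ((∀ i : Fin d, ∀ᶠ s in nhds (0:ℝ), x + s • ee i ∈ D) ∧
      ∃ (w1 : Fin d → ℝ → ℝ) (w2 : Fin d → ℝ),
        (∀ i, ∀ s, HasDerivAt (fun s : ℝ => w (x + s • ee i)) (w1 i s) s) ∧
        (∀ i, HasDerivAt (w1 i) (w2 i) 0) ∧ l * w x ≤ ∑ i, w2 i)) :
    ∀ x ∈ D, w x ≤ 0 := by
  intro x hx
  have key : ∀ ε > 0, w x ≤ ε * (‖x‖ ^ 2 + 2 * d / l) := by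
    intro ε hε
    obtain ⟨x1, hx1, hm⟩ : ∃ x1 ∈ D, IsMaxOn (fun y => w y - ε * ‖y‖ ^ 2) D x1 := by
      refine ContinuousOn.exists_isMaxOn' (by fun_prop) hD hx ?_
      have h1 : ∀ᶠ y in cocompact (Ed d), (K - (w x - ε * ‖x‖ ^ 2)) / ε ≤ ‖y‖ ^ 2 :=
        ((tendsto_pow_atTop two_ne_zero).comp
          (tendsto_norm_cocompact_atTop (E := Ed d))).eventually_ge_atTop _
      rw [eventually_inf_principal]
      filter_upwards [h1] with y hy hyD
      rw [div_le_iff₀ hε] at hy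
      have := hK y hyD
      linarith
    have hmx : w x - ε * ‖x‖ ^ 2 ≤ w x1 - ε * ‖x1‖ ^ 2 := hm hx
    have hn : 0 ≤ ε * ‖x1‖ ^ 2 := by positivity
    have hp : 0 ≤ ε * (2 * d / l) := by positivity
    rcases H x1 hx1 with h | ⟨hin, w1, w2, hw1, hw2, hle⟩
    · nlinarith
    · have hb : ∀ i, w2 i ≤ 2 * ε := by
        intro i
        have : w2 i - 2 * ε ≤ 0 := by
          refine second_deriv_nonpos (h := fun s => w (x1 + s • ee i) - ε * ‖x1 + s • ee i‖ ^ 2)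
            (h1 := fun s => w1 i s - ε * (2 * x1 i + 2 * s)) ?_ ?_ ?_
          · filter_upwards [hin i] with s hs
            simpa using hm hs
          · refine Eventually.of_forall fun s => ?_
            refine (hw1 i s).sub (HasDerivAt.const_mul ε ?_)
            simp_rw [normsq_line]
            have := ((((hasDerivAt_id s).const_mul 2).mul_const (x1 i)).const_add (‖x1‖^2)).add
              ((hasDerivAt_id s).pow 2)
            convert! this using 1
            simp
          · refine (hw2 i).sub ?_
            have := (((hasDerivAt_id (0:ℝ)).const_mul 2).const_add (2 * x1 i)).const_mul ε
            convert! this using 1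
            ring
        linarith
      have hs : ∑ i, w2 i ≤ d * (2 * ε) := by
        calc ∑ i, w2 i ≤ ∑ i : Fin d, 2 * ε := Finset.sum_le_sum fun i _ => hb i
          _ = d * (2 * ε) := by simp
      have : w x1 ≤ ε * (2 * d / l) := by
        rw [← mul_div_assoc, le_div_iff₀ hl]; nlinarith
      nlinarith
  have ht : Tendsto (fun ε : ℝ => ε * (‖x‖ ^ 2 + 2 * d / l)) (nhdsWithin 0 (Set.Ioi 0)) (nhds 0) := by
    have : Continuous (fun ε : ℝ => ε * (‖x‖ ^ 2 + 2 * d / l)) := by fun_prop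
    have := this.tendsto 0
    simp only [zero_mul] at this
    exact this.mono_left nhdsWithin_le_nhds
  exact ge_of_tendsto ht (eventually_mem_nhdsWithin.mono fun ε hε => key ε hε)

/-- derivative at every point of the line -/
lemma line_deriv {d : ℕ} {g g' : Ed d → ℝ} {e : Ed d}
    (h : ∀ x, HasDerivAt (fun s : ℝ => g (x + s • e)) (g' x) 0) (x : Ed d) (c s : ℝ) :
    HasDerivAt (fun s : ℝ => g (x + (c * s) • e)) (c * g' (x + (c * s) • e)) s := by
  have h1 := h (x + (c * s) • e)
  have h2 : HasDerivAt (fun t : ℝ => c * t - c * s) c s := by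
    simpa using ((hasDerivAt_id s).const_mul c).sub_const (c * s)
  have h3 := HasDerivAt.comp_of_eq s h1 h2 (by ring)
  convert! h3 using 1
  · ext t
    show g _ = g _
    congr 1
    rw [sub_smul]; abel
  · ring

lemma scalar_bound {d : ℕ} (g f : Ed d → ℝ) (g1 g2 : Fin d → Ed d → ℝ) (hg : Continuous g)
    (h1 : ∀ i x, HasDerivAt (fun s : ℝ => g (x + s • ee i)) (g1 i x) 0)
    (h2 : ∀ i x, HasDerivAt (fun s : ℝ => g1 i (x + s • ee i)) (g2 i x) 0)
    (K M T : ℝ) (hT : 0 < T) (hK : ∀ x, |g x| ≤ K) (hM : ∀ x, |f x| ≤ M)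
    (heq : ∀ x, -(∑ i, g2 i x) + T⁻¹ ^ 2 * g x = f x) :
    (∀ x, g x ≤ T ^ 2 * M) ∧ ∀ i, g1 i 0 ≤ T * M := by
  have hTT : T⁻¹ ^ 2 * T ^ 2 = 1 := by field_simp
  have hl : 0 < T⁻¹ ^ 2 := by positivity
  constructor
  · intro x
    have := maxprin Set.univ isClosed_univ (fun x => g x - T ^ 2 * M) (by fun_prop)
      (K - T ^ 2 * M) (fun x _ => by have := (abs_le.1 (hK x)).2; linarith) (T⁻¹ ^ 2) hl ?_ x trivial
    · linarith
    · intro x _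
      refine Or.inr ⟨by simp, fun i s => g1 i (x + s • ee i), fun i => g2 i x, ?_, ?_, ?_⟩
      · intro i s
        simpa using (line_deriv (h1 i) x 1 s).sub_const (T ^ 2 * M)
      · intro i; exact h2 i x
      · have := heq x
        have := (abs_le.1 (hM x)).2
        have : T⁻¹ ^ 2 * (g x - T ^ 2 * M) = T⁻¹ ^ 2 * g x - M := by
          rw [mul_sub, ← mul_assoc, hTT, one_mul]
        rw [this]; linarith
  · intro i
    have hM0 : 0 ≤ M := (abs_nonneg _).trans (hM 0)
    set c : Fin d → ℝ := fun j => if j = i then -1 else 1 with hc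
    have hcc : ∀ j, c j * c j = 1 := by intro j; simp only [hc]; split_ifs <;> norm_num
    set σ : Ed d → Ed d := fun x => x - (2 * x i) • ee i with hσ
    have hσc : Continuous σ := by fun_prop
    have hσl : ∀ x j (s : ℝ), σ (x + s • ee j) = σ x + (c j * s) • ee j := by
      intro x j s
      simp only [hσ, hc]
      by_cases hj : j = i
      · subst hj
        simp
        module
      · simp [hj, Ne.symm hj]
        module
    set p : Ed d → ℝ := fun x => 2 * T ^ 2 * M * (1 - exp (-(T⁻¹ * x i))) with hp
    have hpc : Continuous p := by fun_prop
    have hpl : ∀ x j (s : ℝ), p (x + s • ee j) =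
        2 * T ^ 2 * M * (1 - exp (-(T⁻¹ * (x i + if j = i then s else 0)))) := by
      intro x j s
      simp only [hp]
      by_cases hj : j = i
      · subst hj; simp
      · simp [hj, Ne.symm hj]
    have hp1 : ∀ x j (s : ℝ), HasDerivAt (fun s : ℝ => p (x + s • ee j))
        (if j = i then 2 * T * M * exp (-(T⁻¹ * (x i + s))) else 0) s := by
      intro x j s
      simp_rw [hpl]
      split_ifs with hj
      · have := (((((hasDerivAt_id s).const_add (x i)).const_mul T⁻¹).neg.exp).const_sub 1).const_mul
          (2 * T ^ 2 * M)
        convert! this using 1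
        simp only [id, Pi.neg_apply]
        field_simp
      · exact hasDerivAt_const _ _
    have hp2 : ∀ (x : Ed d) j, HasDerivAt
        (fun s : ℝ => if j = i then 2 * T * M * exp (-(T⁻¹ * (x i + s))) else 0)
        (if j = i then -(2 * M * exp (-(T⁻¹ * x i))) else 0) 0 := by
      intro x j
      split_ifs with hj
      · have := ((((hasDerivAt_id (0:ℝ)).const_add (x i)).const_mul T⁻¹).neg.exp).const_mul
          (2 * T * M)
        convert! this using 1
        simp only [id, Pi.neg_apply, add_zero]
        field_simp
      · exact hasDerivAt_const _ _
    have main := maxprin {x : Ed d | 0 ≤ x i} (isClosed_le continuous_const (by fun_prop))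
      (fun x => g x - g (σ x) - p x) (by fun_prop) (K + K) ?_ (T⁻¹ ^ 2) hl ?_
    · -- conclude
      have hd : HasDerivAt (fun s : ℝ => g (0 + s • ee i) - g (σ (0 + s • ee i)) - p (0 + s • ee i))
          (g1 i 0 - (-1) * g1 i 0 - 2 * T * M) 0 := by
        refine HasDerivAt.sub (HasDerivAt.sub (h1 i 0) ?_) ?_
        · simp_rw [hσl]
          have := line_deriv (h1 i) 0 (-1) 0
          simpa [hσ, hc] using this
        · simpa using hp1 0 i 0
      have hneg : g1 i 0 - (-1) * g1 i 0 - 2 * T * M ≤ 0 := by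
        have hs := hd.tendsto_slope_zero_right
        refine le_of_tendsto hs ?_
        filter_upwards [self_mem_nhdsWithin] with t ht
        have ht' : 0 < t := ht
        have a := main (0 + t • ee i) (by simp [ht'.le])
        have b : g (0 + (0:ℝ) • ee i) - g (σ (0 + (0:ℝ) • ee i)) - p (0 + (0:ℝ) • ee i) = 0 := by
          simp [hσ, hp]
        rw [b, smul_eq_mul, sub_zero, zero_add t]
        exact mul_nonpos_of_nonneg_of_nonpos (by positivity) a
      linarith
    · intro x hx
      have a := (abs_le.1 (hK x)).2
      have b := (abs_le.1 (hK (σ x))).1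
      have : 0 ≤ p x := by
        have : exp (-(T⁻¹ * x i)) ≤ 1 := by
          rw [exp_le_one_iff]
          have : 0 ≤ T⁻¹ * x i := mul_nonneg (by positivity) hx
          linarith
        exact mul_nonneg (by positivity) (by linarith)
      show g x - g (σ x) - p x ≤ _
      linarith
    · intro x hx
      have hx : 0 ≤ x i := hx
      rcases hx.eq_or_lt with h0 | h0
      · left
        simp [hσ, hp, ← h0]
      · right
        refine ⟨?_, fun j s => g1 j (x + s • ee j) - c j * g1 j (σ x + (c j * s) • ee j) -
          (if j = i then 2 * T * M * exp (-(T⁻¹ * (x i + s))) else 0),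
          fun j => g2 j x - g2 j (σ x) - (if j = i then -(2 * M * exp (-(T⁻¹ * x i))) else 0),
          ?_, ?_, ?_⟩
        · intro j
          have hcont : Continuous fun s : ℝ => (x + s • ee j) i := by fun_prop
          have := hcont.continuousAt.eventually (lt_mem_nhds (a := 0) (b := (x + (0:ℝ) • ee j) i)
            (by simpa using h0))
          exact this.mono fun s hs => le_of_lt hs
        · intro j s
          refine HasDerivAt.sub (HasDerivAt.sub ?_ ?_) (hp1 x j s)
          · simpa using line_deriv (h1 j) x 1 s
          · simp_rw [hσl]
            exact line_deriv (h1 j) (σ x) (c j) s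
        · intro j
          refine HasDerivAt.sub (HasDerivAt.sub (h2 j x) ?_) (hp2 x j)
          have := (line_deriv (h2 j) (σ x) (c j) 0).const_mul (c j)
          convert! this using 1
          simp [← mul_assoc, hcc]
        · have e1 := heq x
          have e2 := heq (σ x)
          have a := (abs_le.1 (hM x)).2
          have b := (abs_le.1 (hM (σ x))).1
          have : T⁻¹ ^ 2 * (g x - g (σ x) - p x) = T⁻¹ ^ 2 * g x - T⁻¹ ^ 2 * g (σ x) -
              2 * M * (1 - exp (-(T⁻¹ * x i))) := by
            simp only [hp]; field_simp
          rw [this]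
          simp only [Finset.sum_sub_distrib, Finset.sum_ite_eq', Finset.mem_univ, if_true]
          linarith

lemma intOn {d : ℕ} {h : Ed d → ℝ} (hh : Continuous h) (x : Ed d) (R : ℝ) :
    IntegrableOn h (closedBall x R) :=
  hh.continuousOn.integrableOn_compact (isCompact_closedBall x R)

lemma int_deriv {d : ℕ} {v v' ψ : Ed d → ℝ} {e : Ed d} (hv : Continuous v) (hv' : Continuous v')
    (hψ : Continuous ψ) (h : ∀ x, HasDerivAt (fun s : ℝ => v (x + s • e)) (v' x) 0)
    (x0 : Ed d) (R : ℝ) (x : Ed d) :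
    HasDerivAt (fun s : ℝ => ∫ y in closedBall x0 R, v (x + s • e + y) * ψ y)
      (∫ y in closedBall x0 R, v' (x + y) * ψ y) 0 := by
  have hcomp : IsCompact (Set.Icc (-1:ℝ) 1 ×ˢ closedBall x0 R) :=
    isCompact_Icc.prod (isCompact_closedBall x0 R)
  obtain ⟨B, hB⟩ := hcomp.exists_bound_of_continuousOn
    (f := fun q : ℝ × Ed d => v' (x + q.1 • e + q.2) * ψ q.2) (by fun_prop)
  have := (hasDerivAt_integral_of_dominated_loc_of_deriv_le
    (μ := volume.restrict (closedBall x0 R))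
    (F := fun (s : ℝ) y => v (x + s • e + y) * ψ y)
    (F' := fun (s : ℝ) y => v' (x + s • e + y) * ψ y) (x₀ := (0:ℝ)) (bound := fun _ => B)
    (s := Set.Icc (-1) 1) (Icc_mem_nhds (by norm_num) (by norm_num)) ?_ ?_ ?_ ?_ ?_ ?_).2
  · simpa using this
  · refine Eventually.of_forall fun s => Continuous.aestronglyMeasurable (by fun_prop)
  · exact intOn (by fun_prop) _ _
  · exact Continuous.aestronglyMeasurable (by fun_prop)
  · filter_upwards [ae_restrict_mem measurableSet_closedBall] with y hy s hs
    exact hB (s, y) ⟨hs, hy⟩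
  · exact intOn continuous_const _ _
  · refine Eventually.of_forall fun y s _ => ?_
    have := line_deriv h (x + y) 1 s
    simp only [one_mul] at this
    have := this.mul_const (ψ y)
    convert! this using 1
    · ext t; congr 2; abel
    · congr 2; abel

lemma int_translate {d : ℕ} (h : Ed d → ℝ) (x x0 : Ed d) (R : ℝ) :
    ∫ y in closedBall x0 R, h (x + y) = ∫ y in closedBall (x + x0) R, h y := by
  have := (measurePreserving_add_left (volume : Measure (Ed d)) x).setIntegral_preimage_emb
    (measurableEmbedding_addLeft x) h (closedBall (x + x0) R)
  rw [← this]
  congr 2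
  ext y
  simp [mem_closedBall]

lemma ball_cb {d : ℕ} (x : Ed d) {R : ℝ} (hR : 0 < R) :
    (ball x R : Set (Ed d)) =ᵐ[volume] closedBall x R := by
  refine ae_eq_of_subset_of_measure_ge ball_subset_closedBall ?_
    measurableSet_ball.nullMeasurableSet measure_closedBall_lt_top.ne
  have hs : volume (sphere x R) = 0 := Measure.addHaar_sphere_of_ne_zero volume x hR.ne'
  calc volume (closedBall x R) = volume (ball x R ∪ sphere x R) := by rw [ball_union_sphere]
    _ ≤ volume (ball x R) + volume (sphere x R) := measure_union_le _ _
    _ = volume (ball x R) := by rw [hs, add_zero]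

lemma cover {d : ℕ} {h : Ed d → ℝ} (hh : Continuous h) (h0 : ∀ x, 0 ≤ h x)
    (hb : BddAbove (Set.range fun x : Ed d => ∫ y in ball x 1, h y)) (R : ℝ) :
    ∃ K, ∀ x, ∫ y in closedBall x R, h y ≤ K := by
  obtain ⟨B, hB⟩ := hb
  obtain ⟨t, ht⟩ := (isCompact_closedBall (0 : Ed d) R).elim_finite_subcover
    (fun c : Ed d => ball c 1) (fun c => isOpen_ball)
    (fun y _ => Set.mem_iUnion.2 ⟨y, mem_ball_self one_pos⟩)
  refine ⟨∑ c ∈ t, B, fun x => ?_⟩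
  have hio : ∀ c, IntegrableOn h (ball c 1) := fun c => (intOn hh c 1).mono_set ball_subset_closedBall
  have hle : volume.restrict (closedBall x R) ≤ ∑ c ∈ t, volume.restrict (ball (x + c) 1) := by
    have hsub : closedBall x R ⊆ ⋃ c : t, ball (x + c) 1 := by
      intro y hy
      have : y - x ∈ closedBall (0 : Ed d) R := by simpa [mem_closedBall, dist_eq_norm] using hy
      obtain ⟨c, hc, hyc⟩ := Set.mem_iUnion₂.1 (ht this)
      refine Set.mem_iUnion.2 ⟨⟨c, hc⟩, ?_⟩
      simpa [mem_ball, dist_eq_norm, sub_sub] using hyc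
    calc volume.restrict (closedBall x R) ≤ volume.restrict (⋃ c : t, ball (x + c) 1) :=
          Measure.restrict_mono hsub le_rfl
      _ ≤ Measure.sum fun c : t => volume.restrict (ball (x + c) 1) := Measure.restrict_iUnion_le
      _ = ∑ c : t, volume.restrict (ball (x + (c : Ed d)) 1) := Measure.sum_fintype _
      _ = _ := Finset.sum_coe_sort t fun c => volume.restrict (ball (x + c) 1)
  calc ∫ y in closedBall x R, h y ≤ ∫ y, h y ∂(∑ c ∈ t, volume.restrict (ball (x + c) 1)) := by
        refine integral_mono_measure hle (Eventually.of_forall h0) ?_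
        exact integrable_finsetSum_measure.2 fun c _ => hio _
    _ = ∑ c ∈ t, ∫ y in ball (x + c) 1, h y :=
        integral_finsetSum_measure fun c _ => hio _
    _ ≤ ∑ c ∈ t, B := Finset.sum_le_sum fun c _ => hB ⟨x + c, rfl⟩

lemma amgm {d : ℕ} {h ψ : Ed d → ℝ} (hh : Continuous h) (hψ : Continuous ψ) (x x0 : Ed d) (R A t : ℝ)
    (ht : 0 < t) (hA : ∀ x, ∫ y in closedBall x R, h y ^ 2 ≤ A) :
    |∫ y in closedBall x0 R, h (x + y) * ψ y| ≤
      (t * A + (∫ y in closedBall x0 R, ψ y ^ 2) / t) / 2 := by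
  have h1 : |∫ y in closedBall x0 R, h (x + y) * ψ y| ≤
      ∫ y in closedBall x0 R, (t / 2 * h (x + y) ^ 2 + (1 / (2 * t)) * ψ y ^ 2) := by
    refine (abs_integral_le_integral_abs).trans ?_
    refine setIntegral_mono (intOn (by fun_prop) _ _) (intOn (by fun_prop) _ _) fun y => ?_
    have e : t / 2 * h (x + y) ^ 2 + (1 / (2 * t)) * ψ y ^ 2 - |h (x + y) * ψ y| =
        (t * |h (x + y)| - |ψ y|) ^ 2 / (2 * t) := by
      rw [abs_mul, ← sq_abs (h (x + y)), ← sq_abs (ψ y)]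
      field_simp
      ring
    have : 0 ≤ (t * |h (x + y)| - |ψ y|) ^ 2 / (2 * t) := by positivity
    show |h (x + y) * ψ y| ≤ _
    linarith
  rw [integral_add (intOn (by fun_prop) _ _) (intOn (by fun_prop) _ _), integral_const_mul,
    integral_const_mul, int_translate (fun y => h y ^ 2)] at h1
  refine h1.trans ?_
  have := mul_le_mul_of_nonneg_left (hA (x + x0)) ht.le
  have e : (∫ y in closedBall x0 R, ψ y ^ 2) / t / 2 =
    1 / (2 * t) * (∫ y in closedBall x0 R, ψ y ^ 2) := by field_simp
  linarith

lemma fd_line {d : ℕ} {u : Ed d → ℝ} (hu : Differentiable ℝ u) (x e : Ed d) :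
    HasDerivAt (fun s : ℝ => u (x + s • e)) (fderiv ℝ u x e) 0 :=
  (hu x).hasFDerivAt.hasLineDerivAt e

lemma dual_bound {d : ℕ} (u F : Ed d → ℝ) (hu : ContDiff ℝ 2 u) (hF : Continuous F) (T : ℝ)
    (hT : 0 < T) (heq : ∀ x, -(lap u x) + T⁻¹ ^ 2 * u x = F x) (R A K : ℝ)
    (hA : ∀ x, ∫ y in closedBall x R, F y ^ 2 ≤ A)
    (hK : ∀ x, ∫ y in closedBall x R, u y ^ 2 ≤ K) (x0 : Ed d) :
    (∫ y in closedBall x0 R, u y ^ 2 ≤ T ^ 4 * A) ∧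
    ∀ i, ∫ y in closedBall x0 R, (fderiv ℝ u y (ee i)) ^ 2 ≤ T ^ 2 * A := by
  have huc : Continuous u := hu.continuous
  have hfd : ContDiff ℝ 1 (fderiv ℝ u) := hu.fderiv_right (by norm_num)
  set u1 : Fin d → Ed d → ℝ := fun i x => fderiv ℝ u x (ee i) with hu1
  have hu1d : ∀ i, ContDiff ℝ 1 (u1 i) := fun i => hfd.clm_apply contDiff_const
  have hu1c : ∀ i, Continuous (u1 i) := fun i => (hu1d i).continuous
  set u2 : Fin d → Ed d → ℝ := fun i x => fderiv ℝ (u1 i) x (ee i) with hu2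
  have hu2c : ∀ i, Continuous (u2 i) := fun i =>
    ((hu1d i).continuous_fderiv one_ne_zero).clm_apply continuous_const
  have hlap : ∀ x, lap u x = ∑ i, u2 i x := by
    intro x
    refine Finset.sum_congr rfl fun i _ => ?_
    rw [iteratedFDeriv_two_apply]
    simp only [hu2, hu1]
    rw [fderiv_clm_apply (hfd.differentiable one_ne_zero x) (differentiableAt_const _)]
    simp
  have core : ∀ ψ : Ed d → ℝ, Continuous ψ → ∀ t > 0,
      (∫ y in closedBall x0 R, u y * ψ y ≤
        T ^ 2 * ((t * A + (∫ y in closedBall x0 R, ψ y ^ 2) / t) / 2)) ∧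
      ∀ i, ∫ y in closedBall x0 R, u1 i y * ψ y ≤
        T * ((t * A + (∫ y in closedBall x0 R, ψ y ^ 2) / t) / 2) := by
    intro ψ hψ t ht
    have := scalar_bound (fun x => ∫ y in closedBall x0 R, u (x + y) * ψ y)
      (fun x => ∫ y in closedBall x0 R, F (x + y) * ψ y)
      (fun i x => ∫ y in closedBall x0 R, u1 i (x + y) * ψ y)
      (fun i x => ∫ y in closedBall x0 R, u2 i (x + y) * ψ y)
      ?_ ?_ ?_ _ _ T hT (fun x => amgm huc hψ x x0 R K 1 one_pos hK)
      (fun x => amgm hF hψ x x0 R A t ht hA) ?_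
    · refine ⟨by simpa using this.1 0, fun i => by simpa using this.2 i⟩
    · exact continuous_parametric_integral_of_continuous (f := fun x y => u (x + y) * ψ y)
        (by simp only [Function.uncurry_def]; fun_prop) (isCompact_closedBall x0 R)
    · intro i x
      exact int_deriv huc (hu1c i) hψ
        (fun x => fd_line (hu.differentiable two_ne_zero) x (ee i)) x0 R x
    · intro i x
      exact int_deriv (hu1c i) (hu2c i) hψ
        (fun x => fd_line ((hu1d i).differentiable one_ne_zero) x (ee i)) x0 R x
    · intro x
      have hi : ∀ i, Integrable (fun y => u2 i (x + y) * ψ y) (volume.restrict (closedBall x0 R)) :=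
        fun i => intOn (by have := hu2c i; fun_prop) _ _
      rw [← integral_finsetSum _ fun i _ => hi i, ← integral_const_mul, ← integral_neg,
        ← integral_add]
      · congr 1
        ext y
        rw [← heq, hlap, ← Finset.sum_mul]
        ring
      · exact (integrable_finsetSum _ fun i _ => hi i).neg
      · exact intOn (by fun_prop) _ _
  constructor
  · have := (core u huc (T ^ 2) (by positivity)).1
    have e : ∫ y in closedBall x0 R, u y * u y = ∫ y in closedBall x0 R, u y ^ 2 := by
      simp_rw [sq]
    rw [e] at this
    have e2 : T ^ 2 * ((T ^ 2 * A + (∫ y in closedBall x0 R, u y ^ 2) / T ^ 2) / 2) =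
      (T ^ 4 * A + ∫ y in closedBall x0 R, u y ^ 2) / 2 := by field_simp
    linarith
  · intro i
    have := (core (u1 i) (hu1c i) T hT).2 i
    have e : ∫ y in closedBall x0 R, u1 i y * u1 i y = ∫ y in closedBall x0 R, u1 i y ^ 2 := by
      simp_rw [sq]
    rw [e] at this
    have e2 : T * ((T * A + (∫ y in closedBall x0 R, u1 i y ^ 2) / T) / 2) =
      (T ^ 2 * A + ∫ y in closedBall x0 R, u1 i y ^ 2) / 2 := by field_simp
    linarith

lemma opnorm_sq {d : ℕ} (L : Ed d →L[ℝ] ℝ) : ‖L‖ ^ 2 ≤ ∑ i, (L (ee i)) ^ 2 := by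
  have h : ‖L‖ ≤ √(∑ i, (L (ee i)) ^ 2) := by
    refine L.opNorm_le_bound (sqrt_nonneg _) fun x => ?_
    have hx : L x = ∑ i, L (ee i) * x i := by
      conv_lhs => rw [← (EuclideanSpace.basisFun (Fin d) ℝ).sum_repr x]
      simp [map_sum, mul_comm]
    rw [hx, EuclideanSpace.norm_eq, ← sqrt_mul (Finset.sum_nonneg fun i _ => sq_nonneg _)]
    refine abs_le_sqrt ?_
    simpa using Finset.sum_mul_sq_le_sq_mul_sq Finset.univ (fun i => L (ee i)) (fun i => x i)
  calc ‖L‖ ^ 2 ≤ √(∑ i, (L (ee i)) ^ 2) ^ 2 := by gcongr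
    _ = _ := sq_sqrt (Finset.sum_nonneg fun i _ => sq_nonneg _)

/-- for the solution of `−Δu + T⁻²u = F` in `ℝ^d`,
`T⁻¹‖∇u‖_{S²_R} + T⁻²‖u‖_{S²_R} ≤ C ‖F‖_{S²_R}` for all `0 < R < ∞`. -/
theorem stmt_6 (d : ℕ) :
    ∃ C > 0, ∀ (T : ℝ), 0 < T → ∀ (u F : Ed d → ℝ),
      ContDiff ℝ 2 u →
      (∀ x : Ed d, IntegrableOn (fun y => (F y) ^ 2) (ball x 1)) →
      BddAbove (Set.range fun x : Ed d => ∫ y in ball x 1, (F y) ^ 2) →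
      BddAbove (Set.range fun x : Ed d => ∫ y in ball x 1, (u y) ^ 2) →
      BddAbove (Set.range fun x : Ed d => ∫ y in ball x 1, ‖fderiv ℝ u y‖ ^ 2) →
      (∀ x, -(lap u x) + T⁻¹ ^ 2 * u x = F x) →
      ∀ R : ℝ, 0 < R →
      T⁻¹ * S2v R (fun x => fderiv ℝ u x) + T⁻¹ ^ 2 * S2 R u ≤ C * S2 R F := by
  refine ⟨√d + 1, by positivity, ?_⟩
  intro T hT u F hu _ hFb hub _ heq R hR
  have huc : Continuous u := hu.continuous
  have hfdc : Continuous (fderiv ℝ u) := hu.continuous_fderiv two_ne_zero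
  have hF : Continuous F := by
    have : F = fun x => -(lap u x) + T⁻¹ ^ 2 * u x := funext fun x => (heq x).symm
    rw [this]
    have hl : Continuous (lap u) := by
      refine continuous_finsetSum _ fun i _ => ?_
      simp_rw [iteratedFDeriv_two_apply]
      have : Continuous (fderiv ℝ (fderiv ℝ u)) :=
        (hu.fderiv_right (m := 1) (by norm_num)).continuous_fderiv one_ne_zero
      fun_prop
    fun_prop
  obtain ⟨K, hK⟩ := cover (h := fun y => u y ^ 2) (by fun_prop) (fun x => sq_nonneg _) hub R
  obtain ⟨KF, hKF⟩ := cover (h := fun y => F y ^ 2) (by fun_prop) (fun x => sq_nonneg _) hFb R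
  set V : ℝ := volume.real (closedBall (0 : Ed d) R) with hV
  have hVx : ∀ x : Ed d, volume.real (closedBall x R) = V := fun x => by
    simp only [hV, Measure.real]
    rw [Measure.addHaar_closedBall_center]
  have hVpos : 0 < V := by
    refine ENNReal.toReal_pos ?_ measure_closedBall_lt_top.ne
    exact (measure_closedBall_pos volume _ hR).ne'
  have havg : ∀ (h : Ed d → ℝ) (x : Ed d), ⨍ y in ball x R, h y = V⁻¹ * ∫ y in closedBall x R, h y := by
    intro h x
    rw [setAverage_congr (ball_cb x hR), setAverage_eq, hVx, smul_eq_mul]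
  have hbdd : BddAbove (Set.range fun x : Ed d => (⨍ y in ball x R, (F y) ^ 2) ^ (1/2 : ℝ)) := by
    refine ⟨(V⁻¹ * KF) ^ (1/2 : ℝ), ?_⟩
    rintro _ ⟨x, rfl⟩
    simp only [havg]
    have : 0 ≤ ∫ y in closedBall x R, F y ^ 2 := integral_nonneg fun y => sq_nonneg _
    have := hKF x
    gcongr
  set S := S2 R F with hS
  have hS0 : 0 ≤ S := Real.iSup_nonneg fun x => by
    rw [← sqrt_eq_rpow]; exact sqrt_nonneg _
  have hA : ∀ x, ∫ y in closedBall x R, F y ^ 2 ≤ V * S ^ 2 := by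
    intro x
    have h1 : (⨍ y in ball x R, (F y) ^ 2) ^ (1/2 : ℝ) ≤ S := le_ciSup hbdd x
    rw [← sqrt_eq_rpow, sqrt_le_left hS0, havg, inv_mul_le_iff₀ hVpos] at h1
    exact h1
  have hB := fun x0 => dual_bound u F hu hF T hT heq R (V * S ^ 2) K hA hK x0
  have hu' : S2 R u ≤ T ^ 2 * S := by
    refine ciSup_le fun x => ?_
    rw [← sqrt_eq_rpow, sqrt_le_left (by positivity), havg, inv_mul_le_iff₀ hVpos]
    have := (hB x).1
    linarith
  have hg' : S2v R (fun x => fderiv ℝ u x) ≤ √d * (T * S) := by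
    refine ciSup_le fun x => ?_
    rw [← sqrt_eq_rpow, sqrt_le_left (by positivity), havg, inv_mul_le_iff₀ hVpos]
    calc ∫ y in closedBall x R, ‖fderiv ℝ u y‖ ^ 2
        ≤ ∫ y in closedBall x R, ∑ i, (fderiv ℝ u y (ee i)) ^ 2 :=
          setIntegral_mono (intOn (by fun_prop) _ _) (intOn (by fun_prop) _ _)
            fun y => opnorm_sq _
      _ = ∑ i, ∫ y in closedBall x R, (fderiv ℝ u y (ee i)) ^ 2 :=
          integral_finsetSum _ fun i _ => intOn (by fun_prop) _ _
      _ ≤ ∑ i : Fin d, T ^ 2 * (V * S ^ 2) := Finset.sum_le_sum fun i _ => (hB x).2 i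
      _ = V * (√d * (T * S)) ^ 2 := by
          rw [mul_pow, sq_sqrt (Nat.cast_nonneg d)]
          simp
          ring
  calc T⁻¹ * S2v R (fun x => fderiv ℝ u x) + T⁻¹ ^ 2 * S2 R u
      ≤ T⁻¹ * (√d * (T * S)) + T⁻¹ ^ 2 * (T ^ 2 * S) := by gcongr
    _ = (√d + 1) * S := by field_simp
end
end

section
/- Let F ∈ L²_{loc,unif}(ℝ^d) and let u be the weak solution of −Δu + T^{−2} u = F in ℝ^d with u, ∇u ∈ L²_{loc,unif}. Then for 0 < R < ∞ the second derivatives satisfy ‖∇²u‖_{S²_R} ≤ C log(2 + T/R) ‖F‖_{S²_R}, with C depending only on d. -/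
open MeasureTheory Metric Filter Real
noncomputable section

open scoped ContDiff Topology Convolution

/-- Coordinate derivative. -/
def D {d : ℕ} (i : Fin d) (f : Ed d → ℝ) : Ed d → ℝ :=
  fun x => fderiv ℝ f x (EuclideanSpace.single i 1)

/-- Convolution of the kernel `K` with `f`. -/
def conv {d : ℕ} (K f : Ed d → ℝ) : Ed d → ℝ := fun x => ∫ y, f y * K (x - y)

lemma conv_eq {d : ℕ} (K f : Ed d → ℝ) :
    conv K f = (f ⋆[ContinuousLinearMap.mul ℝ ℝ, volume] K) := rfl

/-- Smooth compactly supported functions. -/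
structure Tst {d : ℕ} (K : Ed d → ℝ) : Prop where
  smooth : ContDiff ℝ ∞ K
  comp : HasCompactSupport K

lemma D_contDiff {d : ℕ} {i : Fin d} {f : Ed d → ℝ} {m n : WithTop ℕ∞} (h : ContDiff ℝ n f)
    (hmn : m + 1 ≤ n) : ContDiff ℝ m (D i f) := by
  unfold D
  exact (h.fderiv_right hmn).clm_apply contDiff_const

lemma D_comp {d : ℕ} {i : Fin d} {f : Ed d → ℝ} (h : HasCompactSupport f) :
    HasCompactSupport (D i f) := by
  unfold D
  exact h.fderiv_apply (𝕜 := ℝ) _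

lemma Tst.D {d : ℕ} {i : Fin d} {K : Ed d → ℝ} (h : Tst K) : Tst (D i K) :=
  ⟨D_contDiff h.smooth (by simp), D_comp h.comp⟩

lemma Tst.le {d : ℕ} {K : Ed d → ℝ} (h : Tst K) (n : ℕ) : ContDiff ℝ n K :=
  h.smooth.of_le (by exact_mod_cast le_top)

lemma Tst.continuous {d : ℕ} {K : Ed d → ℝ} (h : Tst K) : Continuous K := h.smooth.continuous

lemma D_comm {d : ℕ} {i j : Fin d} {f : Ed d → ℝ} (h : ContDiff ℝ 2 f) :
    D i (D j f) = D j (D i f) := by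
  have key : ∀ (a b : Fin d) (x : Ed d), D a (D b f) x =
      fderiv ℝ (fderiv ℝ f) x (EuclideanSpace.single a 1) (EuclideanSpace.single b 1) := by
    intro a b x
    unfold D
    have h1 : DifferentiableAt ℝ (fderiv ℝ f) x :=
      ((h.fderiv_right (m := 1) (by norm_num)).differentiable (by norm_num)) x
    rw [fderiv_clm_apply h1 (differentiableAt_const _)]
    simp
  funext x
  rw [key, key]
  exact (h.contDiffAt.isSymmSndFDerivAt (by simp)).eq _ _

lemma iter_eq {d : ℕ} {i j : Fin d} {f : Ed d → ℝ} (h : ContDiff ℝ 2 f) (x : Ed d) :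
    iteratedFDeriv ℝ 2 f x ![EuclideanSpace.single i 1, EuclideanSpace.single j 1] =
      D i (D j f) x := by
  have h1 : DifferentiableAt ℝ (fderiv ℝ f) x :=
      ((h.fderiv_right (m := 1) (by norm_num)).differentiable (by norm_num)) x
  rw [iteratedFDeriv_two_apply]
  unfold D
  rw [fderiv_clm_apply h1 (differentiableAt_const _)]
  simp

lemma lap_eq {d : ℕ} {f : Ed d → ℝ} (h : ContDiff ℝ 2 f) (x : Ed d) :
    lap f x = ∑ i, D i (D i f) x := by
  unfold lap
  exact Finset.sum_congr rfl fun i _ => iter_eq h x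

/-- Integration by parts. -/
lemma ibp {d : ℕ} {i : Fin d} {f g : Ed d → ℝ} (hf : ContDiff ℝ 1 f) (hg : ContDiff ℝ 1 g)
    (hc : HasCompactSupport g) : ∫ x, f x * D i g x = - ∫ x, D i f x * g x := by
  have c1 : Continuous (D i f) := (D_contDiff (m := 0) hf (by norm_num)).continuous
  have c2 : Continuous (D i g) := (D_contDiff (m := 0) hg (by norm_num)).continuous
  refine integral_mul_fderiv_eq_neg_fderiv_mul_of_integrable ?_ ?_ ?_ ?_ ?_
  · exact (c1.mul hg.continuous).integrable_of_hasCompactSupport hc.mul_left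
  · exact (hf.continuous.mul c2).integrable_of_hasCompactSupport (D_comp hc).mul_left
  · exact (hf.continuous.mul hg.continuous).integrable_of_hasCompactSupport hc.mul_left
  · exact fun x _ => hf.differentiable (by norm_num) x
  · exact fun x _ => hg.differentiable (by norm_num) x

/-- The `L²` identity `∫ (∂ᵢⱼV)² = ∫ ∂ᵢᵢV ∂ⱼⱼV`. -/
lemma l2_pair {d : ℕ} {i j : Fin d} {V : Ed d → ℝ} (h : Tst V) :
    ∫ x, D i (D j V) x * D i (D j V) x = ∫ x, D i (D i V) x * D j (D j V) x := by
  rw [ibp (h.D.D.le 1) (h.D.le 1) h.D.comp]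
  have e : D i (D i (D j V)) = D j (D i (D i V)) := by
    rw [D_comm (i := i) (j := j) (h.le 2), D_comm (h.D.le 2)]
  rw [e]
  have := ibp (i := j) (f := D i (D i V)) (h.D.D.le 1) (h.D.le 1) (h.D (i := j)).comp
  rw [this]

lemma l2_sum {d : ℕ} {V : Ed d → ℝ} (h : Tst V) :
    ∑ i, ∑ j, ∫ x, (D i (D j V) x) ^ 2 = ∫ x, (∑ i, D i (D i V) x) ^ 2 := by
  have int : ∀ i j, Integrable fun x => D i (D i V) x * D j (D j V) x := fun i j =>
    (h.D.D.continuous.mul h.D.D.continuous).integrable_of_hasCompactSupport h.D.D.comp.mul_left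
  have : ∀ x, (∑ i, D i (D i V) x) ^ 2 = ∑ i, ∑ j, D i (D i V) x * D j (D j V) x := by
    intro x
    rw [sq, Finset.sum_mul_sum]
  simp_rw [this]
  rw [integral_finsetSum _ fun i _ => integrable_finsetSum _ fun j _ => int i j]
  refine Finset.sum_congr rfl fun i _ => ?_
  rw [integral_finsetSum _ fun j _ => int i j]
  refine Finset.sum_congr rfl fun j _ => ?_
  rw [← l2_pair h]
  simp_rw [sq]

lemma l2_le {d : ℕ} {V : Ed d → ℝ} (h : Tst V) (i j : Fin d) :
    ∫ x, (D i (D j V) x) ^ 2 ≤ ∫ x, (∑ i, D i (D i V) x) ^ 2 := by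
  rw [← l2_sum h]
  have nn : ∀ i j, 0 ≤ ∫ x, (D i (D j V) x) ^ 2 := fun i j => integral_nonneg fun x => sq_nonneg _
  calc _ ≤ ∑ j, ∫ x, (D i (D j V) x) ^ 2 :=
        Finset.single_le_sum (f := fun j => ∫ x, (D i (D j V) x) ^ 2)
          (fun j _ => nn i j) (Finset.mem_univ j)
    _ ≤ _ := Finset.single_le_sum (f := fun i => ∑ j, ∫ x, (D i (D j V) x) ^ 2)
          (fun i _ => Finset.sum_nonneg fun j _ => nn i j) (Finset.mem_univ i)

lemma conv_tst {d : ℕ} {K f : Ed d → ℝ} (hK : Tst K) (hf : Continuous f)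
    (hc : HasCompactSupport f) : Tst (conv K f) := by
  rw [conv_eq]
  exact ⟨hK.comp.contDiff_convolution_right _ hf.locallyIntegrable hK.smooth,
    hc.convolution _ hK.comp⟩

lemma conv_continuous {d : ℕ} {K f : Ed d → ℝ} (hK : Tst K) (hf : Continuous f) :
    Continuous (conv K f) := by
  rw [conv_eq]
  exact hK.comp.continuous_convolution_right _ hf.locallyIntegrable hK.continuous

lemma D_conv {d : ℕ} {i : Fin d} {K f : Ed d → ℝ} (hK : Tst K) (hf : Continuous f) :
    D i (conv K f) = conv (D i K) f := by
  funext x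
  have := (hK.comp.hasFDerivAt_convolution_right (ContinuousLinearMap.mul ℝ ℝ)
    (hf.locallyIntegrable (μ := volume)) (hK.le 1) x).fderiv
  rw [conv_eq]
  unfold D
  rw [this, convolution_precompR_apply _ hf.locallyIntegrable (hK.comp.fderiv ℝ)
    ((hK.le 1).continuous_fderiv one_ne_zero)]
  rfl

lemma conv_integrable {d : ℕ} {K f : Ed d → ℝ} (hK : Tst K) (hf : Continuous f) (x : Ed d) :
    Integrable fun y => f y * K (x - y) := 
  (hK.comp.convolutionExists_right (ContinuousLinearMap.mul ℝ ℝ)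
    hf.locallyIntegrable hK.continuous x)

lemma refl_tst {d : ℕ} {K : Ed d → ℝ} (hK : Tst K) (x : Ed d) : Tst fun y => K (x - y) := by
  refine ⟨hK.smooth.comp (contDiff_const.sub contDiff_id), ?_⟩
  exact hK.comp.comp_homeomorph (Homeomorph.subLeft x)

lemma conv_D {d : ℕ} {i : Fin d} {K f : Ed d → ℝ} (hK : Tst K) (hf : ContDiff ℝ 1 f) :
    conv K (D i f) = conv (D i K) f := by
  funext x
  unfold conv
  have h1 := ibp (i := i) hf ((refl_tst hK x).le 1) (refl_tst hK x).comp
  have h2 : ∀ y, D i (fun y => K (x - y)) y = - D i K (x - y) := by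
    intro y
    unfold D
    have : HasFDerivAt (fun y => K (x - y))
        ((fderiv ℝ K (x - y)).comp (-ContinuousLinearMap.id ℝ (Ed d))) y := by
      have a := ((hK.le 1).differentiable (by norm_num) (x - y)).hasFDerivAt
      exact a.comp y ((hasFDerivAt_id y).const_sub x)
    rw [this.fderiv]
    simp
  simp_rw [h2] at h1
  simp only [mul_neg, integral_neg] at h1
  linarith

lemma conv_DD {d : ℕ} {i j : Fin d} {K f : Ed d → ℝ} (hK : Tst K) (hf : ContDiff ℝ 2 f) :
    conv K (D i (D j f)) = conv (D i (D j K)) f := by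
  rw [conv_D hK (D_contDiff hf (by norm_num)), conv_D hK.D (hf.of_le (by norm_num)),
    D_comm (hK.le 2)]

lemma conv_sum {d : ℕ} {ι : Type*} (s : Finset ι) {K : Ed d → ℝ} {f : ι → Ed d → ℝ} (hK : Tst K)
    (hf : ∀ k ∈ s, Continuous (f k)) (x : Ed d) :
    conv K (fun y => ∑ k ∈ s, f k y) x = ∑ k ∈ s, conv K (f k) x := by
  unfold conv
  simp_rw [Finset.sum_mul]
  exact integral_finsetSum _ fun k hk => conv_integrable hK (hf k hk) x

lemma conv_sum_left {d : ℕ} {ι : Type*} (s : Finset ι) {K : ι → Ed d → ℝ} {f : Ed d → ℝ}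
    (hK : ∀ k ∈ s, Tst (K k)) (hf : Continuous f) (x : Ed d) :
    conv (fun y => ∑ k ∈ s, K k y) f x = ∑ k ∈ s, conv (K k) f x := by
  unfold conv
  simp_rw [Finset.mul_sum]
  exact integral_finsetSum _ fun k hk => conv_integrable (hK k hk) hf x

/-- The fundamental exchange identity. -/
lemma conv_lap {d : ℕ} {i j : Fin d} {K u : Ed d → ℝ} (hK : Tst K) (hu : ContDiff ℝ 2 u)
    (x : Ed d) : conv (D i (D j K)) (fun y => ∑ k, D k (D k u) y) x =
      conv (fun y => ∑ k, D k (D k K) y) (D i (D j u)) x := by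
  have cu : ∀ a b, Continuous (D a (D b u)) := fun a b =>
    (D_contDiff (m := 0) (D_contDiff (m := 1) hu (by norm_num)) (by norm_num)).continuous
  rw [conv_sum _ hK.D.D (fun k _ => cu k k), conv_sum_left _ (fun k _ => hK.D.D) (cu i j)]
  refine Finset.sum_congr rfl fun k _ => ?_
  rw [conv_DD hK.D.D hu, conv_DD hK.D.D hu]
  congr 1
  rw [D_comm (i := k) (j := i) (hK.D.le 2), D_comm (i := k) (j := j) (hK.le 2),
    D_comm (i := k) (j := i) (hK.D.D.le 2), D_comm (i := k) (j := j) (hK.D.le 2)]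


/-- Rescaled kernel. -/
def kr {d : ℕ} (c r : ℝ) (K : Ed d → ℝ) : Ed d → ℝ := fun x => c * K (r⁻¹ • x)

lemma kr_tst {d : ℕ} {c r : ℝ} (hr : 0 < r) {K : Ed d → ℝ} (hK : Tst K) : Tst (kr c r K) := by
  refine ⟨contDiff_const.mul (hK.smooth.comp (contDiff_const_smul _)), ?_⟩
  have := hK.comp.comp_homeomorph (Homeomorph.smulOfNeZero r⁻¹ (inv_ne_zero hr.ne') : Ed d ≃ₜ Ed d)
  exact this.mul_left (f := fun _ => c)

lemma Tst.const_mul {d : ℕ} {K : Ed d → ℝ} (hK : Tst K) (c : ℝ) : Tst (fun x => c * K x) :=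
  ⟨contDiff_const.mul hK.smooth, hK.comp.mul_left (f := fun _ => c)⟩

lemma D_kr {d : ℕ} {c r : ℝ} {i : Fin d} {K : Ed d → ℝ} (hK : Tst K) :
    D i (kr c r K) = kr (c * r⁻¹) r (D i K) := by
  funext x
  unfold D kr
  have a := ((hK.le 1).differentiable (by norm_num) (r⁻¹ • x)).hasFDerivAt
  have b : HasFDerivAt (fun x : Ed d => r⁻¹ • x) (r⁻¹ • ContinuousLinearMap.id ℝ (Ed d)) x :=
    (hasFDerivAt_id x).const_smul r⁻¹
  have := (a.comp x b).const_mul c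
  rw [show (fun x => c * K (r⁻¹ • x)) = (fun x => c * (K ∘ fun x => r⁻¹ • x) x) from rfl,
    this.fderiv]
  simp
  ring

lemma rpow_mul_smooth {q : ℝ → ℝ} (hq : ContDiff ℝ ∞ q) (h0 : ∀ t < 1 / 2, q t = 0) (a : ℝ) :
    ContDiff ℝ ∞ fun t => t ^ a * q t := by
  rw [contDiff_iff_contDiffAt]
  intro t
  rcases lt_or_ge t (1 / 2) with h | h
  · have : (fun t => t ^ a * q t) =ᶠ[𝓝 t] fun _ => 0 := by
      filter_upwards [Iio_mem_nhds h] with s hs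
      rw [h0 s hs, mul_zero]
    exact contDiffAt_const.congr_of_eventuallyEq this
  · exact (Real.contDiffAt_rpow_const_of_ne (by linarith)).mul hq.contDiffAt

lemma radial_hasFDerivAt {d : ℕ} {K : ℝ → ℝ} {k' : ℝ} {x : Ed d} (h : HasDerivAt K k' (‖x‖ ^ 2))
    (i : Fin d) : D i (fun x => K (‖x‖ ^ 2)) x = 2 * k' * x i := by
  have h1 : HasFDerivAt (fun x : Ed d => ‖x‖ ^ 2) (2 • innerSL ℝ x) x :=
    (hasStrictFDerivAt_norm_sq x).hasFDerivAt
  have := h.comp_hasFDerivAt x h1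
  unfold D
  rw [show (fun x : Ed d => K (‖x‖ ^ 2)) = K ∘ fun x => ‖x‖ ^ 2 from rfl, this.fderiv]
  simp [EuclideanSpace.inner_single_right]
  ring

lemma radial_lap {d : ℕ} {K k : ℝ → ℝ} (hK : ∀ t, HasDerivAt K (k t) t) (hk : ContDiff ℝ ∞ k)
    (x : Ed d) : ∑ i, D i (D i fun x => K (‖x‖ ^ 2)) x =
      4 * ‖x‖ ^ 2 * deriv k (‖x‖ ^ 2) + 2 * d * k (‖x‖ ^ 2) := by
  have e : ∀ i : Fin d, D i (fun x => K (‖x‖ ^ 2)) = fun x => k (‖x‖ ^ 2) * (2 * x i) := by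
    intro i; funext y
    rw [radial_hasFDerivAt (hK _)]; ring
  have hkd : HasDerivAt k (deriv k (‖x‖ ^ 2)) (‖x‖ ^ 2) :=
    (hk.differentiable (by simp) _).hasDerivAt
  have f : ∀ i : Fin d, D i (D i fun x => K (‖x‖ ^ 2)) x =
      4 * deriv k (‖x‖ ^ 2) * (x i) ^ 2 + 2 * k (‖x‖ ^ 2) := by
    intro i
    rw [e]
    have g1 : DifferentiableAt ℝ (fun x : Ed d => k (‖x‖ ^ 2)) x :=
      (hkd.comp_hasFDerivAt x (hasStrictFDerivAt_norm_sq x).hasFDerivAt).differentiableAt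
    have g2 : HasFDerivAt (fun x : Ed d => 2 * x i)
        ((2 : ℝ) • (EuclideanSpace.proj i : Ed d →L[ℝ] ℝ)) x :=
      (EuclideanSpace.proj i : Ed d →L[ℝ] ℝ).hasFDerivAt.const_mul 2
    have g3 := radial_hasFDerivAt hkd i
    unfold D at g3 ⊢
    rw [fderiv_fun_mul g1 g2.differentiableAt, g2.fderiv]
    simp only [add_apply, smul_apply, g3]
    simp
    ring
  simp_rw [f]
  rw [Finset.sum_add_distrib, ← Finset.mul_sum, ← EuclideanSpace.real_norm_sq_eq]
  simp
  ring

set_option maxHeartbeats 1000000 in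
lemma exists_kernel (d : ℕ) (hd : 0 < d) : ∃ φ G : Ed d → ℝ, Tst φ ∧ Tst G ∧ (∀ x, 0 ≤ φ x) ∧
    ∫ x, φ x = 1 ∧ (∀ x, 1 < ‖x‖ → φ x = 0) ∧ (∀ x, 2 < ‖x‖ → G x = 0) ∧
    ∀ x, ∑ k, D k (D k G) x = φ x - (2 ^ d)⁻¹ * φ ((2 : ℝ)⁻¹ • x) := by
  set P : ℝ → ℝ := fun t => Real.smoothTransition (2 * t - 1) with hPdef
  have hP : ContDiff ℝ ∞ P := Real.smoothTransition.contDiff.comp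
    ((contDiff_const.mul contDiff_id).sub contDiff_const)
  have hPd : ∀ t, HasDerivAt P (deriv P t) t := fun t =>
    (hP.differentiable (by simp) t).hasDerivAt
  have hP' : ContDiff ℝ ∞ (deriv P) := (contDiff_infty_iff_deriv.1 hP).2
  have P0 : ∀ t ≤ 1 / 2, P t = 0 := fun t ht =>
    Real.smoothTransition.zero_of_nonpos (by linarith)
  have P1 : ∀ t ≥ 1, P t = 1 := fun t ht => Real.smoothTransition.one_of_one_le (by linarith)
  have Pmono : Monotone P := fun a b hab => Real.smoothTransition.monotone (by linarith)
  have P'0 : ∀ t < 1 / 2, deriv P t = 0 := by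
    intro t ht
    have : P =ᶠ[𝓝 t] fun _ => 0 := by
      filter_upwards [Iio_mem_nhds ht] with s hs using P0 s (le_of_lt hs)
    rw [this.deriv_eq]; simp
  have P'1 : ∀ t > 1, deriv P t = 0 := by
    intro t ht
    have : P =ᶠ[𝓝 t] fun _ => 1 := by
      filter_upwards [Ioi_mem_nhds ht] with s hs using P1 s (le_of_lt hs)
    rw [this.deriv_eq]; simp
  set p : ℝ := (d : ℝ) / 2 with hp
  set k : ℝ → ℝ := fun t => t ^ (-p) * (P t - P (t / 4)) with hkdef
  have hk : ContDiff ℝ ∞ k := by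
    refine rpow_mul_smooth (hP.sub (hP.comp (contDiff_id.div_const 4))) ?_ _
    intro t ht
    change P t - P (t / 4) = 0
    rcases le_or_gt 0 t with h | h
    · rw [P0 t ht.le, P0 (t / 4) (by linarith), sub_zero]
    · rw [P0 t ht.le, P0 (t / 4) (by linarith), sub_zero]
  have k4 : ∀ t ≥ 4, k t = 0 := by
    intro t ht
    simp only [hkdef]
    rw [P1 t (by linarith), P1 (t / 4) (by linarith), sub_self, mul_zero]
  set K : ℝ → ℝ := fun t => ∫ s in (4 : ℝ)..t, k s with hKdef
  have hKd : ∀ t, HasDerivAt K (k t) t := fun t =>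
    intervalIntegral.integral_hasDerivAt_right (hk.continuous.intervalIntegrable _ _)
      (hk.continuous.stronglyMeasurableAtFilter _ _) hk.continuous.continuousAt
  have hK : ContDiff ℝ ∞ K := by
    rw [contDiff_infty_iff_deriv]
    refine ⟨fun t => (hKd t).differentiableAt, ?_⟩
    rw [show deriv K = k from funext fun t => (hKd t).deriv]
    exact hk
  have K4 : ∀ t ≥ 4, K t = 0 := by
    intro t ht
    simp only [hKdef]
    rw [intervalIntegral.integral_congr (g := fun _ => 0)]
    · simp
    · intro s hs
      rw [Set.uIcc_of_le ht] at hs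
      exact k4 s hs.1
  set ψ : ℝ → ℝ := fun t => t ^ (1 - p) * deriv P t with hψdef
  have hψ : ContDiff ℝ ∞ ψ := rpow_mul_smooth hP' P'0 _
  have nsq : ContDiff ℝ ∞ fun x : Ed d => ‖x‖ ^ 2 := contDiff_norm_sq ℝ
  set φ₀ : Ed d → ℝ := fun x => 4 * ψ (‖x‖ ^ 2) with hφ₀
  set G₀ : Ed d → ℝ := fun x => K (‖x‖ ^ 2) with hG₀
  have φ1 : ∀ x, 1 < ‖x‖ → φ₀ x = 0 := by
    intro x hx
    simp only [hφ₀, hψdef]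
    rw [P'1 _ (by nlinarith)]; simp
  have G1 : ∀ x, 2 < ‖x‖ → G₀ x = 0 := by
    intro x hx
    exact K4 _ (by nlinarith)
  have φT : Tst φ₀ := by
    refine ⟨contDiff_const.mul (hψ.comp nsq), ?_⟩
    refine HasCompactSupport.of_support_subset_isCompact (isCompact_closedBall (0 : Ed d) 1) ?_
    intro x hx
    by_contra h
    exact hx (φ1 x (by simpa using h))
  have GT : Tst G₀ := by
    refine ⟨hK.comp nsq, ?_⟩
    refine HasCompactSupport.of_support_subset_isCompact (isCompact_closedBall (0 : Ed d) 2) ?_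
    intro x hx
    by_contra h
    exact hx (G1 x (by simpa using h))
  have φnn : ∀ x, 0 ≤ φ₀ x := by
    intro x
    have := Pmono.deriv_nonneg (x := ‖x‖ ^ 2)
    simp only [hφ₀, hψdef]
    positivity
  have φpos : 0 < ∫ x, φ₀ x := by
    obtain ⟨c, hc, hc'⟩ := exists_deriv_eq_slope P (a := 1 / 2) (b := 1) (by norm_num)
      hP.continuous.continuousOn (fun t _ => (hPd t).differentiableAt.differentiableWithinAt)
    rw [P1 1 le_rfl, P0 _ le_rfl] at hc'
    refine φT.continuous.integral_pos_of_hasCompactSupport_nonneg_nonzero φT.comp φnn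
      (x := EuclideanSpace.single ⟨0, hd⟩ (Real.sqrt c)) ?_
    have c0 : 0 < c := by linarith [hc.1]
    simp only [hφ₀, hψdef]
    simp only [EuclideanSpace.norm_single, Real.norm_eq_abs, sq_abs, Real.sq_sqrt c0.le, hc']
    have := Real.rpow_pos_of_pos c0 (1 - p)
    positivity
  -- the Laplacian identity
  have kd : ∀ t ≥ 0, t * deriv k t + p * k t = ψ t - 4⁻¹ * (t ^ (1 - p) * deriv P (t / 4)) := by
    intro t ht
    rcases lt_or_ge t (1 / 2) with h | h
    · have : k =ᶠ[𝓝 t] fun _ => 0 := by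
        filter_upwards [Iio_mem_nhds h] with s hs
        have hs : s < 1 / 2 := hs
        simp only [hkdef]
        rcases le_or_gt 0 s with h | h
        · rw [P0 s hs.le, P0 (s / 4) (by linarith), sub_zero, mul_zero]
        · rw [P0 s hs.le, P0 (s / 4) (by linarith), sub_zero, mul_zero]
      rw [this.deriv_eq, this.eq_of_nhds]
      simp only [hψdef]
      rw [P'0 t h, P'0 (t / 4) (by linarith)]
      simp
    · have t0 : 0 < t := by linarith
      have h1 : HasDerivAt (fun t => P (t / 4)) (deriv P (t / 4) * (1 / 4)) t :=
        HasDerivAt.comp t (h₂ := P) (h := fun t => t / 4) (hPd (t / 4))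
          ((hasDerivAt_id t).div_const 4)
      have h2 := (Real.hasDerivAt_rpow_const (p := -p) (Or.inl t0.ne')).mul ((hPd t).sub h1)
      have h3 : deriv k t = _ := h2.deriv
      rw [h3]
      simp only [hkdef, hψdef]
      have e1 : t ^ (1 - p) = t * t ^ (-p) := by
        rw [sub_eq_add_neg, Real.rpow_add t0, Real.rpow_one]
      have e2 : t * t ^ (-p - 1) = t ^ (-p) := by
        rw [Real.rpow_sub_one t0.ne']; field_simp
      rw [e1, ← e2]
      simp only [Pi.sub_apply]
      ring
  have lapG : ∀ x, ∑ k, D k (D k G₀) x = φ₀ x - (2 ^ d)⁻¹ * φ₀ ((2 : ℝ)⁻¹ • x) := by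
    intro x
    rw [hG₀, radial_lap hKd hk x]
    have := kd (‖x‖ ^ 2) (by positivity)
    have n2 : ‖(2 : ℝ)⁻¹ • x‖ ^ 2 = ‖x‖ ^ 2 / 4 := by
      rw [norm_smul]; norm_num; ring
    simp only [hφ₀, n2]
    have e : (2 ^ d)⁻¹ * (4 * ψ (‖x‖ ^ 2 / 4)) =
        (‖x‖ ^ 2) ^ (1 - p) * deriv P (‖x‖ ^ 2 / 4) := by
      simp only [hψdef]
      rw [Real.div_rpow (by positivity) (by norm_num)]
      have : (4 : ℝ) ^ (1 - p) = 4 * (2 ^ d)⁻¹ := by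
        rw [Real.rpow_sub (by norm_num), Real.rpow_one, hp, show (4 : ℝ) = 2 ^ (2 : ℝ) by norm_num,
          ← Real.rpow_mul (by norm_num), show (2 : ℝ) * (d / 2) = d by ring, Real.rpow_natCast]
        rfl
      rw [this]
      field_simp
    rw [e]
    have e' : (2 : ℝ) * d = 4 * p := by rw [hp]; ring
    rw [e']
    linarith
  set I := ∫ x, φ₀ x with hI
  refine ⟨fun x => I⁻¹ * φ₀ x, fun x => I⁻¹ * G₀ x, ?_, ?_, ?_, ?_, ?_, ?_, ?_⟩
  · exact φT.const_mul _
  · exact GT.const_mul _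
  · intro x; exact mul_nonneg (inv_nonneg.2 φpos.le) (φnn x)
  · rw [integral_const_mul, ← hI, inv_mul_cancel₀ φpos.ne']
  · intro x hx; simp [φ1 x hx]
  · intro x hx; simp [G1 x hx]
  · intro x
    have e : (fun x => I⁻¹ * G₀ x) = kr I⁻¹ 1 G₀ := by funext y; simp [kr]
    rw [e]
    have : ∀ k, D k (D k (kr I⁻¹ 1 G₀)) x = I⁻¹ * D k (D k G₀) x := by
      intro k
      rw [D_kr GT, D_kr GT.D]
      simp [kr]
    simp_rw [this]
    rw [← Finset.mul_sum, lapG]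
    ring


/-- Volume of the ball of radius `r`. -/
def vb (d : ℕ) (r : ℝ) : ℝ := volume.real (ball (0 : Ed d) r)

lemma vb_pos {d : ℕ} {r : ℝ} (hr : 0 < r) : 0 < vb d r := by
  unfold vb
  exact ENNReal.toReal_pos (measure_ball_pos _ _ hr).ne' measure_ball_lt_top.ne

lemma vb_eq {d : ℕ} {r : ℝ} (hr : 0 < r) : vb d r = r ^ d * vb d 1 := by
  unfold vb Measure.real
  rw [Measure.addHaar_ball_of_pos _ _ hr, ENNReal.toReal_mul, ENNReal.toReal_ofReal (by positivity)]
  simp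

lemma vb_center {d : ℕ} (x : Ed d) (r : ℝ) : volume.real (ball x r) = vb d r := by
  unfold vb Measure.real
  rw [Measure.addHaar_ball_center]

lemma intOn_ball {d : ℕ} {f : Ed d → ℝ} (hf : Continuous f) (x : Ed d) (r : ℝ) :
    IntegrableOn f (ball x r) :=
  (hf.continuousOn.integrableOn_compact (isCompact_closedBall x r)).mono_set ball_subset_closedBall

lemma fubini_ball {d : ℕ} {f : Ed d → ℝ} (hf : Continuous f) (h0 : ∀ x, 0 ≤ f x) {r r' A : ℝ}
    (hr : 0 < r) (hA : ∀ z, ∫ y in ball z r, f y ≤ A) (x : Ed d) :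
    ∫ y in ball x r', f y ≤ A * vb d (r + r') / vb d r := by
  have hA0 : 0 ≤ A := (integral_nonneg fun y => h0 y).trans (hA 0)
  rw [le_div_iff₀ (vb_pos hr)]
  set g : Ed d → ENNReal := fun y => ENNReal.ofReal (f y) with hg
  have gm : Measurable g := hf.measurable.ennreal_ofReal
  have conv1 : ∀ z s, ∫⁻ y in ball z s, g y = ENNReal.ofReal (∫ y in ball z s, f y) := by
    intro z s
    rw [ofReal_integral_eq_lintegral_ofReal (intOn_ball hf z s)
      (Eventually.of_forall fun y => h0 y)]
  have key : (∫⁻ y in ball x r', g y) * volume (ball (0 : Ed d) r) ≤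
      ENNReal.ofReal A * volume (ball (0 : Ed d) (r + r')) := by
    set S : Set (Ed d × Ed d) := {q | dist q.1 q.2 < r} with hS
    have Sm : MeasurableSet S := (isOpen_lt (by fun_prop) continuous_const).measurableSet
    calc (∫⁻ y in ball x r', g y) * volume (ball (0 : Ed d) r)
        = ∫⁻ y in ball x r', ∫⁻ z, S.indicator (fun q => g q.1) (y, z) := by
          rw [← lintegral_mul_const _ gm]
          refine lintegral_congr fun y => ?_
          have : ∀ z, S.indicator (fun q => g q.1) (y, z) =
              (ball y r).indicator (fun _ => g y) z := by
            intro z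
            by_cases hz : dist y z < r
            · rw [Set.indicator_of_mem (show (y, z) ∈ S from hz), Set.indicator_of_mem]
              rwa [mem_ball, dist_comm]
            · rw [Set.indicator_of_notMem (show (y, z) ∉ S from hz), Set.indicator_of_notMem]
              rwa [mem_ball, dist_comm]
          simp_rw [this]
          rw [lintegral_indicator measurableSet_ball]
          simp only [lintegral_const, Measure.restrict_apply_univ]
          rw [Measure.addHaar_ball_center volume y]
      _ = ∫⁻ z, ∫⁻ y in ball x r', S.indicator (fun q => g q.1) (y, z) := by
          refine lintegral_lintegral_swap ?_
          exact ((gm.comp measurable_fst).indicator Sm).aemeasurable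
      _ ≤ ∫⁻ z, (ball x (r + r')).indicator (fun _ => ENNReal.ofReal A) z := by
          refine lintegral_mono fun z => ?_
          by_cases hz : z ∈ ball x (r + r')
          · rw [Set.indicator_of_mem hz]
            calc ∫⁻ y in ball x r', S.indicator (fun q => g q.1) (y, z)
                ≤ ∫⁻ y, S.indicator (fun q => g q.1) (y, z) := setLIntegral_le_lintegral _ _
              _ = ∫⁻ y, (ball z r).indicator g y := lintegral_congr fun y => rfl
              _ = ∫⁻ y in ball z r, g y := lintegral_indicator measurableSet_ball _
              _ ≤ _ := by rw [conv1]; exact ENNReal.ofReal_le_ofReal (hA z)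
          · rw [Set.indicator_of_notMem hz]
            rw [setLIntegral_congr_fun (g := fun _ => 0) measurableSet_ball]
            · simp
            · intro y hy
              refine Set.indicator_of_notMem (s := S) ?_ _
              intro hyz
              have hyz : dist y z < r := hyz
              apply hz
              rw [mem_ball] at hy ⊢
              have := dist_triangle_left z x y
              linarith
      _ = _ := by
          rw [lintegral_indicator measurableSet_ball]
          simp [Measure.addHaar_ball_center volume x]
  rw [conv1] at key
  have := ENNReal.toReal_mono
    (ENNReal.mul_ne_top ENNReal.ofReal_ne_top measure_ball_lt_top.ne) key
  rw [ENNReal.toReal_mul, ENNReal.toReal_mul, ENNReal.toReal_ofReal hA0,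
    ENNReal.toReal_ofReal (integral_nonneg fun y => h0 y)] at this
  exact this

/-- Uniform local `L²` bound at scale `r`. -/
def Bd {d : ℕ} (f : Ed d → ℝ) (r M : ℝ) : Prop := ∀ x, ∫ y in ball x r, (f y) ^ 2 ≤ M ^ 2 * vb d r

lemma Bd.up {d : ℕ} {f : Ed d → ℝ} (hf : Continuous f) {r r' M : ℝ} (hr : 0 < r) (hrr : r ≤ r')
    (h : Bd f r M) : Bd f r' (2 ^ d * M) := by
  intro x
  refine (fubini_ball (hf.pow 2) (fun x => sq_nonneg _) hr h x (r' := r')).trans ?_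
  have e : M ^ 2 * vb d r * vb d (r + r') / vb d r = M ^ 2 * vb d (r + r') := by
    have := (vb_pos (d := d) hr).ne'
    field_simp
  rw [e, mul_pow, vb_eq (by linarith : 0 < r + r'), vb_eq (by linarith : 0 < r')]
  have h1 : (r + r') ^ d ≤ 2 ^ d * r' ^ d := by
    rw [← mul_pow]; exact pow_le_pow_left₀ (by linarith) (by linarith) d
  have h2 : (2 : ℝ) ^ d ≤ (2 ^ d) ^ 2 := by
    have : (1 : ℝ) ≤ 2 ^ d := one_le_pow₀ (by norm_num)
    nlinarith
  have h3 : 0 ≤ vb d 1 := (vb_pos one_pos).le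
  have h4 : 0 ≤ r' ^ d := pow_nonneg (by linarith) _
  calc M ^ 2 * ((r + r') ^ d * vb d 1) ≤ M ^ 2 * ((2 ^ d * r' ^ d) * vb d 1) := by gcongr
    _ ≤ M ^ 2 * (((2 ^ d) ^ 2 * r' ^ d) * vb d 1) := by gcongr
    _ = _ := by ring

/-- second derivative test -/
lemma second_deriv_nonpos_s7 {g g' : ℝ → ℝ} {a : ℝ} (h1 : ∀ t, HasDerivAt g (g' t) t)
    (h2 : HasDerivAt g' a 0) (hm : ∀ t, g t ≤ g 0) : a ≤ 0 := by
  by_contra h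
  push Not at h
  have e : deriv g = g' := funext fun t => (h1 t).deriv
  have hmax : IsLocalMax g 0 := Eventually.of_forall hm
  have hd : deriv g 0 = 0 := hmax.deriv_eq_zero
  have hmin := isLocalMin_of_deriv_deriv_pos (f := g) (x₀ := 0) (by rw [e, h2.deriv]; exact h) hd
    (h1 0).continuousAt
  have hc : g =ᶠ[𝓝 0] fun _ => g 0 := by
    filter_upwards [hmin, hmax] with t a b using le_antisymm b a
  have hc' : deriv g =ᶠ[𝓝 0] deriv fun _ => g 0 := hc.deriv
  have := hc'.deriv_eq
  rw [e, h2.deriv] at this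
  simp at this
  linarith

/-- Integral over the ball of radius `r` around `x`. -/
def Ib {d : ℕ} (r : ℝ) (h : Ed d → ℝ) (x : Ed d) : ℝ := ∫ y in ball (0 : Ed d) r, h (x + y)

lemma Ib_eq {d : ℕ} (r : ℝ) (h : Ed d → ℝ) (x : Ed d) : Ib r h x = ∫ y in ball x r, h y := by
  unfold Ib
  have := (measurePreserving_add_left (volume : Measure (Ed d)) x).setIntegral_preimage_emb
    (measurableEmbedding_addLeft x) h (ball x r)
  rw [← this]
  congr 2
  ext y
  simp

lemma Ib_hasDerivAt {d : ℕ} (r : ℝ) {h : Ed d → ℝ} (hh : ContDiff ℝ 1 h) (x : Ed d) (i : Fin d)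
    (t : ℝ) : HasDerivAt (fun t : ℝ => Ib r h (x + t • EuclideanSpace.single i 1))
      (Ib r (D i h) (x + t • EuclideanSpace.single i 1)) t := by
  set e : Ed d := EuclideanSpace.single i 1 with he
  have ne : ‖e‖ = 1 := by simp [he]
  have cD : Continuous (D i h) := (D_contDiff (m := 0) hh (by norm_num)).continuous
  obtain ⟨B, hB⟩ := (isCompact_closedBall (x + t • e) (|r| + 1)).exists_bound_of_continuousOn
    cD.continuousOn
  unfold Ib
  have cs : ∀ s : ℝ, ∀ k : Ed d → ℝ, Continuous k → Continuous fun y => k (x + s • e + y) :=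
    fun s k hk => hk.comp (continuous_const.add continuous_id)
  refine (hasDerivAt_integral_of_dominated_loc_of_deriv_le (bound := fun _ => B)
    (F' := fun s y => D i h (x + s • e + y)) (s := ball t 1) (ball_mem_nhds t one_pos)
    ?_ ?_ ?_ ?_ ?_ ?_).2
  · exact Eventually.of_forall fun s => (cs s h hh.continuous).aestronglyMeasurable
  · exact intOn_ball (cs t h hh.continuous) _ _
  · exact (cs t _ cD).aestronglyMeasurable
  · refine (ae_restrict_iff' measurableSet_ball).2 (Eventually.of_forall fun y hy s hs => ?_)
    apply hB
    rw [mem_closedBall, dist_eq_norm]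
    have : x + s • e + y - (x + t • e) = (s - t) • e + y := by rw [sub_smul]; abel
    rw [this]
    rw [mem_ball, Real.dist_eq] at hs
    rw [mem_ball_zero_iff] at hy
    calc _ ≤ ‖(s - t) • e‖ + ‖y‖ := norm_add_le _ _
      _ ≤ 1 + |r| := by
        rw [norm_smul, ne, mul_one, Real.norm_eq_abs]
        exact add_le_add hs.le (hy.le.trans (le_abs_self r))
      _ = _ := by ring
  · exact (intOn_ball (f := fun _ => B) continuous_const 0 r)
  · refine Eventually.of_forall fun y s _ => ?_
    have a := (hh.differentiable (by norm_num) (x + s • e + y)).hasFDerivAt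
    have b : HasDerivAt (fun s : ℝ => x + s • e + y) e s := by
      simpa using (((hasDerivAt_id s).smul_const e).const_add x).add_const y
    exact a.comp_hasDerivAt s b

lemma Ib_continuous {d : ℕ} {r : ℝ} (hr : 0 < r) {h : Ed d → ℝ} (hh : Continuous h) :
    Continuous (Ib r h) := by
  have e : Ib r h = fun x => ∫ y in closedBall (0 : Ed d) r, h (x + y) := by
    funext x
    unfold Ib
    refine setIntegral_congr_set (ae_eq_of_subset_of_measure_ge ball_subset_closedBall ?_
      measurableSet_ball.nullMeasurableSet measure_closedBall_lt_top.ne)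
    rw [Measure.addHaar_closedBall _ _ hr.le, Measure.addHaar_ball_of_pos _ _ hr]
  rw [e]
  refine continuous_parametric_integral_of_continuous (f := fun x y => h (x + y)) ?_
    (isCompact_closedBall _ _)
  exact hh.comp (continuous_fst.add continuous_snd)

lemma sup_bound {d : ℕ} {u F : Ed d → ℝ} {lam r A B : ℝ} (hl : 0 < lam)
    (hu : ContDiff ℝ 2 u) (hF : Continuous F) (hr : 0 < r)
    (heq : ∀ x, -(∑ k, D k (D k u) x) + lam * u x = F x)
    (hA : ∀ x, ∫ y in ball x r, F y ^ 2 ≤ A) (hB : ∀ x, ∫ y in ball x r, u y ^ 2 ≤ B) (x : Ed d) :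
    lam ^ 2 * ∫ y in ball x r, u y ^ 2 ≤ A := by
  set w : Ed d → ℝ := fun y => u y ^ 2 with hw
  have wC : ContDiff ℝ 2 w := hu.pow 2
  have uc := hu.continuous
  have D1 : ∀ i, D i w = fun x => 2 * u x * D i u x := by
    intro i; funext x
    unfold D
    have := ((hu.differentiable (by norm_num) x).hasFDerivAt.pow 2).fderiv
    rw [hw, this]
    simp
  have D2 : ∀ i x, D i (D i w) x = 2 * (D i u x) ^ 2 + 2 * u x * D i (D i u) x := by
    intro i x
    rw [D1]
    have a := ((hu.differentiable (by norm_num) x).hasFDerivAt.const_mul 2)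
    have b := ((D_contDiff (i := i) (m := 1) hu (by norm_num)).differentiable
      (by norm_num) x).hasFDerivAt
    have := (a.mul b).fderiv
    unfold D at this ⊢
    change fderiv ℝ ((fun y => 2 * u y) * fun x => (fderiv ℝ u x) (EuclideanSpace.single i 1)) x
      (EuclideanSpace.single i 1) = _
    rw [this]
    simp
    ring
  have point : ∀ y, lam * w y - F y ^ 2 / lam ≤ ∑ i, D i (D i w) y := by
    intro y
    simp_rw [D2]
    rw [Finset.sum_add_distrib, ← Finset.mul_sum, ← Finset.mul_sum]
    have h1 : 0 ≤ ∑ i, (D i u y) ^ 2 := Finset.sum_nonneg fun i _ => sq_nonneg _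
    have h2 : ∑ i, D i (D i u) y = lam * u y - F y := by linarith [heq y]
    rw [h2]
    have h3 : 0 ≤ (lam * u y - F y) ^ 2 / lam := by positivity
    have h4 : (lam * u y - F y) ^ 2 / lam = lam * u y ^ 2 - 2 * u y * F y + F y ^ 2 / lam := by
      field_simp
      ring
    simp only [hw]
    nlinarith
  have cDD : ∀ i, Continuous (D i (D i w)) := fun i =>
    (D_contDiff (m := 0) (D_contDiff (m := 1) wC (by norm_num)) (by norm_num)).continuous
  -- main estimate for each δ
  have main : ∀ δ > 0, Ib r w x ≤ A / lam ^ 2 + δ * (‖x‖ ^ 2 + 2 * d / lam) := by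
    intro δ hδ
    set W : Ed d → ℝ := fun x => Ib r w x - δ * ‖x‖ ^ 2 with hW
    have Wc : Continuous W := (Ib_continuous hr wC.continuous).sub (by fun_prop)
    have Wt : Tendsto W (cocompact (Ed d)) atBot := by
      have t1 : Tendsto (fun x : Ed d => B + -(δ * ‖x‖ ^ 2)) (cocompact (Ed d)) atBot := by
        refine tendsto_atBot_add_const_left _ _ (tendsto_neg_atTop_atBot.comp ?_)
        refine Tendsto.const_mul_atTop hδ ?_
        exact (tendsto_pow_atTop two_ne_zero).comp (tendsto_norm_cocompact_atTop)
      refine tendsto_atBot_mono (fun x => ?_) t1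
      have := hB x
      rw [← Ib_eq r (fun y => u y ^ 2)] at this
      simp only [hW]
      linarith
    obtain ⟨x0, hx0⟩ := Wc.exists_forall_ge Wt
    have sd : ∀ i, Ib r (D i (D i w)) x0 ≤ 2 * δ := by
      intro i
      have nn : ∀ t : ℝ, ‖x0 + t • EuclideanSpace.single i (1 : ℝ)‖ ^ 2 =
          ‖x0‖ ^ 2 + 2 * t * x0 i + t ^ 2 := by
        intro t
        rw [norm_add_sq_real, inner_smul_right, norm_smul]
        simp [EuclideanSpace.inner_single_right]
        ring
      have pd : ∀ t : ℝ, HasDerivAt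
          (fun t : ℝ => δ * ‖x0 + t • EuclideanSpace.single i (1 : ℝ)‖ ^ 2)
          (δ * (2 * x0 i + 2 * t)) t := by
        intro t
        simp_rw [nn]
        have := ((((hasDerivAt_id t).const_mul 2).mul_const (x0 i)).const_add (‖x0‖ ^ 2)).add
          ((hasDerivAt_id t).pow 2)
        exact (this.const_mul δ).congr_deriv (by simp)
      have pd2 : HasDerivAt (fun t : ℝ => δ * (2 * x0 i + 2 * t)) (2 * δ) 0 := by
        have := (((hasDerivAt_id (0 : ℝ)).const_mul 2).const_add (2 * x0 i)).const_mul δ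
        exact this.congr_deriv (by ring)
      have i1 := fun t => (Ib_hasDerivAt r (wC.of_le (by norm_num)) x0 i t).sub (pd t)
      have i2 := (Ib_hasDerivAt r (D_contDiff (i := i) wC (by norm_num)) x0 i 0).sub pd2
      have := second_deriv_nonpos_s7 i1 i2 (fun t => by
        have := hx0 (x0 + t • EuclideanSpace.single i (1 : ℝ))
        simpa [hW] using this)
      simp at this
      linarith
    have cs : ∀ k : Ed d → ℝ, Continuous k → IntegrableOn (fun y => k (x0 + y)) (ball 0 r) :=
      fun k hk => intOn_ball (hk.comp (continuous_const.add continuous_id)) _ _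
    have s1 : lam * Ib r w x0 - (Ib r (fun y => F y ^ 2) x0) / lam ≤ 2 * d * δ := by
      calc lam * Ib r w x0 - (Ib r (fun y => F y ^ 2) x0) / lam
          = ∫ y in ball (0 : Ed d) r, (lam * w (x0 + y) - F (x0 + y) ^ 2 / lam) := by
            unfold Ib
            rw [integral_sub ((cs w wC.continuous).const_mul lam)
              ((cs (fun y => F y ^ 2) (hF.pow 2)).div_const lam), integral_const_mul,
              integral_div]
        _ ≤ ∫ y in ball (0 : Ed d) r, ∑ i, D i (D i w) (x0 + y) := by
            refine integral_mono (((cs w wC.continuous).const_mul lam).sub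
              ((cs (fun y => F y ^ 2) (hF.pow 2)).div_const lam)) ?_ fun y => point (x0 + y)
            exact integrable_finsetSum _ fun i _ => cs _ (cDD i)
        _ = ∑ i, Ib r (D i (D i w)) x0 := integral_finsetSum _ fun i _ => cs _ (cDD i)
        _ ≤ ∑ i : Fin d, 2 * δ := Finset.sum_le_sum fun i _ => sd i
        _ = _ := by simp; ring
    have s2 : Ib r (fun y => F y ^ 2) x0 ≤ A := by rw [Ib_eq]; exact hA x0
    have s3 : Ib r w x0 ≤ A / lam ^ 2 + δ * (2 * d / lam) := by
      have : lam * Ib r w x0 ≤ A / lam + 2 * d * δ := by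
        have := div_le_div_of_nonneg_right s2 hl.le
        linarith
      calc Ib r w x0 = (lam * Ib r w x0) / lam := by field_simp
        _ ≤ (A / lam + 2 * d * δ) / lam := by gcongr
        _ = _ := by field_simp
    have s4 := hx0 x
    simp only [hW] at s4
    have : 0 ≤ δ * ‖x0‖ ^ 2 := by positivity
    linarith
  have fin : Ib r w x ≤ A / lam ^ 2 := by
    set Q := ‖x‖ ^ 2 + 2 * d / lam with hQ
    have hQ0 : 0 ≤ Q := by positivity
    refine le_of_forall_pos_le_add fun ε hε => ?_
    have := main (ε / (Q + 1)) (by positivity)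
    have h2 : ε / (Q + 1) * Q ≤ ε := by
      rw [div_mul_eq_mul_div, div_le_iff₀ (by positivity)]
      nlinarith
    linarith
  rw [Ib_eq, le_div_iff₀ (by positivity)] at fin
  linarith


lemma intAbs_le {d : ℕ} {f : Ed d → ℝ} (hf : Continuous f) {r M : ℝ} (hM : 0 < M)
    (h : Bd f r M) (x : Ed d) : ∫ y in ball x r, |f y| ≤ M * vb d r := by
  have i1 : IntegrableOn (fun y => f y ^ 2) (ball x r) := intOn_ball (hf.pow 2) x r
  have i2 : IntegrableOn (fun _ => M) (ball x r) := intOn_ball continuous_const x r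
  have i1' : IntegrableOn (fun y => f y ^ 2 / M) (ball x r) := i1.div_const M
  calc ∫ y in ball x r, |f y| ≤ ∫ y in ball x r, (f y ^ 2 / M + M) / 2 := by
        refine integral_mono (intOn_ball hf.abs x r) ((i1'.add i2).div_const 2) ?_
        intro y
        simp only
        rw [le_div_iff₀ two_pos, div_add' _ _ _ hM.ne', le_div_iff₀ hM]
        nlinarith [sq_nonneg (|f y| - M), sq_abs (f y)]
    _ = ((∫ y in ball x r, f y ^ 2) / M + M * vb d r) / 2 := by
        rw [integral_div, integral_add i1' i2, integral_div]
        simp [vb_center]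
        ring
    _ ≤ ((M ^ 2 * vb d r) / M + M * vb d r) / 2 := by
        have := h x
        gcongr
    _ = _ := by field_simp; ring

lemma conv_bound {d : ℕ} {K f : Ed d → ℝ} (hf : Continuous f) {B r a M : ℝ} (hr : 0 < r)
    (hM : 0 < M) (hK0 : ∀ x, 2 < ‖x‖ → K x = 0) (hB : ∀ x, |K x| ≤ B) (h : Bd f (3 * r) M)
    (x : Ed d) : |conv (kr (a * (r ^ d)⁻¹) r K) f x| ≤ |a| * (B * (3 ^ d * vb d 1) * M) := by
  have B0 : 0 ≤ B := (abs_nonneg _).trans (hB 0)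
  set c := |a| * (r ^ d)⁻¹ * B with hc
  have c0 : 0 ≤ c := by positivity
  have i1 : IntegrableOn (fun y => |f y|) (ball x (3 * r)) := intOn_ball hf.abs x (3 * r)
  have i1' : IntegrableOn (fun y => c * |f y|) (ball x (3 * r)) := i1.const_mul c
  have : |conv (kr (a * (r ^ d)⁻¹) r K) f x| ≤
      ∫ y, (ball x (3 * r)).indicator (fun y => c * |f y|) y := by
    unfold conv
    rw [← Real.norm_eq_abs]
    refine norm_integral_le_of_norm_le ((integrable_indicator_iff measurableSet_ball).2 i1')
      (Eventually.of_forall fun y => ?_)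
    by_cases hy : y ∈ ball x (3 * r)
    · rw [Set.indicator_of_mem hy]
      rw [Real.norm_eq_abs, abs_mul, kr, abs_mul, abs_mul, mul_comm, hc]
      have : |(r ^ d)⁻¹| = (r ^ d)⁻¹ := abs_of_nonneg (by positivity)
      rw [this]
      gcongr
      exact hB _
    · rw [Set.indicator_of_notMem hy]
      have : K (r⁻¹ • (x - y)) = 0 := by
        apply hK0
        rw [norm_smul, norm_inv, Real.norm_of_nonneg hr.le, ← dist_eq_norm, dist_comm]
        rw [mem_ball, not_lt] at hy
        rw [inv_mul_eq_div, lt_div_iff₀ hr]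
        linarith
      simp [kr, this]
  refine this.trans ?_
  rw [integral_indicator measurableSet_ball, integral_const_mul]
  calc c * ∫ y in ball x (3 * r), |f y| ≤ c * (M * vb d (3 * r)) := by
        gcongr
        exact intAbs_le hf hM h x
    _ = _ := by
        rw [vb_eq (by positivity : 0 < 3 * r), hc, mul_pow]
        field_simp

lemma conv_eq' {d : ℕ} (K f : Ed d → ℝ) (x : Ed d) :
    conv K f x = (K ⋆[ContinuousLinearMap.lsmul ℝ ℝ, volume] f) x := by
  rw [convolution_eq_swap]
  unfold conv
  refine integral_congr_ae (Eventually.of_forall fun y => ?_)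
  simp [mul_comm]

lemma sq_comp {d : ℕ} {h : Ed d → ℝ} (hc : HasCompactSupport h) :
    HasCompactSupport fun y => h y ^ 2 := by
  have : (fun y => h y ^ 2) = h * h := by funext y; simp [sq]
  rw [this]
  exact hc.mul_left

lemma sq_int {d : ℕ} {h : Ed d → ℝ} (h1 : Continuous h) (hc : HasCompactSupport h) :
    Integrable fun y => h y ^ 2 := (h1.pow 2).integrable_of_hasCompactSupport (sq_comp hc)

lemma young {d : ℕ} {K h : Ed d → ℝ} (hK : Tst K) (h0 : ∀ x, 0 ≤ K x) (h1 : ∫ x, K x = 1)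
    (hh : Continuous h) (hc : HasCompactSupport h) :
    ∫ x, (conv K h x) ^ 2 ≤ ∫ x, h x ^ 2 := by
  have jensen : ∀ x, (conv K h x) ^ 2 ≤ conv K (fun y => h y ^ 2) x := by
    intro x
    set c := conv K h x with hcdef
    have I1 : Integrable fun y => h y ^ 2 * K (x - y) := conv_integrable hK (hh.pow 2) x
    have I2 := conv_integrable hK hh x
    have I3 : Integrable fun y => K (x - y) :=
      (refl_tst hK x).continuous.integrable_of_hasCompactSupport (refl_tst hK x).comp
    have e3 : ∫ y, K (x - y) = 1 := by rw [integral_sub_left_eq_self K volume x, h1]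
    have e : ∫ y, (h y - c) ^ 2 * K (x - y) = conv K (fun y => h y ^ 2) x - c ^ 2 := by
      have : ∀ y, (h y - c) ^ 2 * K (x - y) =
          h y ^ 2 * K (x - y) - (2 * c) * (h y * K (x - y)) + c ^ 2 * K (x - y) := by
        intro y; ring
      simp_rw [this]
      have I12 : Integrable fun y => h y ^ 2 * K (x - y) - (2 * c) * (h y * K (x - y)) :=
        I1.sub (I2.const_mul _)
      rw [integral_add I12 (I3.const_mul _),
        integral_sub I1 (I2.const_mul _), integral_const_mul, integral_const_mul, e3]
      change conv K (fun y => h y ^ 2) x - 2 * c * conv K h x + c ^ 2 * 1 = _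
      rw [← hcdef]; ring
    have : 0 ≤ ∫ y, (h y - c) ^ 2 * K (x - y) :=
      integral_nonneg fun y => mul_nonneg (sq_nonneg _) (h0 _)
    linarith
  have hc2 : HasCompactSupport fun y => h y ^ 2 := by
    exact sq_comp hc
  have T1 := conv_tst hK hh hc
  have T2 : Tst (conv K fun y => h y ^ 2) := conv_tst hK (hh.pow 2) hc2
  calc ∫ x, (conv K h x) ^ 2 ≤ ∫ x, conv K (fun y => h y ^ 2) x := by
        refine integral_mono ?_ (T2.continuous.integrable_of_hasCompactSupport T2.comp) jensen
        exact sq_int T1.continuous T1.comp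
    _ = ∫ x, h x ^ 2 := by
        rw [conv_eq, integral_convolution _ (sq_int hh hc)
          (hK.continuous.integrable_of_hasCompactSupport hK.comp), h1]
        simp

lemma D_zero_of {d : ℕ} {i : Fin d} {K : Ed d → ℝ} {ρ : ℝ} (h : ∀ x, ρ < ‖x‖ → K x = 0) :
    ∀ x, ρ < ‖x‖ → D i K x = 0 := by
  intro x hx
  have : K =ᶠ[𝓝 x] fun _ => 0 := by
    filter_upwards [(isOpen_lt continuous_const continuous_norm).mem_nhds hx] with y hy using h y hy
  unfold D
  rw [this.fderiv_eq]
  simp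

lemma Tst.sum {d : ℕ} {ι : Type*} (s : Finset ι) {K : ι → Ed d → ℝ} (h : ∀ k ∈ s, Tst (K k)) :
    Tst fun x => ∑ k ∈ s, K k x := by
  classical
  refine ⟨ContDiff.sum fun k hk => (h k hk).smooth, ?_⟩
  induction s using Finset.induction_on with
  | empty => simp [HasCompactSupport, tsupport, Function.support]
  | insert a s ha ih =>
    simp_rw [Finset.sum_insert ha]
    exact (h a (by simp)).comp.add (ih fun k hk => h k (by simp [hk]))

lemma D_sum {d : ℕ} {ι : Type*} (s : Finset ι) {K : ι → Ed d → ℝ} (h : ∀ k ∈ s, Tst (K k))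
    (i : Fin d) : D i (fun x => ∑ k ∈ s, K k x) = fun x => ∑ k ∈ s, D i (K k) x := by
  funext x
  unfold D
  rw [fderiv_fun_sum fun k hk => ((h k hk).le 1).differentiable (by norm_num) x]
  simp

/-- The package of kernels. -/
structure Kern {d : ℕ} (φ G : Ed d → ℝ) : Prop where
  tφ : Tst φ
  tG : Tst G
  nn : ∀ x, 0 ≤ φ x
  one : ∫ x, φ x = 1
  sφ : ∀ x, 1 < ‖x‖ → φ x = 0
  sG : ∀ x, 2 < ‖x‖ → G x = 0
  lap : ∀ x, ∑ k, D k (D k G) x = φ x - (2 ^ d)⁻¹ * φ ((2 : ℝ)⁻¹ • x)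

/-- Normalized rescaled averaging kernel. -/
def Ph {d : ℕ} (φ : Ed d → ℝ) (r : ℝ) : Ed d → ℝ := kr (r ^ d)⁻¹ r φ

/-- Rescaled potential. -/
def Ga {d : ℕ} (G : Ed d → ℝ) (r : ℝ) : Ed d → ℝ := kr (r ^ 2 * (r ^ d)⁻¹) r G

lemma Ph_tst {d : ℕ} {φ G : Ed d → ℝ} {r : ℝ} (hr : 0 < r) (h : Kern φ G) : Tst (Ph φ r) :=
  kr_tst hr h.tφ

lemma Ga_tst {d : ℕ} {φ G : Ed d → ℝ} {r : ℝ} (hr : 0 < r) (h : Kern φ G) : Tst (Ga G r) :=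
  kr_tst hr h.tG

lemma Ga_DD {d : ℕ} {G : Ed d → ℝ} (hG : Tst G) {r : ℝ} (hr : 0 < r) (i j : Fin d) :
    D i (D j (Ga G r)) = kr (1 * (r ^ d)⁻¹) r (D i (D j G)) := by
  unfold Ga
  rw [D_kr hG, D_kr hG.D]
  congr 1
  field_simp

lemma Ph_DD {d : ℕ} {G : Ed d → ℝ} (hG : Tst G) {r : ℝ} (hr : 0 < r) (i j : Fin d) :
    D i (D j (Ph G r)) = kr ((r ^ 2)⁻¹ * (r ^ d)⁻¹) r (D i (D j G)) := by
  unfold Ph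
  rw [D_kr hG, D_kr hG.D]
  congr 1
  field_simp

lemma Ga_lap {d : ℕ} {φ G : Ed d → ℝ} (h : Kern φ G) {r : ℝ} (hr : 0 < r) (x : Ed d) :
    ∑ k, D k (D k (Ga G r)) x = Ph φ r x - Ph φ (2 * r) x := by
  simp_rw [Ga_DD h.tG hr]
  unfold kr
  rw [← Finset.mul_sum, h.lap]
  unfold Ph kr
  rw [smul_smul, mul_inv, mul_pow, mul_inv]
  ring

lemma Ph_int {d : ℕ} {φ G : Ed d → ℝ} (h : Kern φ G) {r : ℝ} (hr : 0 < r) :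
    ∫ x, Ph φ r x = 1 := by
  unfold Ph kr
  rw [integral_const_mul, Measure.integral_comp_inv_smul, h.one]
  simp [abs_of_pos hr]
  field_simp

lemma Ph_nn {d : ℕ} {φ G : Ed d → ℝ} (h : Kern φ G) {r : ℝ} (hr : 0 < r) (x : Ed d) :
    0 ≤ Ph φ r x := mul_nonneg (by positivity) (h.nn _)

lemma kr_zero {d : ℕ} {K : Ed d → ℝ} {c r ρ : ℝ} (hr : 0 < r) (h : ∀ x, ρ < ‖x‖ → K x = 0)
    (x : Ed d) (hx : ρ * r < ‖x‖) : kr c r K x = 0 := by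
  unfold kr
  rw [h, mul_zero]
  rw [norm_smul, norm_inv, Real.norm_of_nonneg hr.le, inv_mul_eq_div, lt_div_iff₀ hr]
  exact hx

lemma conv_sub_left {d : ℕ} {K L f : Ed d → ℝ} (hK : Tst K) (hL : Tst L) (hf : Continuous f)
    (x : Ed d) : conv (fun y => K y - L y) f x = conv K f x - conv L f x := by
  unfold conv
  rw [← integral_sub (conv_integrable hK hf x) (conv_integrable hL hf x)]
  simp_rw [mul_sub]

lemma DD_cont {d : ℕ} {u : Ed d → ℝ} (hu : ContDiff ℝ 2 u) (a b : Fin d) :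
    Continuous (D a (D b u)) :=
  (D_contDiff (m := 0) (D_contDiff (m := 1) hu (by norm_num)) (by norm_num)).continuous

lemma lap_cont {d : ℕ} {u : Ed d → ℝ} (hu : ContDiff ℝ 2 u) :
    Continuous fun y => ∑ k, D k (D k u) y :=
  continuous_finsetSum _ fun k _ => DD_cont hu k k

lemma step {d : ℕ} {φ G u : Ed d → ℝ} (h : Kern φ G) (hu : ContDiff ℝ 2 u) {r : ℝ} (hr : 0 < r)
    (i j : Fin d) (x : Ed d) : conv (Ph φ r) (D i (D j u)) x =
      conv (D i (D j (Ga G r))) (fun y => ∑ k, D k (D k u) y) x +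
        conv (Ph φ (2 * r)) (D i (D j u)) x := by
  rw [conv_lap (Ga_tst hr h) hu]
  have : (fun y => ∑ k, D k (D k (Ga G r)) y) = fun y => Ph φ r y - Ph φ (2 * r) y :=
    funext fun y => Ga_lap h hr y
  rw [this, conv_sub_left (Ph_tst hr h) (Ph_tst (by positivity) h) (DD_cont hu i j)]
  ring

/-- Iterated step bound. -/
lemma tele {d : ℕ} {φ G u : Ed d → ℝ} (h : Kern φ G) (hu : ContDiff ℝ 2 u) {r : ℝ} (hr : 0 < r)
    {i j : Fin d} {Q : ℝ} (x : Ed d)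
    (hQ : ∀ s, r ≤ s → |conv (D i (D j (Ga G s))) (fun y => ∑ k, D k (D k u) y) x| ≤ Q) (n : ℕ) :
    |conv (Ph φ r) (D i (D j u)) x| ≤ n * Q + |conv (Ph φ (2 ^ n * r)) (D i (D j u)) x| := by
  induction n with
  | zero => simp
  | succ n ih =>
    have p : (1 : ℝ) ≤ 2 ^ n := one_le_pow₀ (by norm_num)
    rw [step h hu (by positivity : 0 < 2 ^ n * r)] at ih
    have e : (2 : ℝ) * (2 ^ n * r) = 2 ^ (n + 1) * r := by ring
    rw [e] at ih
    have := hQ (2 ^ n * r) (by nlinarith)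
    have := abs_add_le (conv (D i (D j (Ga G (2 ^ n * r)))) (fun y => ∑ k, D k (D k u) y) x)
      (conv (Ph φ (2 ^ (n + 1) * r)) (D i (D j u)) x)
    push_cast
    linarith

lemma local_est {d : ℕ} {φ G u : Ed d → ℝ} (h : Kern φ G) (hu : ContDiff ℝ 2 u) {r : ℝ}
    (hr : 0 < r) (i j : Fin d) (n : ℕ) (x0 : Ed d) :
    ∫ x in ball x0 r, (conv (Ph φ (r / 2 ^ n)) (D i (D j u)) x
      - conv (Ph φ r) (D i (D j u)) x) ^ 2 ≤
      4 * ∫ y in ball x0 (3 * r), (∑ k, D k (D k u) y) ^ 2 := by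
  set s := r / 2 ^ n with hs
  have s0 : 0 < s := by positivity
  set g : Ed d → ℝ := fun y => ∑ k, D k (D k u) y with hg
  have gc : Continuous g := lap_cont hu
  set w := D i (D j u) with hw
  have wc : Continuous w := DD_cont hu i j
  set Gs : Ed d → ℝ := fun y => ∑ m ∈ Finset.range n, Ga G (2 ^ m * s) y with hGs
  have tGa : ∀ m ∈ Finset.range n, Tst (Ga G (2 ^ m * s)) := fun m _ =>
    Ga_tst (by positivity) h
  have tGs : Tst Gs := Tst.sum _ tGa
  have lapGs : (fun y => ∑ k, D k (D k Gs) y) = fun y => Ph φ s y - Ph φ r y := by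
    funext y
    have : ∀ k, D k (D k Gs) y = ∑ m ∈ Finset.range n, D k (D k (Ga G (2 ^ m * s))) y := by
      intro k
      rw [hGs, D_sum _ tGa, D_sum _ fun m hm => (tGa m hm).D]
    simp_rw [this]
    rw [Finset.sum_comm]
    have e : ∀ m ∈ Finset.range n, ∑ k, D k (D k (Ga G (2 ^ m * s))) y =
        Ph φ (2 ^ m * s) y - Ph φ (2 ^ (m + 1) * s) y := by
      intro m _
      rw [Ga_lap h (by positivity), show 2 * (2 ^ m * s) = 2 ^ (m + 1) * s by ring]
    rw [Finset.sum_congr rfl e, Finset.sum_range_sub']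
    have : 2 ^ n * s = r := by rw [hs]; field_simp
    rw [this]; simp
  have zGs : ∀ x, r < ‖x‖ → Gs x = 0 := by
    intro x hx
    refine Finset.sum_eq_zero fun m hm => kr_zero (by positivity) h.sG x (lt_of_le_of_lt ?_ hx)
    have hm : m + 1 ≤ n := Finset.mem_range.1 hm
    calc 2 * (2 ^ m * s) = 2 ^ (m + 1) * s := by ring
      _ ≤ 2 ^ n * s := by gcongr; norm_num
      _ = r := by rw [hs]; field_simp
  -- cutoff
  let η : ContDiffBump x0 := ⟨2 * r, 3 * r, by positivity, by linarith⟩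
  have ηc : Continuous η := η.continuous
  set f : Ed d → ℝ := fun y => η y * g y with hf
  have fc : Continuous f := ηc.mul gc
  have fcs : HasCompactSupport f := η.hasCompactSupport.mul_right
  set V := conv Gs f with hV
  have tV : Tst V := conv_tst tGs fc fcs
  have DV : ∀ a b, D a (D b V) = conv (D a (D b Gs)) f := by
    intro a b
    rw [hV, D_conv tGs fc, D_conv tGs.D fc]
  have lapV : ∀ x, ∑ k, D k (D k V) x = conv (Ph φ s) f x - conv (Ph φ r) f x := by
    intro x
    simp_rw [DV]
    rw [← conv_sum_left _ (fun k _ => tGs.D.D) fc, lapGs,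
      conv_sub_left (Ph_tst s0 h) (Ph_tst hr h) fc]
  have eq1 : ∀ x ∈ ball x0 r, conv (Ph φ s) w x - conv (Ph φ r) w x = D i (D j V) x := by
    intro x hx
    rw [← conv_sub_left (Ph_tst s0 h) (Ph_tst hr h) wc, DV]
    rw [← lapGs, hw, ← conv_lap tGs hu]
    unfold conv
    refine integral_congr_ae (Eventually.of_forall fun y => ?_)
    simp only
    by_cases hy : r < ‖x - y‖
    · rw [D_zero_of (D_zero_of zGs) _ hy]; simp
    · have : η y = 1 := by
        apply η.one_of_mem_closedBall
        rw [mem_ball] at hx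
        rw [← dist_eq_norm, dist_comm] at hy
        rw [mem_closedBall]
        change dist y x0 ≤ 2 * r
        have := dist_triangle y x x0
        linarith
      simp [hf, this, hg]
  have t1 := conv_tst (Ph_tst s0 h : Tst (Ph φ s)) fc fcs
  have t2 := conv_tst (Ph_tst hr h : Tst (Ph φ r)) fc fcs
  calc ∫ x in ball x0 r, (conv (Ph φ s) w x - conv (Ph φ r) w x) ^ 2
      = ∫ x in ball x0 r, (D i (D j V) x) ^ 2 :=
        setIntegral_congr_fun measurableSet_ball fun x hx => by simp only [eq1 x hx]
    _ ≤ ∫ x, (D i (D j V) x) ^ 2 :=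
        setIntegral_le_integral (sq_int tV.D.D.continuous tV.D.D.comp)
          (Eventually.of_forall fun x => sq_nonneg _)
    _ ≤ ∫ x, (∑ k, D k (D k V) x) ^ 2 := l2_le tV i j
    _ ≤ ∫ x, (2 * conv (Ph φ s) f x ^ 2 + 2 * conv (Ph φ r) f x ^ 2) := by
        have tl : Tst fun x => ∑ k, D k (D k V) x := Tst.sum _ fun k _ => tV.D.D
        refine integral_mono (sq_int tl.continuous tl.comp)
          (((sq_int t1.continuous t1.comp).const_mul 2).add
            ((sq_int t2.continuous t2.comp).const_mul 2)) fun x => ?_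
        simp only [lapV]
        nlinarith [sq_nonneg (conv (Ph φ s) f x + conv (Ph φ r) f x)]
    _ = 2 * (∫ x, conv (Ph φ s) f x ^ 2) + 2 * ∫ x, conv (Ph φ r) f x ^ 2 := by
        rw [integral_add ((sq_int t1.continuous t1.comp).const_mul 2)
            ((sq_int t2.continuous t2.comp).const_mul 2), integral_const_mul, integral_const_mul]
    _ ≤ 4 * ∫ x, f x ^ 2 := by
        have y1 := young (Ph_tst s0 h : Tst (Ph φ s)) (Ph_nn h s0) (Ph_int h s0) fc fcs
        have y2 := young (Ph_tst hr h : Tst (Ph φ r)) (Ph_nn h hr) (Ph_int h hr) fc fcs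
        linarith
    _ ≤ 4 * ∫ y in ball x0 (3 * r), g y ^ 2 := by
        rw [← integral_indicator measurableSet_ball]
        refine mul_le_mul_of_nonneg_left ?_ (by norm_num)
        refine integral_mono (sq_int fc fcs)
          ((intOn_ball (gc.pow 2) x0 (3 * r)).integrable_indicator measurableSet_ball) fun y => ?_
        by_cases hy : y ∈ ball x0 (3 * r)
        · rw [Set.indicator_of_mem hy]
          simp only [hf, mul_pow]
          have a1 := η.nonneg (x := y)
          have a2 := η.le_one (x := y)
          have : (η y) ^ 2 ≤ 1 := by nlinarith
          nlinarith [sq_nonneg (g y)]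
        · rw [Set.indicator_of_notMem hy]
          have : η y = 0 := η.zero_of_le_dist (by simpa using hy)
          simp [hf, this]

lemma conv_dist {d : ℕ} {φ G w : Ed d → ℝ} (h : Kern φ G) (hw : Continuous w) {s : ℝ} (hs : 0 < s)
    {x : Ed d} {z ε : ℝ} (hε : 0 ≤ ε) (hz : ∀ y ∈ ball x (2 * s), dist (w y) z ≤ ε) :
    dist (conv (Ph φ s) w x) z ≤ ε := by
  rw [conv_eq']
  refine dist_convolution_le (R := 2 * s) hε ?_ (Ph_nn h hs) (Ph_int h hs)
    hw.aestronglyMeasurable hz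
  intro y hy
  by_contra hy'
  refine hy (kr_zero hs h.sφ y ?_)
  rw [mem_ball_zero_iff, not_lt] at hy'
  linarith

lemma limit_est {d : ℕ} {φ G w : Ed d → ℝ} (h : Kern φ G) (hw : Continuous w) {r A : ℝ}
    (hr : 0 < r) (x0 : Ed d)
    (hA : ∀ n : ℕ, ∫ x in ball x0 r, (conv (Ph φ (r / 2 ^ n)) w x) ^ 2 ≤ A) :
    ∫ x in ball x0 r, w x ^ 2 ≤ A := by
  have s0 : ∀ n : ℕ, 0 < r / 2 ^ n := fun n => by positivity
  obtain ⟨B, hB⟩ := (isCompact_closedBall x0 (3 * r)).exists_bound_of_continuousOn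
    hw.continuousOn
  have B0 : 0 ≤ B := (norm_nonneg _).trans (hB x0 (mem_closedBall_self (by positivity)))
  refine le_of_tendsto' (tendsto_integral_of_dominated_convergence (fun _ => B ^ 2)
    (F := fun n x => (conv (Ph φ (r / 2 ^ n)) w x) ^ 2) ?_ ?_ ?_ ?_) hA
  · intro n
    exact ((conv_continuous (Ph_tst (s0 n) h) hw).pow 2).aestronglyMeasurable
  · exact intOn_ball (f := fun _ => B ^ 2) continuous_const x0 r
  · intro n
    refine (ae_restrict_iff' measurableSet_ball).2 (Eventually.of_forall fun x hx => ?_)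
    have : dist (conv (Ph φ (r / 2 ^ n)) w x) 0 ≤ B := by
      refine conv_dist h hw (s0 n) B0 fun y hy => ?_
      rw [dist_zero_right]
      apply hB
      rw [mem_ball] at hx hy
      rw [mem_closedBall]
      have e : r / 2 ^ n ≤ r := div_le_self hr.le (one_le_pow₀ (by norm_num))
      have := dist_triangle y x x0
      linarith
    rw [dist_zero_right, Real.norm_eq_abs] at this
    rw [Real.norm_eq_abs, abs_pow]
    exact pow_le_pow_left₀ (abs_nonneg _) this 2
  · refine Eventually.of_forall fun x => Tendsto.pow ?_ 2
    rw [Metric.tendsto_atTop]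
    intro ε hε
    obtain ⟨δ, δ0, hδ⟩ := Metric.continuous_iff.1 hw x (ε / 2) (by positivity)
    have t : Tendsto (fun n : ℕ => 2 * (r / 2 ^ n)) atTop (𝓝 0) := by
      have := (tendsto_pow_atTop_nhds_zero_of_lt_one (r := (1 / 2 : ℝ)) (by norm_num)
        (by norm_num)).const_mul (2 * r)
      rw [mul_zero] at this
      refine this.congr fun n => ?_
      rw [div_pow, one_pow]; ring
    obtain ⟨N, hN⟩ := eventually_atTop.1 (t.eventually (gt_mem_nhds δ0))
    refine ⟨N, fun n hn => lt_of_le_of_lt (conv_dist h hw (s0 n) (by positivity) ?_)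
      (half_lt_self hε)⟩
    intro y hy
    refine (hδ y ?_).le
    rw [mem_ball] at hy
    exact hy.trans (hN n hn)

lemma tst_bound {d : ℕ} {K : Ed d → ℝ} (hK : Tst K) : ∃ B, ∀ x, |K x| ≤ B := by
  obtain ⟨B, hB⟩ := hK.comp.exists_bound_of_continuous hK.continuous
  exact ⟨B, hB⟩


lemma exists_n {t : ℝ} (ht : 0 < t) :
    1 ≤ Real.log (2 + t) / Real.log 2 ∧
    ∃ n : ℕ, t ≤ 2 ^ n ∧ (2 * n + 1 : ℝ) ≤ 5 * (Real.log (2 + t) / Real.log 2) := by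
  have l2 : 0 < Real.log 2 := Real.log_pos (by norm_num)
  have h1 : 1 ≤ Real.log (2 + t) / Real.log 2 := by
    rw [le_div_iff₀ l2, one_mul]
    exact Real.log_le_log (by norm_num) (by linarith)
  refine ⟨h1, ⌈Real.logb 2 t⌉₊, ?_, ?_⟩
  · have : Real.logb 2 t ≤ (⌈Real.logb 2 t⌉₊ : ℝ) := Nat.le_ceil _
    rw [Real.logb_le_iff_le_rpow (by norm_num) ht, Real.rpow_natCast] at this
    exact this
  · have h2 : Real.logb 2 t ≤ Real.log (2 + t) / Real.log 2 := by
      unfold Real.logb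
      gcongr
      linarith
    have : (⌈Real.logb 2 t⌉₊ : ℝ) ≤ Real.log (2 + t) / Real.log 2 + 1 := by
      rcases le_or_gt 0 (Real.logb 2 t) with h | h
      · have := Nat.ceil_lt_add_one h
        linarith
      · rw [Nat.ceil_eq_zero.2 h.le]
        push_cast
        linarith
    linarith

lemma Bd.sub' {d : ℕ} {f g : Ed d → ℝ} (hf : Continuous f) (hg : Continuous g) {r M : ℝ}
    (h1 : Bd f r M) (h2 : Bd g r M) : Bd (fun y => f y - g y) r (2 * M) := by
  intro x
  have i1 : IntegrableOn (fun y => 2 * f y ^ 2) (ball x r) :=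
    intOn_ball (continuous_const.mul (hf.pow 2)) x r
  have i2 : IntegrableOn (fun y => 2 * g y ^ 2) (ball x r) :=
    intOn_ball (continuous_const.mul (hg.pow 2)) x r
  calc ∫ y in ball x r, (f y - g y) ^ 2 ≤ ∫ y in ball x r, (2 * f y ^ 2 + 2 * g y ^ 2) := by
        refine integral_mono (intOn_ball ((hf.sub hg).pow 2) x r) (i1.add i2) fun y => ?_
        simp only
        nlinarith [sq_nonneg (f y + g y)]
    _ = 2 * (∫ y in ball x r, f y ^ 2) + 2 * ∫ y in ball x r, g y ^ 2 := by
        rw [integral_add i1 i2, integral_const_mul, integral_const_mul]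
    _ ≤ _ := by
        have := h1 x
        have := h2 x
        linarith

lemma w_est {d : ℕ} {φ G u F : Ed d → ℝ} (h : Kern φ G) {B T R M : ℝ} {i j : Fin d}
    (hBφ : ∀ x, |D i (D j φ) x| ≤ B) (hBG : ∀ x, |D i (D j G) x| ≤ B)
    (hu : ContDiff ℝ 2 u) (hF : Continuous F) (hT : 0 < T) (hR : 0 < R) (hM : 0 < M)
    (heq : ∀ x, -(∑ k, D k (D k u) x) + T⁻¹ ^ 2 * u x = F x)
    (bF : Bd F R M) (bu : Bd u R (M * T ^ 2)) (x0 : Ed d) :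
    ∫ x in ball x0 R, (D i (D j u) x) ^ 2 ≤
      ((32 * 3 ^ d * (2 ^ d) ^ 2 + 50 * (B * (3 ^ d * vb d 1) * 2 ^ d) ^ 2) *
        (Real.log (2 + T / R) / Real.log 2) ^ 2) * M ^ 2 * vb d R := by
  set ℓ := Real.log (2 + T / R) / Real.log 2 with hℓ
  set Q := B * (3 ^ d * vb d 1) * 2 ^ d with hQ
  have B0 : 0 ≤ B := (abs_nonneg _).trans (hBφ 0)
  have v1 : 0 < vb d 1 := vb_pos one_pos
  have vR : 0 < vb d R := vb_pos hR
  have Q0 : 0 ≤ Q := by positivity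
  obtain ⟨l1, n, hn, hn2⟩ := exists_n (t := T / R) (by positivity)
  have uc : Continuous u := hu.continuous
  set g : Ed d → ℝ := fun y => ∑ k, D k (D k u) y with hg
  have gc : Continuous g := lap_cont hu
  set w := D i (D j u) with hw
  have wc : Continuous w := DD_cont hu i j
  have bg : Bd g R (2 * M) := by
    have b1 : Bd (fun y => T⁻¹ ^ 2 * u y) R M := by
      intro x
      simp_rw [mul_pow]
      rw [integral_const_mul]
      calc (T⁻¹ ^ 2) ^ 2 * ∫ y in ball x R, u y ^ 2
          ≤ (T⁻¹ ^ 2) ^ 2 * ((M * T ^ 2) ^ 2 * vb d R) := by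
            gcongr
            exact bu x
        _ = _ := by field_simp
    have := Bd.sub' (f := fun y => T⁻¹ ^ 2 * u y) (continuous_const.mul uc) hF b1 bF
    have e : (fun y => T⁻¹ ^ 2 * u y - F y) = g := by
      funext y
      have := heq y
      simp only [hg]
      linarith
    rwa [e] at this
  have hstep : ∀ x s, R ≤ s → |conv (D i (D j (Ga G s))) g x| ≤ 2 * Q * M := by
    intro x s hs
    have s0 : 0 < s := hR.trans_le hs
    rw [Ga_DD h.tG s0]
    refine (conv_bound gc s0 (M := 2 ^ d * (2 * M)) (by positivity)
      (D_zero_of (D_zero_of h.sG)) hBG (bg.up gc hR (by linarith)) x).trans (le_of_eq ?_)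
    rw [abs_one, hQ]; ring
  have hlast : ∀ x, |conv (Ph φ (2 ^ n * R)) w x| ≤ Q * M := by
    intro x
    have ρT : T ≤ 2 ^ n * R := by rwa [div_le_iff₀ hR] at hn
    have p : (1 : ℝ) ≤ 2 ^ n := one_le_pow₀ (by norm_num)
    have ρR : R ≤ 2 ^ n * R := by nlinarith
    set ρ := 2 ^ n * R with hρ
    have ρ0 : 0 < ρ := by positivity
    rw [hw, conv_DD (Ph_tst ρ0 h) hu, Ph_DD h.tφ ρ0]
    refine (conv_bound uc ρ0 (M := 2 ^ d * (M * T ^ 2)) (by positivity)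
      (D_zero_of (D_zero_of fun x hx => h.sφ x (by linarith))) hBφ
      (bu.up uc hR (by linarith)) x).trans ?_
    rw [abs_of_nonneg (by positivity)]
    have : (ρ ^ 2)⁻¹ * T ^ 2 ≤ 1 := by
      rw [inv_mul_le_iff₀ (by positivity), mul_one]
      gcongr
    calc (ρ ^ 2)⁻¹ * (B * (3 ^ d * vb d 1) * (2 ^ d * (M * T ^ 2)))
        = (Q * M) * ((ρ ^ 2)⁻¹ * T ^ 2) := by rw [hQ]; ring
      _ ≤ (Q * M) * 1 := by gcongr
      _ = Q * M := mul_one _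
  have hL : ∀ x, |conv (Ph φ R) w x| ≤ 5 * ℓ * (Q * M) := by
    intro x
    have := tele h hu hR x (hstep x) n
    have := hlast x
    calc |conv (Ph φ R) w x| ≤ (2 * n + 1) * (Q * M) := by
          simp only [← hw] at *
          linarith
      _ ≤ _ := by gcongr
  refine limit_est h wc hR x0 fun m => ?_
  have s0 : 0 < R / 2 ^ m := by positivity
  have c1 : Continuous (conv (Ph φ (R / 2 ^ m)) w) := conv_continuous (Ph_tst s0 h) wc
  have c2 : Continuous (conv (Ph φ R) w) := conv_continuous (Ph_tst hR h) wc
  have i1 : IntegrableOn (fun x => 2 * (conv (Ph φ (R / 2 ^ m)) w x - conv (Ph φ R) w x) ^ 2)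
      (ball x0 R) := intOn_ball (continuous_const.mul ((c1.sub c2).pow 2)) x0 R
  have i2 : IntegrableOn (fun _ : Ed d => 2 * (5 * ℓ * (Q * M)) ^ 2) (ball x0 R) :=
    intOn_ball continuous_const x0 R
  have le := local_est h hu hR i j m x0
  have b3 := bg.up gc hR (by linarith : R ≤ 3 * R) x0
  calc ∫ x in ball x0 R, conv (Ph φ (R / 2 ^ m)) w x ^ 2
      ≤ ∫ x in ball x0 R, (2 * (conv (Ph φ (R / 2 ^ m)) w x - conv (Ph φ R) w x) ^ 2 +
          2 * (5 * ℓ * (Q * M)) ^ 2) := by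
        refine integral_mono (intOn_ball (c1.pow 2) x0 R) (i1.add i2) fun x => ?_
        have h2 : conv (Ph φ R) w x ^ 2 ≤ (5 * ℓ * (Q * M)) ^ 2 := by
          rw [← sq_abs]
          exact pow_le_pow_left₀ (abs_nonneg _) (hL x) 2
        simp only
        nlinarith [sq_nonneg (conv (Ph φ (R / 2 ^ m)) w x - 2 * conv (Ph φ R) w x)]
    _ = 2 * (∫ x in ball x0 R, (conv (Ph φ (R / 2 ^ m)) w x - conv (Ph φ R) w x) ^ 2) +
          2 * (5 * ℓ * (Q * M)) ^ 2 * vb d R := by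
        rw [integral_add i1 i2, integral_const_mul]
        simp [vb_center]
        ring
    _ ≤ 2 * (4 * ((2 ^ d * (2 * M)) ^ 2 * vb d (3 * R))) +
          2 * (5 * ℓ * (Q * M)) ^ 2 * vb d R := by
        gcongr
        exact le.trans (by gcongr)
    _ = (32 * 3 ^ d * (2 ^ d) ^ 2 * 1 + 50 * Q ^ 2 * ℓ ^ 2) * M ^ 2 * vb d R := by
        rw [vb_eq (by positivity : 0 < 3 * R), vb_eq hR, mul_pow 3 R d]
        ring
    _ ≤ (32 * 3 ^ d * (2 ^ d) ^ 2 * ℓ ^ 2 + 50 * Q ^ 2 * ℓ ^ 2) * M ^ 2 * vb d R := by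
        gcongr
        exact one_le_pow₀ l1
    _ = _ := by ring

lemma iter_norm {d : ℕ} {u : Ed d → ℝ} (hu : ContDiff ℝ 2 u) (x : Ed d) :
    ‖iteratedFDeriv ℝ 2 u x‖ ≤ ∑ i, ∑ j, |D i (D j u) x| := by
  refine ContinuousMultilinearMap.opNorm_le_bound (by positivity) fun m => ?_
  have e : ∀ v : Ed d, v = ∑ i, v i • EuclideanSpace.single i (1 : ℝ) := by
    intro v
    ext k
    simp [EuclideanSpace.single, Pi.single_apply]
  have hm : m = ![m 0, m 1] := by
    ext k; fin_cases k <;> rfl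
  have key : iteratedFDeriv ℝ 2 u x m = ∑ i, ∑ j, (m 0 i * m 1 j) * D i (D j u) x := by
    simp_rw [← iter_eq hu x, iteratedFDeriv_two_apply]
    conv_lhs => rw [e (m 0), e (m 1)]
    simp only [map_sum, map_smul, ContinuousLinearMap.sum_apply, ContinuousLinearMap.smul_apply,
      smul_eq_mul, Finset.mul_sum, mul_assoc, Matrix.cons_val_zero, Matrix.cons_val_one]
    rw [Finset.sum_comm]
    exact Finset.sum_congr rfl fun i _ => Finset.sum_congr rfl fun j _ => by ring
  rw [key, Fin.prod_univ_two, Finset.sum_mul]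
  refine (Finset.abs_sum_le_sum_abs _ _).trans (Finset.sum_le_sum fun i _ => ?_)
  rw [Finset.sum_mul]
  refine (Finset.abs_sum_le_sum_abs _ _).trans (Finset.sum_le_sum fun j _ => ?_)
  rw [abs_mul, abs_mul, mul_comm]
  gcongr
  · exact PiLp.norm_apply_le (m 0) i
  · exact PiLp.norm_apply_le (m 1) j

lemma iter_norm_sq {d : ℕ} {u : Ed d → ℝ} (hu : ContDiff ℝ 2 u) (x : Ed d) :
    ‖iteratedFDeriv ℝ 2 u x‖ ^ 2 ≤ (d : ℝ) ^ 2 * ∑ p : Fin d × Fin d, (D p.1 (D p.2 u) x) ^ 2 := by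
  have h1 := iter_norm hu x
  rw [← Finset.sum_product' (f := fun i j => |D i (D j u) x|), Finset.univ_product_univ] at h1
  refine (pow_le_pow_left₀ (norm_nonneg _) h1 2).trans ?_
  refine (sq_sum_le_card_mul_sum_sq).trans (le_of_eq ?_)
  simp [sq]

lemma avg_eq {d : ℕ} (f : Ed d → ℝ) (x : Ed d) (R : ℝ) :
    ⨍ y in ball x R, f y = (∫ y in ball x R, f y) / vb d R := by
  rw [setAverage_eq, vb_center, smul_eq_mul, inv_mul_eq_div]

lemma S2_nonneg {d : ℕ} (R : ℝ) (f : Ed d → ℝ) : 0 ≤ S2 R f := by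
  refine Real.iSup_nonneg fun x => Real.rpow_nonneg ?_ _
  rw [avg_eq]
  exact div_nonneg (integral_nonneg fun y => sq_nonneg _) measureReal_nonneg

lemma scale_bd {d : ℕ} {f : Ed d → ℝ} (hf : Continuous f)
    (h : BddAbove (Set.range fun x : Ed d => ∫ y in ball x 1, (f y) ^ 2)) (R : ℝ) :
    ∃ A, ∀ x, ∫ y in ball x R, f y ^ 2 ≤ A := by
  obtain ⟨A, hA⟩ := h
  exact ⟨_, fun x => fubini_ball (hf.pow 2) (fun _ => sq_nonneg _) one_pos
    (fun z => hA ⟨z, rfl⟩) x⟩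

lemma S2_Bd {d : ℕ} {f : Ed d → ℝ} {A R M : ℝ} (hR : 0 < R)
    (h : ∀ x, ∫ y in ball x R, f y ^ 2 ≤ A) (hM : S2 R f ≤ M) : Bd f R M := by
  intro x
  have v := vb_pos (d := d) hR
  have nn : ∀ x, 0 ≤ ⨍ y in ball x R, (f y) ^ 2 := by
    intro x
    rw [avg_eq]
    exact div_nonneg (integral_nonneg fun y => sq_nonneg _) v.le
  have bdd : BddAbove (Set.range fun x : Ed d => (⨍ y in ball x R, (f y) ^ 2) ^ (1/2 : ℝ)) := by
    refine ⟨(A / vb d R) ^ (1/2 : ℝ), ?_⟩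
    rintro _ ⟨z, rfl⟩
    refine Real.rpow_le_rpow (nn z) ?_ (by norm_num)
    rw [avg_eq]
    have := h z
    gcongr
  have h1 : (⨍ y in ball x R, (f y) ^ 2) ^ (1/2 : ℝ) ≤ M := (le_ciSup bdd x).trans hM
  rw [← Real.sqrt_eq_rpow, Real.sqrt_le_iff, avg_eq, div_le_iff₀ v] at h1
  exact h1.2

lemma hess_est {d : ℕ} {u : Ed d → ℝ} (hu : ContDiff ℝ 2 u) {R K : ℝ} (hR : 0 < R) (x0 : Ed d)
    (h : ∀ i j, ∫ x in ball x0 R, (D i (D j u) x) ^ 2 ≤ K * vb d R) :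
    ⨍ y in ball x0 R, ‖iteratedFDeriv ℝ 2 u y‖ ^ 2 ≤ (d : ℝ) ^ 4 * K := by
  have v := vb_pos (d := d) hR
  rw [avg_eq, div_le_iff₀ v]
  have c : Continuous fun y => ‖iteratedFDeriv ℝ 2 u y‖ ^ 2 :=
    (hu.continuous_iteratedFDeriv (m := 2) le_rfl).norm.pow 2
  have ip : ∀ p ∈ (Finset.univ : Finset (Fin d × Fin d)),
      IntegrableOn (fun y => (D p.1 (D p.2 u) y) ^ 2) (ball x0 R) := fun p _ =>
    intOn_ball ((DD_cont hu p.1 p.2).pow 2) x0 R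
  calc ∫ y in ball x0 R, ‖iteratedFDeriv ℝ 2 u y‖ ^ 2
      ≤ ∫ y in ball x0 R, (d : ℝ) ^ 2 * ∑ p : Fin d × Fin d, (D p.1 (D p.2 u) y) ^ 2 :=
        integral_mono (intOn_ball c x0 R) ((integrable_finsetSum _ ip).const_mul _)
          (iter_norm_sq hu)
    _ = (d : ℝ) ^ 2 * ∑ p : Fin d × Fin d, ∫ y in ball x0 R, (D p.1 (D p.2 u) y) ^ 2 := by
        rw [integral_const_mul, integral_finsetSum _ ip]
    _ ≤ (d : ℝ) ^ 2 * ∑ p : Fin d × Fin d, K * vb d R := by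
        gcongr with p
        exact h _ _
    _ = _ := by
        simp
        ring

lemma exists_B {d : ℕ} {K : Ed d → ℝ} (hK : Tst K) : ∃ B, ∀ i j x, |D i (D j K) x| ≤ B := by
  choose b hb using fun p : Fin d × Fin d => tst_bound ((hK.D (i := p.2)).D (i := p.1))
  refine ⟨∑ p, b p, fun i j x => (hb (i, j) x).trans ?_⟩
  exact Finset.single_le_sum (f := b) (fun p _ => (abs_nonneg _).trans (hb p 0))
    (Finset.mem_univ (i, j))

/-- for the solution of `−Δu + T⁻²u = F` in `ℝ^d`,
`‖∇²u‖_{S²_R} ≤ C log(2 + T/R) ‖F‖_{S²_R}`. -/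
theorem stmt_7 (d : ℕ) :
    ∃ C > 0, ∀ (T : ℝ), 0 < T → ∀ (u F : Ed d → ℝ),
      ContDiff ℝ 2 u →
      (∀ x : Ed d, IntegrableOn (fun y => (F y) ^ 2) (ball x 1)) →
      BddAbove (Set.range fun x : Ed d => ∫ y in ball x 1, (F y) ^ 2) →
      BddAbove (Set.range fun x : Ed d => ∫ y in ball x 1, (u y) ^ 2) →
      BddAbove (Set.range fun x : Ed d => ∫ y in ball x 1, ‖fderiv ℝ u y‖ ^ 2) →
      (∀ x, -(lap u x) + T⁻¹ ^ 2 * u x = F x) →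
      ∀ R : ℝ, 0 < R →
      S2v R (fun x => iteratedFDeriv ℝ 2 u x) ≤ C * Real.log (2 + T / R) * S2 R F := by
  suffices H : ∃ K, 0 ≤ K ∧ ∀ (T : ℝ), 0 < T → ∀ (u F : Ed d → ℝ), ContDiff ℝ 2 u →
      Continuous F →
      BddAbove (Set.range fun x : Ed d => ∫ y in ball x 1, (F y) ^ 2) →
      BddAbove (Set.range fun x : Ed d => ∫ y in ball x 1, (u y) ^ 2) →
      (∀ x, -(∑ k, D k (D k u) x) + T⁻¹ ^ 2 * u x = F x) →
      ∀ R : ℝ, 0 < R → ∀ M, 0 < M → S2 R F ≤ M → ∀ i j x0,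
      ∫ x in ball x0 R, (D i (D j u) x) ^ 2 ≤
        (K * (Real.log (2 + T / R) / Real.log 2) ^ 2) * M ^ 2 * vb d R by
    obtain ⟨K, K0, H⟩ := H
    have l2 : 0 < Real.log 2 := Real.log_pos (by norm_num)
    refine ⟨√((d : ℝ) ^ 4 * K) / Real.log 2 + 1, by positivity, ?_⟩
    intro T hT u F hu _ bF bu _ heq R hR
    simp_rw [lap_eq hu] at heq
    have Fc : Continuous F := by
      have : F = fun x => -(∑ k, D k (D k u) x) + T⁻¹ ^ 2 * u x := funext fun x => (heq x).symm
      rw [this]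
      exact (lap_cont hu).neg.add (continuous_const.mul hu.continuous)
    have S0 := S2_nonneg R F
    have TR : 0 < T / R := by positivity
    have ℓ0 : 0 < Real.log (2 + T / R) := Real.log_pos (by linarith)
    set ℓ := Real.log (2 + T / R) with hℓ
    set c := √((d : ℝ) ^ 4 * K) with hc
    have c0 : 0 ≤ c := Real.sqrt_nonneg _
    refine Real.iSup_le (fun x0 => ?_) (by positivity)
    have k0 : 0 < (c / Real.log 2 + 1) * ℓ := by positivity
    refine le_of_forall_pos_le_add fun ε hε => ?_
    set M := S2 R F + ε / ((c / Real.log 2 + 1) * ℓ) with hM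
    have M0 : 0 < M := by positivity
    have e1 := hess_est hu hR x0 (fun i j =>
      H T hT u F hu Fc bF bu heq R hR M M0 (by rw [hM]; linarith [div_pos hε k0]) i j x0)
    have e2 : (d : ℝ) ^ 4 * (K * (ℓ / Real.log 2) ^ 2 * M ^ 2) = (c * (ℓ / Real.log 2) * M) ^ 2 := by
      rw [mul_pow, mul_pow, hc, Real.sq_sqrt (by positivity)]
      ring
    rw [e2] at e1
    rw [← Real.sqrt_eq_rpow]
    calc √(⨍ y in ball x0 R, ‖iteratedFDeriv ℝ 2 u y‖ ^ 2) ≤ c * (ℓ / Real.log 2) * M :=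
          Real.sqrt_le_iff.2 ⟨by positivity, e1⟩
      _ = (c / Real.log 2) * ℓ * M := by ring
      _ ≤ (c / Real.log 2 + 1) * ℓ * M := by gcongr; linarith
      _ = _ := by
          rw [hM, mul_add, mul_div_cancel₀ _ k0.ne']
  rcases Nat.eq_zero_or_pos d with rfl | hd
  · exact ⟨0, le_rfl, fun _ _ _ _ _ _ _ _ _ _ _ _ _ _ i => i.elim0⟩
  obtain ⟨φ, G, a1, a2, a3, a4, a5, a6, a7⟩ := exists_kernel d hd
  have h : Kern φ G := ⟨a1, a2, a3, a4, a5, a6, a7⟩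
  obtain ⟨B1, hB1⟩ := exists_B a1
  obtain ⟨B2, hB2⟩ := exists_B a2
  refine ⟨32 * 3 ^ d * (2 ^ d) ^ 2 + 50 * (max B1 B2 * (3 ^ d * vb d 1) * 2 ^ d) ^ 2,
    by positivity, ?_⟩
  intro T hT u F hu hF bF bu heq R hR M hM hS i j x0
  obtain ⟨A, hA⟩ := scale_bd hF bF R
  obtain ⟨A', hA'⟩ := scale_bd hu.continuous bu R
  have b1 : Bd F R M := S2_Bd hR hA hS
  refine w_est h (fun x => (hB1 i j x).trans (le_max_left _ _))
    (fun x => (hB2 i j x).trans (le_max_right _ _)) hu hF hT hR hM heq b1 ?_ x0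
  intro x
  have := sup_bound (lam := T⁻¹ ^ 2) (by positivity) hu hF hR heq b1 hA' x
  rw [← le_div_iff₀' (by positivity)] at this
  refine this.trans (le_of_eq ?_)
  field_simp
end
end
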